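/- arXiv:1409.8223 — 2 statements merged into one kernel-verified Lean document; each statement's English description precedes it below -/
import Mathlib

section
/- Let k ∈ ℕ and n ≥ 1, and let I be an ideal of the ring R^k(ℝ^n) of k-regulous functions on ℝ^n. Then the radical of I equals the ideal I(Z(I)) of all k-regulous functions vanishing on the common zero set Z(I) = {x ∈ ℝ^n : g(x) = 0 for all g ∈ I}; that is, f ∈ R^k(ℝ^n) satisfies f^N ∈ I for some N ∈ ℕ if and only if f vanishes identically on Z(I). -/
open MvPolynomial

/-- A function `f : ℝ^n → ℝ` is regulous if it is continuous and agrees with a rational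
function `p/q` wherever `q` does not vanish. -/
def Regulous (n : ℕ) (f : (Fin n → ℝ) → ℝ) : Prop :=
  Continuous f ∧ ∃ p q : MvPolynomial (Fin n) ℝ, q ≠ 0 ∧
    ∀ x : Fin n → ℝ, eval x q ≠ 0 → f x = eval x p / eval x q

/-- The ring `R^k(ℝ^n)` of `k`-regulous functions, as a subring of all functions
`ℝ^n → ℝ`. -/
noncomputable def RegulousRing (n k : ℕ) : Subring ((Fin n → ℝ) → ℝ) where
  carrier := {f | Regulous n f ∧ ContDiff ℝ k f}
  zero_mem' := by
    refine ⟨⟨continuous_const, 0, 1, one_ne_zero, fun x _ => by simp⟩, contDiff_const⟩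
  one_mem' := by
    refine ⟨⟨continuous_const, 1, 1, one_ne_zero, fun x _ => by simp⟩, contDiff_const⟩
  add_mem' := by
    rintro f g ⟨⟨hfc, pf, qf, hqf, hf⟩, hfd⟩ ⟨⟨hgc, pg, qg, hqg, hg⟩, hgd⟩
    refine ⟨⟨hfc.add hgc, pf * qg + pg * qf, qf * qg, mul_ne_zero hqf hqg, ?_⟩,
      hfd.add hgd⟩
    intro x hx
    rw [map_mul] at hx
    have h1 : eval x qf ≠ 0 := left_ne_zero_of_mul hx
    have h2 : eval x qg ≠ 0 := right_ne_zero_of_mul hx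
    show f x + g x = _
    rw [hf x h1, hg x h2, map_add, map_mul, map_mul, map_mul]
    field_simp
  mul_mem' := by
    rintro f g ⟨⟨hfc, pf, qf, hqf, hf⟩, hfd⟩ ⟨⟨hgc, pg, qg, hqg, hg⟩, hgd⟩
    refine ⟨⟨hfc.mul hgc, pf * pg, qf * qg, mul_ne_zero hqf hqg, ?_⟩, hfd.mul hgd⟩
    intro x hx
    rw [map_mul] at hx
    have h1 : eval x qf ≠ 0 := left_ne_zero_of_mul hx
    have h2 : eval x qg ≠ 0 := right_ne_zero_of_mul hx
    show f x * g x = _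
    rw [hf x h1, hg x h2, map_mul, map_mul]
    field_simp
  neg_mem' := by
    rintro f ⟨⟨hfc, pf, qf, hqf, hf⟩, hfd⟩
    refine ⟨⟨hfc.neg, -pf, qf, hqf, ?_⟩, hfd.neg⟩
    intro x hx
    show -f x = _
    rw [hf x hx, map_neg, neg_div]



theorem exists_derivation_ne_zero {R L : Type} [CommRing R] [IsDomain R] [CharZero R] [Field L]
    [Algebra R L] (a : L) (ha : Transcendental R a) : ∃ D : Derivation R L L, D a ≠ 0 := by
  have hinj : Function.Injective (algebraMap R L) := by
    rw [injective_iff_map_eq_zero]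
    intro r hr
    by_contra hne
    exact ha ⟨Polynomial.C r, by simpa using hne, by simpa using hr⟩
  haveI : FaithfulSMul R L := (faithfulSMul_iff_algebraMap_injective R L).2 hinj
  haveI : CharZero L := charZero_of_injective_algebraMap hinj
  have hai : AlgebraicIndepOn R id ({a} : Set L) := by
    simpa using ha
  obtain ⟨t, hat, ht⟩ := exists_isTranscendenceBasis_superset hai
  let P := Algebra.adjoin R (Set.range ((↑) : t → L))
  haveI halg : Algebra.IsAlgebraic P L := ht.isAlgebraic
  letI : Algebra (FractionRing P) L := FractionRing.liftAlgebra P L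
  haveI : Algebra.IsAlgebraic (FractionRing P) L :=
    (IsFractionRing.comap_isAlgebraic_iff (A := P) (K := FractionRing P) (C := L)).1 halg
  haveI : Algebra.FormallyEtale (FractionRing P) L := Algebra.FormallyEtale.of_isSeparable _ L
  haveI : Algebra.FormallyEtale P (FractionRing P) := .of_isLocalization (nonZeroDivisors _)
  haveI : Algebra.FormallyEtale P L := .comp _ (FractionRing P) _
  let e : MvPolynomial t R ≃ₐ[R] P := ht.1.aevalEquiv
  let a' : t := ⟨a, hat rfl⟩
  let φ : MvPolynomial t R →ₐ[R] L := aeval ((↑) : t → L)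
  have he : ∀ q, ((e q : P) : L) = φ q := by
    intro q
    exact ht.1.algebraMap_aevalEquiv q
  have he' : ∀ x : P, φ (e.symm x) = (x : L) := by
    intro x; rw [← he]; simp
  let D0 : Derivation R P L := Derivation.mk'
    (φ.toLinearMap ∘ₗ (pderiv a' : Derivation R (MvPolynomial t R) (MvPolynomial t R)).toLinearMap
      ∘ₗ e.symm.toLinearMap) (by
      intro x y
      simp [he', Algebra.smul_def, Derivation.leibniz])
  let l : TensorProduct P L (Ω[P⁄R]) →ₗ[L] L := D0.liftKaehlerDifferential.liftBaseChange L
  let E := KaehlerDifferential.tensorKaehlerEquivOfFormallyEtale R P L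
  refine ⟨(l ∘ₗ E.symm.toLinearMap).compDer (KaehlerDifferential.D R L), ?_⟩
  have key : a = algebraMap P L (e (X a')) := by
    change _ = ((e (X a') : P) : L)
    rw [he]; simp [φ, a']
  change l (E.symm (KaehlerDifferential.D R L a)) ≠ 0
  rw [key, KaehlerDifferential.tensorKaehlerEquivOfFormallyEtale_symm_D_algebraMap]
  have : D0 (e (X a')) = 1 := by
    change φ (pderiv a' (e.symm (e (X a')))) = 1
    simp
  simp [l, this]

theorem exists_poly_aeval_mem {R S : Type} [CommRing R] [IsDomain R] [CharZero R] [CommRing S]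
    [Algebra R S] (J : Ideal S) (Ψ : S)
    (h : ∀ (L : Type) [Field L] [Algebra R L] (f : S →ₐ[R] L), (∀ j ∈ J, f j = 0) →
      ∀ D : Derivation R L L, D (f Ψ) = 0) :
    ∃ P : Polynomial R, P ≠ 0 ∧ Polynomial.aeval Ψ P ∈ J := by
  by_contra hcon
  push Not at hcon
  let M : Submonoid S := (nonZeroDivisors (Polynomial R)).map (Polynomial.aeval Ψ : Polynomial R →ₐ[R] S)
  have hdis : Disjoint (J : Set S) M := by
    rw [Set.disjoint_left]
    rintro x hx ⟨P, hP, rfl⟩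
    exact hcon P (nonZeroDivisors.ne_zero hP) hx
  obtain ⟨Q, hQ, hJQ, hQM⟩ := Ideal.exists_le_prime_disjoint J M hdis
  let L := FractionRing (S ⧸ Q)
  let f : S →ₐ[R] L := (IsScalarTower.toAlgHom R (S ⧸ Q) L).comp (Ideal.Quotient.mkₐ R Q)
  have hf0 : ∀ j, f j = 0 ↔ j ∈ Q := by
    intro j
    change algebraMap (S ⧸ Q) L (Ideal.Quotient.mk Q j) = 0 ↔ _
    rw [FaithfulSMul.algebraMap_eq_zero_iff, Ideal.Quotient.eq_zero_iff_mem]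
  have htr : Transcendental R (f Ψ) := by
    rintro ⟨P, hP0, hP⟩
    rw [Polynomial.aeval_algHom_apply, hf0] at hP
    exact Set.disjoint_left.1 hQM hP ⟨P, mem_nonZeroDivisors_of_ne_zero hP0, rfl⟩
  obtain ⟨D, hD⟩ := exists_derivation_ne_zero _ htr
  exact hD (h L f (fun j hj => (hf0 j).2 (hJQ hj)) D)

/-- critical values are algebraic -/
theorem exists_poly_critical {R : Type} [CommRing R] [IsDomain R] [CharZero R] {n : ℕ}
    (A B : MvPolynomial (Fin n) R) :
    ∃ P : Polynomial R, P ≠ 0 ∧ ∀ (φ : R →+* ℝ) (x : Fin n → ℝ), eval₂ φ x B ≠ 0 →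
      (∀ i, eval₂ φ x (B * pderiv i A - A * pderiv i B) = 0) →
      P.eval₂ φ (eval₂ φ x A / eval₂ φ x B) = 0 := by
  let S := Polynomial (MvPolynomial (Fin n) R)
  let cc : MvPolynomial (Fin n) R →ₐ[R] S := IsScalarTower.toAlgHom R (MvPolynomial (Fin n) R) S
  let z : S := Polynomial.X
  let J : Ideal S := Ideal.span (insert (z * cc B - 1)
    (Set.range fun i => cc (B * pderiv i A - A * pderiv i B)))
  obtain ⟨P, hP0, hP⟩ := exists_poly_aeval_mem (R := R) J (cc A * z) (by
    intro L _ _ f hf D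
    have h1 : f z * f (cc B) = 1 := by
      have := hf (z * cc B - 1) (Ideal.subset_span (Set.mem_insert _ _))
      rw [map_sub, map_mul, map_one, sub_eq_zero] at this
      exact this
    have h2 : ∀ i, f (cc B) * f (cc (pderiv i A)) = f (cc A) * f (cc (pderiv i B)) := by
      intro i
      have := hf _ (Ideal.subset_span (Set.mem_insert_of_mem _ ⟨i, rfl⟩))
      simp only [map_sub, map_mul, sub_eq_zero] at this
      exact this
    let ψ : MvPolynomial (Fin n) R →ₐ[R] L := f.comp cc
    have chain : ∀ q, D (ψ q) = ∑ i, ψ (pderiv i q) * D (ψ (X i)) := by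
      intro q
      induction q using MvPolynomial.induction_on with
      | C a =>
        have : ψ (C a) = algebraMap R L a := ψ.commutes a
        rw [this]; simp
      | add p q hp hq => simp [hp, hq, add_mul, Finset.sum_add_distrib]
      | mul_X p j hp =>
        simp only [map_mul, Derivation.leibniz, hp, smul_eq_mul, map_add, add_mul,
          Finset.sum_add_distrib, pderiv_X, Finset.mul_sum]
        congr 1
        · rw [Finset.sum_eq_single j] <;> simp [Pi.single_apply, eq_comm] <;> try tauto
        · apply Finset.sum_congr rfl; intros; ring
    have h3 : f (cc B) * D (ψ A) = f (cc A) * D (ψ B) := by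
      rw [chain A, chain B, Finset.mul_sum, Finset.mul_sum]
      apply Finset.sum_congr rfl
      intro i _
      have := h2 i
      change _ * (f (cc _) * _) = _ * (f (cc _) * _)
      rw [← mul_assoc, this, mul_assoc]
    have h4 : f z * D (ψ B) + f (cc B) * D (f z) = 0 := by
      have := congrArg D h1
      rw [Derivation.leibniz, Derivation.map_one_eq_zero] at this
      exact this
    rw [map_mul, Derivation.leibniz]
    change f (cc A) * D (f z) + f z * D (ψ A) = 0
    have hB : f (cc B) ≠ 0 := right_ne_zero_of_mul_eq_one h1
    have : f (cc B) * (f (cc A) * D (f z) + f z * D (ψ A)) = 0 := by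
      linear_combination f (cc A) * h4 + f z * h3
    exact (mul_eq_zero.1 this).resolve_left hB)
  refine ⟨P, hP0, fun φ x hB hcrit => ?_⟩
  let ev : S →+* ℝ := Polynomial.eval₂RingHom (eval₂Hom φ x) (eval₂ φ x B)⁻¹
  have hcc : ∀ q, ev (cc q) = eval₂ φ x q := by
    intro q
    change Polynomial.eval₂ (eval₂Hom φ x) _ (Polynomial.C q) = _
    rw [Polynomial.eval₂_C]; rfl
  have hz : ev z = (eval₂ φ x B)⁻¹ := Polynomial.eval₂_X _ _
  have hJ : J ≤ RingHom.ker ev := by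
    rw [Ideal.span_le]
    rintro j (rfl | ⟨i, rfl⟩)
    · simp only [SetLike.mem_coe, RingHom.mem_ker, map_sub, map_mul, hcc, hz, map_one]
      rw [inv_mul_cancel₀ hB, sub_self]
    · simp only [SetLike.mem_coe, RingHom.mem_ker, hcc]
      exact hcrit i
  have := hJ hP
  rw [RingHom.mem_ker, Polynomial.aeval_def, Polynomial.hom_eval₂, map_mul, hcc, hz] at this
  rw [div_eq_mul_inv]
  convert this using 2
  ext r
  change _ = ev (cc (C r))
  rw [hcc]; simp


theorem dense_ne_zero {ι : Type} [Finite ι] (q : MvPolynomial ι ℝ) (hq : q ≠ 0) :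
    Dense {x : ι → ℝ | eval x q ≠ 0} := by
  have := Fintype.ofFinite ι
  intro x
  by_contra hx
  rw [mem_closure_iff_frequently, Filter.not_frequently] at hx
  have h1 : AnalyticOnNhd ℝ (fun x : ι → ℝ => eval x q) Set.univ :=
    AnalyticOnNhd.eval_mvPolynomial q
  have h2 := h1.eq_of_eventuallyEq (g := fun _ => 0) (z₀ := x) (fun _ _ => analyticAt_const) (by
    filter_upwards [hx] with y hy
    simpa using hy)
  exact hq (MvPolynomial.funext fun y => by simpa using congrFun h2 y)

theorem poly_upper (a : Polynomial ℝ) (D : ℕ) (hD : a.natDegree ≤ D) :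
    ∃ c ≥ 0, ∀ m : ℝ, 1 ≤ m → |a.eval m| ≤ c * m ^ D := by
  refine ⟨∑ i ∈ Finset.range (D + 1), |a.coeff i|, Finset.sum_nonneg fun i _ => abs_nonneg _, ?_⟩
  intro m hm
  rw [Polynomial.eval_eq_sum_range' (Nat.lt_succ_of_le hD), Finset.sum_mul]
  refine (Finset.abs_sum_le_sum_abs _ _).trans (Finset.sum_le_sum fun i hi => ?_)
  rw [abs_mul, abs_pow, abs_of_nonneg (by linarith : (0:ℝ) ≤ m)]
  gcongr
  · simpa [Nat.lt_succ_iff] using hi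

theorem poly_lower (a : Polynomial ℝ) (ha : a ≠ 0) :
    ∃ c > 0, ∃ M : ℝ, ∀ m ≥ M, c ≤ |a.eval m| := by
  rcases lt_or_ge 0 a.degree with h | h
  · have := a.abs_tendsto_atTop h
    obtain ⟨M, hM⟩ := Filter.eventually_atTop.1 (this.eventually_ge_atTop 1)
    exact ⟨1, one_pos, M, hM⟩
  · rw [Polynomial.eq_C_of_degree_le_zero h] at ha ⊢
    refine ⟨|a.coeff 0|, by simpa using ha, 0, fun m _ => by simp⟩

theorem evalEval_swap' (P : Polynomial (Polynomial ℝ)) (x y : ℝ) :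
    (Polynomial.Bivariate.swap P).evalEval x y = P.evalEval y x := by
  have : ((Polynomial.evalEvalRingHom x y).comp
     (Polynomial.Bivariate.swap (R := ℝ) : _ →+* Polynomial (Polynomial ℝ))) = Polynomial.evalEvalRingHom y x := by
    ext <;> simp [Polynomial.Bivariate.swap_apply]
  exact congrArg (fun f => f P) this

theorem bivariate_bound (P : Polynomial (Polynomial ℝ)) (hP : P ≠ 0) :
    ∃ (C : ℝ) (D : ℕ) (M : ℝ), 0 ≤ C ∧ ∀ l m : ℝ, 1 ≤ l → M ≤ m → P.evalEval l m = 0 →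
      l ≤ C * m ^ D := by
  set W := Polynomial.Bivariate.swap P with hW
  have hW0 : W ≠ 0 := by simpa [hW] using hP
  obtain ⟨c, hc, M, hM⟩ := poly_lower W.leadingCoeff (by simpa using hW0)
  let D := (Finset.range (W.natDegree + 1)).sup fun i => (W.coeff i).natDegree
  have hex : ∀ i, i ∈ Finset.range (W.natDegree + 1) → ∃ c ≥ 0, ∀ m : ℝ, 1 ≤ m → |(W.coeff i).eval m| ≤ c * m ^ D := by
    intro i hi
    exact poly_upper _ _ (Finset.le_sup (f := fun i => (W.coeff i).natDegree) hi)
  choose! u hu0 hu using hex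
  refine ⟨(∑ i ∈ Finset.range W.natDegree, u i) / c, D, max M 1, ?_, ?_⟩
  · apply div_nonneg _ hc.le
    apply Finset.sum_nonneg
    intro i hi
    exact hu0 i (by simp at hi ⊢; omega)
  intro l m hl hm h
  have hm1 : 1 ≤ m := (le_max_right _ _).trans hm
  have h1 : W.evalEval m l = 0 := by
    rw [hW, evalEval_swap']; exact h
  have h2 : ∑ i ∈ Finset.range (W.natDegree + 1), (W.coeff i).eval m * l ^ i = 0 := by
    rw [← h1, Polynomial.evalEval, Polynomial.eval_eq_sum_range (p := W), Polynomial.eval_finsetSum]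
    simp
  rw [Finset.sum_range_succ] at h2
  have h3 : c ≤ |(W.coeff W.natDegree).eval m| := hM m ((le_max_left _ _).trans hm)
  have hl0 : 0 < l := by linarith
  have h4 : c * l ^ W.natDegree ≤ ∑ i ∈ Finset.range W.natDegree, |(W.coeff i).eval m| * l ^ i := by
    calc c * l ^ W.natDegree ≤ |(W.coeff W.natDegree).eval m| * l ^ W.natDegree := by gcongr
      _ = |(W.coeff W.natDegree).eval m * l ^ W.natDegree| := by
          rw [abs_mul, abs_of_pos (pow_pos hl0 _)]
      _ = |∑ i ∈ Finset.range W.natDegree, (W.coeff i).eval m * l ^ i| := by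
          rw [eq_neg_of_add_eq_zero_right h2, abs_neg]
      _ ≤ ∑ i ∈ Finset.range W.natDegree, |(W.coeff i).eval m * l ^ i| := Finset.abs_sum_le_sum_abs _ _
      _ = _ := by
          refine Finset.sum_congr rfl fun i _ => ?_
          rw [abs_mul, abs_of_pos (pow_pos hl0 _)]
  rcases Nat.eq_zero_or_pos W.natDegree with h0 | h0
  · rw [h0] at h4; simp at h4; linarith
  obtain ⟨J, hJ⟩ : ∃ J, W.natDegree = J + 1 := ⟨W.natDegree - 1, by omega⟩
  have h5 : ∑ i ∈ Finset.range W.natDegree, |(W.coeff i).eval m| * l ^ i ≤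
      ∑ i ∈ Finset.range W.natDegree, (u i * m ^ D) * l ^ J := by
    refine Finset.sum_le_sum fun i hi => ?_
    have hi' := Finset.mem_range.1 hi
    have := hu i (by simp; omega) m hm1
    gcongr
    · exact (abs_nonneg _).trans this
    · omega
  rw [← Finset.sum_mul, ← Finset.sum_mul] at h5
  have h6 := h4.trans h5
  rw [hJ, pow_succ] at h6
  rw [div_mul_eq_mul_div, le_div_iff₀ hc]
  have h7 : 0 < l ^ J := pow_pos hl0 _
  rw [hJ]
  nlinarith


theorem hasDerivAt_eval_update {n : ℕ} (a : MvPolynomial (Fin n) ℝ) (x : Fin n → ℝ) (i : Fin n) :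
    HasDerivAt (fun t => eval (Function.update x i t) a) (eval x (pderiv i a)) (x i) := by
  induction a using MvPolynomial.induction_on with
  | C c => simpa using hasDerivAt_const (x i) c
  | add p q hp hq => simpa using hp.fun_add hq
  | mul_X p j hp =>
    have h1 : HasDerivAt (fun t => Function.update x i t j) (eval x (pderiv i (X j : MvPolynomial (Fin n) ℝ))) (x i) := by
      by_cases h : j = i
      · subst h; simpa using hasDerivAt_id' (x j)
      · rw [pderiv_X_of_ne h]
        simpa [Function.update_of_ne h] using hasDerivAt_const (x i) (x j)
    have := hp.mul h1
    simp only [Derivation.leibniz, smul_eq_mul, map_add, map_mul, eval_X]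
    simp only [Function.update_eq_self] at this
    refine (this.congr_deriv ?_).congr_of_eventuallyEq ?_
    · ring
    · filter_upwards with t
      simp

theorem crit_of_isLocalMin {n : ℕ} (a b : MvPolynomial (Fin n) ℝ) (x : Fin n → ℝ) (hb : eval x b ≠ 0)
    (h : IsLocalMin (fun y => eval y a / eval y b) x) (i : Fin n) :
    eval x (b * pderiv i a - a * pderiv i b) = 0 := by
  have h1 := (hasDerivAt_eval_update a x i).div (hasDerivAt_eval_update b x i) (by simpa using hb)
  have hc : Continuous (fun t : ℝ => Function.update x i t) := by fun_prop
  have h2 : IsLocalMin (fun t => eval (Function.update x i t) a / eval (Function.update x i t) b) (x i) := by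
    have := h
    unfold IsLocalMin IsMinFilter at this ⊢
    have h3 : Filter.Tendsto (fun t : ℝ => Function.update x i t) (nhds (x i)) (nhds x) := by
      simpa using hc.tendsto (x i)
    simpa using h3.eventually this
  have h3 := h2.hasDerivAt_eq_zero h1
  simp only [Function.update_eq_self] at h3
  rw [div_eq_zero_iff] at h3
  rcases h3 with h3 | h3
  · simp only [map_sub, map_mul]; linarith
  · exact absurd h3 (pow_ne_zero _ hb)

/-- sum of squares of the coordinates -/
noncomputable def sqPoly (n : ℕ) : MvPolynomial (Fin n) ℝ := ∑ i, X i ^ 2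

noncomputable def Psi {n : ℕ} (p Q r : MvPolynomial (Fin n) ℝ) (l e : ℝ) (x : Fin n → ℝ) : ℝ :=
  l * (eval x r / eval x Q) ^ 2 + eval x (sqPoly n) + (eval x Q / eval x p) ^ 2 + e / eval x Q ^ 2

open Polynomial in
theorem exists_trivar {n : ℕ} (p Q r : MvPolynomial (Fin n) ℝ) :
    ∃ P : ℝ[X][X][X], P ≠ 0 ∧ ∀ (l e : ℝ) (x : Fin n → ℝ), MvPolynomial.eval x p ≠ 0 → MvPolynomial.eval x Q ≠ 0 →
      IsLocalMin (Psi p Q r l e) x → P.eval₂ (Polynomial.evalEvalRingHom l e) (Psi p Q r l e x) = 0 := by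
  let c : ℝ →+* ℝ[X][X] := Polynomial.C.comp Polynomial.C
  let μ : MvPolynomial (Fin n) ℝ →+* MvPolynomial (Fin n) ℝ[X][X] := MvPolynomial.map c
  have hφ : ∀ l e : ℝ, (Polynomial.evalEvalRingHom l e).comp c = RingHom.id ℝ := by
    intro l e; ext; simp [c]
  have hμ : ∀ l e a, MvPolynomial.map (Polynomial.evalEvalRingHom l e) (μ a) = a := by
    intro l e a
    simp only [μ, MvPolynomial.map_map, hφ, MvPolynomial.map_id]
  let A : MvPolynomial (Fin n) ℝ[X][X] := (MvPolynomial.C (Polynomial.C (Polynomial.X : ℝ[X])) * μ r ^ 2 + MvPolynomial.C Polynomial.X) * μ p ^ 2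
    + μ (sqPoly n) * μ p ^ 2 * μ Q ^ 2 + μ Q ^ 4
  let B : MvPolynomial (Fin n) ℝ[X][X] := μ p ^ 2 * μ Q ^ 2
  obtain ⟨P, hP0, hP⟩ := exists_poly_critical A B
  refine ⟨P, hP0, fun l e x hp hQ hmin => ?_⟩
  set φ := Polynomial.evalEvalRingHom l e with hφd
  have hA : MvPolynomial.map φ A = (MvPolynomial.C l * r ^ 2 + MvPolynomial.C e) * p ^ 2 + sqPoly n * p ^ 2 * Q ^ 2 + Q ^ 4 := by
    simp [A, hφd, hμ]
  have hB : MvPolynomial.map φ B = p ^ 2 * Q ^ 2 := by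
    simp [B, hφd, hμ]
  have hPsi : ∀ y, MvPolynomial.eval y p ≠ 0 → MvPolynomial.eval y Q ≠ 0 →
      MvPolynomial.eval y (MvPolynomial.map φ A) / MvPolynomial.eval y (MvPolynomial.map φ B) = Psi p Q r l e y := by
    intro y hp hQ
    rw [hA, hB, Psi]
    simp
    field_simp
    ring
  have hBx : MvPolynomial.eval x (MvPolynomial.map φ B) ≠ 0 := by
    rw [hB]; simp [hp, hQ]
  have hev : ∀ᶠ y in nhds x, MvPolynomial.eval y (MvPolynomial.map φ A) / MvPolynomial.eval y (MvPolynomial.map φ B) = Psi p Q r l e y := by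
    have h1 := (MvPolynomial.continuous_eval p).continuousAt.eventually_ne hp
    have h2 := (MvPolynomial.continuous_eval Q).continuousAt.eventually_ne hQ
    filter_upwards [h1, h2] with y h1 h2 using hPsi y h1 h2
  have hmin' : IsLocalMin (fun y => MvPolynomial.eval y (MvPolynomial.map φ A) / MvPolynomial.eval y (MvPolynomial.map φ B)) x := by
    refine hmin.congr ?_
    filter_upwards [hev] with y hy using hy.symm
  have := hP φ x (by rwa [MvPolynomial.eval₂_eq_eval_map]) (fun i => by
    rw [MvPolynomial.eval₂_eq_eval_map]
    have := crit_of_isLocalMin _ _ x hBx hmin' i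
    simpa [MvPolynomial.pderiv_map] using this)
  rwa [MvPolynomial.eval₂_eq_eval_map, MvPolynomial.eval₂_eq_eval_map, hPsi x hp hQ] at this

theorem sq_le_sqPoly {n : ℕ} (x : Fin n → ℝ) (i : Fin n) : x i ^ 2 ≤ eval x (sqPoly n) := by
  simp only [sqPoly, map_sum, map_pow, eval_X]
  exact Finset.single_le_sum (f := fun i => x i ^ 2) (fun _ _ => sq_nonneg _) (Finset.mem_univ i)

theorem sqPoly_nonneg {n : ℕ} (x : Fin n → ℝ) : 0 ≤ eval x (sqPoly n) := by
  simp only [sqPoly, map_sum, map_pow, eval_X]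
  exact Finset.sum_nonneg fun _ _ => sq_nonneg _

theorem isCompact_sqPoly {n : ℕ} (M : ℝ) : IsCompact {x : Fin n → ℝ | eval x (sqPoly n) ≤ M} := by
  refine Metric.isCompact_of_isClosed_isBounded (isClosed_le (continuous_eval _) continuous_const) ?_
  refine (Metric.isBounded_closedBall (x := (0 : Fin n → ℝ)) (r := |M| + 1)).subset ?_
  intro x hx
  simp only [Metric.mem_closedBall, dist_zero_right]
  rw [pi_norm_le_iff_of_nonneg (by positivity)]
  intro i
  have h1 : x i ^ 2 ≤ M := (sq_le_sqPoly x i).trans hx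
  rw [Real.norm_eq_abs]
  apply abs_le_of_sq_le_sq _ (by positivity)
  nlinarith [le_abs_self M, abs_nonneg M]


theorem exists_min_Psi {n : ℕ} (p Q r : MvPolynomial (Fin n) ℝ) (f : (Fin n → ℝ) → ℝ)
    (hf : Continuous f) (hfp : ∀ x, eval x Q ≠ 0 → f x = eval x p / eval x Q)
    (y0 : Fin n → ℝ) (hy0 : eval y0 p ≠ 0 ∧ eval y0 Q ≠ 0) (l e : ℝ) (hl : 0 ≤ l) (he : 0 < e) :
    ∃ x, (eval x p ≠ 0 ∧ eval x Q ≠ 0) ∧ ∀ y, (eval y p ≠ 0 ∧ eval y Q ≠ 0) →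
      Psi p Q r l e x ≤ Psi p Q r l e y := by
  set M := Psi p Q r l e y0 with hM
  let K : Set (Fin n → ℝ) := {x | eval x (sqPoly n) ≤ M} ∩ ({x | 1 ≤ M * f x ^ 2} ∩ {x | e ≤ M * eval x Q ^ 2})
  have hK : IsCompact K := by
    refine (isCompact_sqPoly M).inter_right (IsClosed.inter ?_ ?_)
    · exact isClosed_le continuous_const (by fun_prop)
    · exact isClosed_le continuous_const (continuous_const.mul ((continuous_eval Q).pow 2))
  have hKU : ∀ x ∈ K, eval x p ≠ 0 ∧ eval x Q ≠ 0 := by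
    rintro x ⟨-, h2, h3⟩
    simp only [Set.mem_ofPred_eq] at h2 h3
    have hQ : eval x Q ≠ 0 := by
      intro h; rw [h] at h3; simp at h3; linarith
    refine ⟨?_, hQ⟩
    intro h
    rw [hfp x hQ, h] at h2
    simp at h2; linarith
  have hUK : ∀ x, (eval x p ≠ 0 ∧ eval x Q ≠ 0) → Psi p Q r l e x ≤ M → x ∈ K := by
    rintro x ⟨h1, h2⟩ h3
    have hfx : (eval x Q / eval x p) ^ 2 = 1 / f x ^ 2 := by
      rw [hfp x h2]; field_simp
    have hf0 : f x ≠ 0 := by rw [hfp x h2]; exact div_ne_zero h1 h2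
    unfold Psi at h3
    rw [hfx] at h3
    have a1 : 0 ≤ l * (eval x r / eval x Q) ^ 2 := by positivity
    have a2 := sqPoly_nonneg x
    have a3 : 0 ≤ 1 / f x ^ 2 := by positivity
    have a4 : 0 ≤ e / eval x Q ^ 2 := by positivity
    refine ⟨?_, ?_, ?_⟩
    · simp only [Set.mem_ofPred_eq]; linarith
    · simp only [Set.mem_ofPred_eq]
      rw [← div_le_iff₀ (by positivity)]; linarith
    · simp only [Set.mem_ofPred_eq]
      rw [← div_le_iff₀ (by positivity)]; linarith
  have hc : ContinuousOn (Psi p Q r l e) K := by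
    have h1 : ∀ a : MvPolynomial (Fin n) ℝ, ContinuousOn (fun x => eval x a) K := fun a =>
      (continuous_eval a).continuousOn
    unfold Psi
    refine ((((continuousOn_const.mul (((h1 r).div (h1 Q) ?_).pow 2)).add (h1 _)).add
      (((h1 Q).div (h1 p) ?_).pow 2))).add (continuousOn_const.div ((h1 Q).pow 2) ?_)
    · exact fun x hx => (hKU x hx).2
    · exact fun x hx => (hKU x hx).1
    · exact fun x hx => pow_ne_zero _ (hKU x hx).2
  obtain ⟨x, hx, hmin⟩ := hK.exists_isMinOn ⟨y0, hUK y0 hy0 le_rfl⟩ hc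
  refine ⟨x, hKU x hx, fun y hy => ?_⟩
  by_cases h : Psi p Q r l e y ≤ M
  · exact hmin (hUK y hy h)
  · exact (hmin (hUK y0 hy0 le_rfl)).trans (not_le.1 h).le

open Polynomial in
theorem eval₂_joint_continuous (P : ℝ[X][X][X]) (l : ℝ) :
    Continuous (fun z : ℝ × ℝ => P.eval₂ (evalEvalRingHom l z.1) z.2) := by
  simp only [eval₂_eq_sum_range]
  refine continuous_finsetSum _ fun i _ => Continuous.mul ?_ (by fun_prop)
  have : ∀ z : ℝ × ℝ, evalEvalRingHom l z.1 (P.coeff i) = ((P.coeff i).map (evalRingHom l)).eval z.1 := by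
    intro z
    rw [map_evalRingHom_eval]; rfl
  simp only [this]
  exact (Polynomial.continuous _).comp continuous_fst

open Polynomial in
theorem exists_bivar {n : ℕ} (p Q r : MvPolynomial (Fin n) ℝ) (f : (Fin n → ℝ) → ℝ)
    (hf : Continuous f) (hfp : ∀ x, MvPolynomial.eval x Q ≠ 0 → f x = MvPolynomial.eval x p / MvPolynomial.eval x Q)
    (y0 : Fin n → ℝ) (hy0 : MvPolynomial.eval y0 p ≠ 0 ∧ MvPolynomial.eval y0 Q ≠ 0) :
    ∃ P : ℝ[X][X], P ≠ 0 ∧ ∀ l m : ℝ, 0 ≤ l →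
      IsGLB (Psi p Q r l 0 '' {x | MvPolynomial.eval x p ≠ 0 ∧ MvPolynomial.eval x Q ≠ 0}) m → P.evalEval l m = 0 := by
  obtain ⟨P, hP0, hP⟩ := exists_trivar p Q r
  have hprime : Prime (Polynomial.C Polynomial.X : ℝ[X][X][X]) := Polynomial.prime_C_iff.2 Polynomial.prime_X
  obtain ⟨j, P1, hnd, hPP⟩ := WfDvdMonoid.max_power_factor hP0 hprime.irreducible
  have hnd' : P1.map (evalRingHom (0 : ℝ[X])) ≠ 0 := by
    intro h
    apply hnd
    rw [Polynomial.C_dvd_iff_dvd_coeff]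
    intro i
    rw [Polynomial.X_dvd_iff]
    have := congrArg (fun q => Polynomial.coeff q i) h
    simpa [Polynomial.coeff_zero_eq_eval_zero] using this
  refine ⟨_, hnd', fun l m hl hm => ?_⟩
  have key : ∀ e : ℝ, 0 < e → ∃ x, (MvPolynomial.eval x p ≠ 0 ∧ MvPolynomial.eval x Q ≠ 0) ∧
      (∀ y, (MvPolynomial.eval y p ≠ 0 ∧ MvPolynomial.eval y Q ≠ 0) → Psi p Q r l e x ≤ Psi p Q r l e y) ∧
      P1.eval₂ (evalEvalRingHom l e) (Psi p Q r l e x) = 0 := by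
    intro e he
    obtain ⟨x, hx, hmin⟩ := exists_min_Psi p Q r f hf hfp y0 hy0 l e hl he
    refine ⟨x, hx, hmin, ?_⟩
    have hloc : IsLocalMin (Psi p Q r l e) x := by
      have h1 := (MvPolynomial.continuous_eval p).continuousAt.eventually_ne hx.1
      have h2 := (MvPolynomial.continuous_eval Q).continuousAt.eventually_ne hx.2
      filter_upwards [h1, h2] with y h1 h2 using hmin y ⟨h1, h2⟩
    have := hP l e x hx.1 hx.2 hloc
    rw [hPP] at this
    simp only [Polynomial.eval₂_mul, Polynomial.eval₂_pow, Polynomial.eval₂_C, mul_eq_zero] at this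
    rcases this with h | h
    · exfalso
      simp at h
      exact he.ne' h.1
    · exact h
  choose! X hXU hXmin hXP using key
  have hge : ∀ e > 0, m ≤ Psi p Q r l e (X e) := by
    intro e he
    have h1 := hm.1 ⟨X e, hXU e he, rfl⟩
    refine h1.trans ?_
    unfold Psi
    have : 0 ≤ e / MvPolynomial.eval (X e) Q ^ 2 := by positivity
    simp only [zero_div]; linarith
  have hlim : Filter.Tendsto (fun e => Psi p Q r l e (X e)) (nhdsWithin 0 (Set.Ioi 0)) (nhds m) := by
    rw [tendsto_order]
    constructor
    · intro a ha
      filter_upwards [self_mem_nhdsWithin] with e he using lt_of_lt_of_le ha (hge e he)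
    · intro a ha
      obtain ⟨b, ⟨y, hy, rfl⟩, hb⟩ := (isGLB_lt_iff hm).1 ha
      have hcont : Continuous (fun e => Psi p Q r l e y) := by unfold Psi; fun_prop
      have h1 : ∀ᶠ e in nhdsWithin 0 (Set.Ioi 0), Psi p Q r l e y < a :=
        (hcont.tendsto 0).mono_left nhdsWithin_le_nhds |>.eventually_lt_const hb
      filter_upwards [h1, self_mem_nhdsWithin] with e h1 he
      exact (hXmin e he y hy).trans_lt h1
  have hid : Filter.Tendsto (fun e : ℝ => e) (nhdsWithin 0 (Set.Ioi 0)) (nhds 0) := nhdsWithin_le_nhds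
  have h3 := ((eval₂_joint_continuous P1 l).tendsto (0, m)).comp (hid.prodMk_nhds hlim)
  have h4 : Filter.Tendsto (fun _ : ℝ => (0:ℝ)) (nhdsWithin 0 (Set.Ioi 0)) (nhds (P1.eval₂ (evalEvalRingHom l 0) m)) := by
    refine h3.congr' ?_
    filter_upwards [self_mem_nhdsWithin] with e he using hXP e he
  have h5 := tendsto_nhds_unique h4 tendsto_const_nhds
  rw [← h5, ← map_evalRingHom_eval, Polynomial.eval_map, Polynomial.eval₂_map]
  congr 1
  ext <;> simp


theorem psi_growth {n : ℕ} (f g : (Fin n → ℝ) → ℝ) (hf : Continuous f) (hg : Continuous g)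
    (hz : ∀ x, g x = 0 → f x = 0) (M : ℝ) : ∃ l0 : ℝ, 1 ≤ l0 ∧ ∀ l ≥ l0, ∀ x, f x ≠ 0 →
      M ≤ l * g x ^ 2 + eval x (sqPoly n) + 1 / f x ^ 2 := by
  let K : Set (Fin n → ℝ) := {x | eval x (sqPoly n) ≤ M} ∩ {x | 1 ≤ M * f x ^ 2}
  have hK : IsCompact K := by
    refine (isCompact_sqPoly M).inter_right ?_
    exact isClosed_le continuous_const (by fun_prop)
  have hxK : ∀ x, f x ≠ 0 → eval x (sqPoly n) + 1 / f x ^ 2 ≤ M → x ∈ K := by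
    intro x hx h
    have h1 := sqPoly_nonneg x
    have h2 : 0 < 1 / f x ^ 2 := by positivity
    refine ⟨by simp only [Set.mem_ofPred_eq]; linarith, ?_⟩
    simp only [Set.mem_ofPred_eq]
    rw [← div_le_iff₀ (by positivity)]; linarith
  obtain ⟨μ, hμ, hμK⟩ : ∃ μ > 0, ∀ x ∈ K, μ ≤ g x ^ 2 := by
    rcases K.eq_empty_or_nonempty with h | h
    · exact ⟨1, one_pos, by simp [h]⟩
    · obtain ⟨x, hx, hmin⟩ := hK.exists_isMinOn h (f := fun x => g x ^ 2) (by fun_prop)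
      refine ⟨g x ^ 2, ?_, fun y hy => hmin hy⟩
      have : g x ≠ 0 := by
        intro h0
        have := hx.2
        simp only [Set.mem_ofPred_eq, hz x h0] at this
        norm_num at this
      positivity
  refine ⟨max 1 (M / μ), le_max_left _ _, fun l hl x hx => ?_⟩
  have hl1 : 1 ≤ l := (le_max_left _ _).trans hl
  have hl2 : M / μ ≤ l := (le_max_right _ _).trans hl
  have h1 := sqPoly_nonneg x
  have h2 : 0 < 1 / f x ^ 2 := by positivity
  by_cases h : eval x (sqPoly n) + 1 / f x ^ 2 ≤ M
  · have h3 := hμK x (hxK x hx h)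
    rw [div_le_iff₀ hμ] at hl2
    have : l * μ ≤ l * g x ^ 2 := by gcongr
    linarith
  · have : 0 ≤ l * g x ^ 2 := by positivity
    linarith

theorem lojasiewicz {n : ℕ} (p Q r : MvPolynomial (Fin n) ℝ) (f g : (Fin n → ℝ) → ℝ)
    (hf : Continuous f) (hg : Continuous g) (hp0 : p ≠ 0) (hQ0 : Q ≠ 0)
    (hfp : ∀ x, eval x Q ≠ 0 → f x = eval x p / eval x Q)
    (hgr : ∀ x, eval x Q ≠ 0 → g x = eval x r / eval x Q)
    (hz : ∀ x, g x = 0 → f x = 0) :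
    ∃ (N : ℕ) (w : (Fin n → ℝ) → ℝ), Continuous w ∧ (∀ x, 0 ≤ w x) ∧ ∀ x, |f x| ^ N ≤ w x * g x ^ 2 := by
  have hdense := dense_ne_zero (p * Q) (mul_ne_zero hp0 hQ0)
  have hU : {x | eval x (p * Q) ≠ 0} = {x | eval x p ≠ 0 ∧ eval x Q ≠ 0} := by
    ext x; simp
  rw [hU] at hdense
  obtain ⟨y0, hy0⟩ := hdense.nonempty
  obtain ⟨P, hP0, hP⟩ := exists_bivar p Q r f hf hfp y0 hy0
  obtain ⟨C, D, M, hC, hb⟩ := bivariate_bound P hP0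
  obtain ⟨l0, hl01, hgrow⟩ := psi_growth f g hf hg hz M
  have hpsi : ∀ l x, (eval x p ≠ 0 ∧ eval x Q ≠ 0) → Psi p Q r l 0 x =
      l * g x ^ 2 + eval x (sqPoly n) + 1 / f x ^ 2 := by
    rintro l x ⟨h1, h2⟩
    rw [Psi, hfp x h2, hgr x h2]; field_simp; ring
  have hf0 : ∀ x, (eval x p ≠ 0 ∧ eval x Q ≠ 0) → f x ≠ 0 := by
    rintro x ⟨h1, h2⟩
    rw [hfp x h2]; exact div_ne_zero h1 h2
  have h1 : ∀ l ≥ l0, ∀ x, (eval x p ≠ 0 ∧ eval x Q ≠ 0) → l ≤ C * (l * g x ^ 2 + eval x (sqPoly n) + 1 / f x ^ 2) ^ D := by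
    intro l hl x hx
    have hl0 : 0 ≤ l := by linarith
    set S := Psi p Q r l 0 '' {x | eval x p ≠ 0 ∧ eval x Q ≠ 0} with hS
    have hSb : ∀ b ∈ S, max M 0 ≤ b := by
      rintro _ ⟨y, hy, rfl⟩
      rw [hpsi l y hy]
      refine max_le (hgrow l hl y (hf0 y hy)) ?_
      have := sqPoly_nonneg y
      positivity
    have hglb : IsGLB S (sInf S) := isGLB_csInf ⟨_, y0, hy0, rfl⟩ ⟨max M 0, hSb⟩
    have hm := le_csInf (⟨_, y0, hy0, rfl⟩ : S.Nonempty) hSb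
    have h2 := hb l (sInf S) (by linarith) ((le_max_left _ _).trans hm) (hP l _ hl0 hglb)
    refine h2.trans ?_
    have h3 := hglb.1 ⟨x, hx, rfl⟩
    rw [hpsi l x hx] at h3
    have h4 : 0 ≤ sInf S := (le_max_right _ _).trans hm
    gcongr
  have h2 : ∀ l ≥ l0, ∀ x, l * (f x ^ 2) ^ D ≤ C * (l * g x ^ 2 * f x ^ 2 + eval x (sqPoly n) * f x ^ 2 + 1) ^ D := by
    intro l hl x
    have hc := continuous_eval (sqPoly n)
    have hcl : IsClosed {x | l * (f x ^ 2) ^ D ≤ C * (l * g x ^ 2 * f x ^ 2 + eval x (sqPoly n) * f x ^ 2 + 1) ^ D} :=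
      isClosed_le (by fun_prop) (by fun_prop)
    have := closure_minimal (s := {x | eval x p ≠ 0 ∧ eval x Q ≠ 0}) (h₂ := hcl) (by
      intro x hx
      have h3 := h1 l hl x hx
      have h4 := hf0 x hx
      have h5 : l * g x ^ 2 * f x ^ 2 + eval x (sqPoly n) * f x ^ 2 + 1 =
        (l * g x ^ 2 + eval x (sqPoly n) + 1 / f x ^ 2) * f x ^ 2 := by field_simp
      simp only [Set.mem_ofPred_eq]
      rw [h5, mul_pow, ← mul_assoc]
      gcongr)
    exact this (hdense x)
  refine ⟨2 * D + 2, fun x => f x ^ 4 * (C * 2 ^ D * (1 + eval x (sqPoly n) * f x ^ 2) ^ D + l0 * (f x ^ 2) ^ D), ?_, ?_, ?_⟩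
  · have hc := continuous_eval (sqPoly n)
    fun_prop
  · intro x
    have := sqPoly_nonneg x
    have : 0 ≤ l0 := by linarith
    positivity
  intro x
  have hs := sqPoly_nonneg x
  have hl00 : 0 ≤ l0 := by linarith
  have hN : |f x| ^ (2 * D + 2) = (f x ^ 2) ^ D * f x ^ 2 := by
    rw [pow_add, pow_mul, sq_abs]
  rw [hN]
  by_cases hfx : f x = 0
  · simp [hfx]
  have hgx : g x ≠ 0 := fun h => hfx (hz x h)
  set T := eval x (sqPoly n) * f x ^ 2 + 1 with hT
  have hT1 : 1 ≤ T := by have := mul_nonneg hs (sq_nonneg (f x)); linarith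
  have hf2 : 0 < f x ^ 2 := by positivity
  have hg2 : 0 < g x ^ 2 := by positivity
  have hcomm : 1 + eval x (sqPoly n) * f x ^ 2 = T := by rw [hT]; ring
  simp only [hcomm]
  by_cases hl : l0 ≤ T / (f x ^ 2 * g x ^ 2)
  · have h3 := h2 _ hl x
    have h5 : T / (f x ^ 2 * g x ^ 2) * g x ^ 2 * f x ^ 2 + eval x (sqPoly n) * f x ^ 2 + 1 = 2 * T := by
      have : T / (f x ^ 2 * g x ^ 2) * g x ^ 2 * f x ^ 2 = T := by field_simp
      rw [this, hT]; ring
    rw [h5, mul_pow, div_mul_eq_mul_div, div_le_iff₀ (by positivity)] at h3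
    have h6 : (f x ^ 2) ^ D * f x ^ 2 ≤ (T * (f x ^ 2) ^ D) * f x ^ 2 := by
      have : (f x ^ 2) ^ D ≤ T * (f x ^ 2) ^ D := le_mul_of_one_le_left (by positivity) hT1
      gcongr
    have h7 : (T * (f x ^ 2) ^ D) * f x ^ 2 ≤ (C * (2 ^ D * T ^ D) * (f x ^ 2 * g x ^ 2)) * f x ^ 2 := by gcongr
    have h8 : 0 ≤ f x ^ 4 * (l0 * (f x ^ 2) ^ D) * g x ^ 2 := by positivity
    nlinarith
  · rw [not_le, div_lt_iff₀ (by positivity)] at hl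
    have h6 : 1 ≤ l0 * (f x ^ 2 * g x ^ 2) := by linarith
    have h7 : (f x ^ 2) ^ D * f x ^ 2 * 1 ≤ (f x ^ 2) ^ D * f x ^ 2 * (l0 * (f x ^ 2 * g x ^ 2)) := by gcongr
    have h8 : 0 ≤ f x ^ 4 * (C * 2 ^ D * T ^ D) * g x ^ 2 := by positivity
    nlinarith


section quot
variable {E : Type} [NormedAddCommGroup E] [NormedSpace ℝ E] [FiniteDimensional ℝ E]

theorem quot_bound {E : Type} (f G w A : E → ℝ) (N : ℕ)
    (hw : ∀ x, 0 ≤ w x) (hb : ∀ x, |f x| ^ N ≤ w x * |G x|) (hz : ∀ x, G x = 0 → f x = 0)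
    (r M : ℕ) (hM : N * r + 1 ≤ M) (x : E) :
    |A x * f x ^ M / G x ^ r| ≤ |A x| * w x ^ r * |f x| ^ (M - N * r) := by
  have hw' := hw x
  by_cases h : G x = 0
  · rw [hz x h, zero_pow (by omega)]
    simp only [mul_zero, zero_div, abs_zero]
    positivity
  · have hG : 0 < |G x| := abs_pos.2 h
    rw [abs_div, abs_mul, abs_pow, abs_pow, div_le_iff₀ (by positivity)]
    have h1 : |f x| ^ M = |f x| ^ (M - N * r) * (|f x| ^ N) ^ r := by
      rw [← pow_mul, ← pow_add]; congr 1; omega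
    have h2 : (|f x| ^ N) ^ r ≤ (w x * |G x|) ^ r := by gcongr; exact hb x
    rw [h1]
    calc _ ≤ |A x| * (|f x| ^ (M - N * r) * (w x * |G x|) ^ r) := by gcongr
      _ = _ := by rw [mul_pow]; ring

theorem quot_hasFDerivAt {E : Type} [NormedAddCommGroup E] [NormedSpace ℝ E] (f G w A : E → ℝ) (N : ℕ) (hwc : Continuous w)
    (hw : ∀ x, 0 ≤ w x) (hb : ∀ x, |f x| ^ N ≤ w x * |G x|) (hz : ∀ x, G x = 0 → f x = 0)
    (hf : Differentiable ℝ f) (hG : Differentiable ℝ G) (hA : Differentiable ℝ A)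
    (r M : ℕ) (hM : N * r + 2 ≤ M) (x : E) :
    HasFDerivAt (fun x => A x * f x ^ M / G x ^ r)
      ((f x ^ M / G x ^ r) • fderiv ℝ A x + (M * A x * f x ^ (M - 1) / G x ^ r) • fderiv ℝ f x
        + (- (r * A x * f x ^ M / G x ^ (r + 1))) • fderiv ℝ G x) x := by
  by_cases h : G x = 0
  · have hfx := hz x h
    rw [hfx, zero_pow (by omega), zero_pow (by omega)]
    simp only [zero_div, mul_zero, neg_zero, zero_smul, add_zero]
    rw [hasFDerivAt_iff_isLittleO]
    simp only [hfx, zero_pow (show M ≠ 0 by omega), mul_zero, zero_div, sub_zero, zero_apply]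
    have h1 : (fun y => f y) =O[nhds x] fun y => y - x := by
      have := (hf x).isBigO_sub
      simpa [hfx] using this
    have h2 : (fun y => |A y| * w y ^ r * |f y| ^ (M - N * r - 1)) =o[nhds x] fun _ => (1:ℝ) := by
      rw [Asymptotics.isLittleO_one_iff]
      have hc : Continuous (fun y => |A y| * w y ^ r * |f y| ^ (M - N * r - 1)) := by
        have := hA.continuous
        have := hf.continuous
        fun_prop
      have := hc.tendsto x
      simpa [hfx, zero_pow (show M - N * r - 1 ≠ 0 by omega)] using this
    have h3 := h2.mul_isBigO h1.norm_norm
    simp only [one_mul] at h3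
    refine (Asymptotics.IsBigO.of_bound 1 ?_).trans_isLittleO h3.of_norm_right
    filter_upwards with y
    have := quot_bound f G w A N hw hb hz r M (by omega) y
    rw [Real.norm_eq_abs, one_mul]
    refine this.trans (le_of_eq ?_)
    have hwy := hw y
    rw [norm_mul, norm_norm, Real.norm_eq_abs, Real.norm_eq_abs,
      abs_of_nonneg (show 0 ≤ |A y| * w y ^ r * |f y| ^ (M - N * r - 1) by positivity), mul_assoc _ _ |f y|, ← pow_succ]
    congr 2; omega
  · have h0 : HasDerivAt (fun u : ℝ => (u ^ r)⁻¹) (-(r / (G x) ^ (r + 1))) (G x) := by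
      refine ((hasDerivAt_pow r (G x)).fun_inv (pow_ne_zero _ h)).congr_deriv ?_
      rcases r with _ | r
      · simp
      · simp only [Nat.add_sub_cancel]; field_simp; ring
    have h1 := ((hA x).hasFDerivAt.mul ((hf x).hasFDerivAt.pow M)).mul
      (h0.comp_hasFDerivAt x (hG x).hasFDerivAt)
    refine (h1.congr_of_eventuallyEq ?_).congr_fderiv ?_
    · filter_upwards with y
      simp [div_eq_mul_inv]
    · ext v
      simp
      field_simp
      ring

theorem quot_contDiff (f G w : E → ℝ) (N : ℕ) (hwc : Continuous w)
    (hw : ∀ x, 0 ≤ w x) (hb : ∀ x, |f x| ^ N ≤ w x * |G x|) (hz : ∀ x, G x = 0 → f x = 0) (k : ℕ) :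
    ∀ (A : E → ℝ) (_ : ContDiff ℝ k f) (_ : ContDiff ℝ k G) (_ : ContDiff ℝ k A)
    (r M : ℕ) (_ : N * (r + k) + k + 2 ≤ M), ContDiff ℝ k (fun x => A x * f x ^ M / G x ^ r) := by
  induction k with
  | zero =>
    intro A hf hG hA r M hM
    simp only [Nat.cast_zero, contDiff_zero] at *
    simp only [add_zero] at hM
    rw [continuous_iff_continuousAt]
    intro x
    by_cases h : G x = 0
    · have hfx := hz x h
      have hc : Continuous (fun y => |A y| * w y ^ r * |f y| ^ (M - N * r)) := by fun_prop
      have h1 := hc.tendsto x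
      simp only [hfx, abs_zero, zero_pow (show M - N * r ≠ 0 by omega), mul_zero] at h1
      unfold ContinuousAt
      beta_reduce
      rw [hfx, zero_pow (by omega), mul_zero, zero_div]
      exact squeeze_zero_norm (fun y => quot_bound f G w A N hw hb hz r M (by omega) y) h1
    · have := pow_ne_zero r h
      fun_prop (disch := assumption)
  | succ k ih =>
    intro A hf hG hA r M hM
    have hle : ((k : ℕ) : WithTop ℕ∞) ≤ ((k + 1 : ℕ) : WithTop ℕ∞) := by exact_mod_cast Nat.le_succ k
    have hne : ((k + 1 : ℕ) : WithTop ℕ∞) ≠ 0 := by exact_mod_cast Nat.succ_ne_zero k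
    have hM2 : N * r + 2 ≤ M := by nlinarith
    have hfd := hf.differentiable hne
    have hGd := hG.differentiable hne
    have hAd := hA.differentiable hne
    have hder := quot_hasFDerivAt f G w A N hwc hw hb hz hfd hGd hAd r M hM2
    have hf'' := hf.of_le hle
    have hG'' := hG.of_le hle
    have hA'' := hA.of_le hle
    push_cast at hf hG hA ⊢
    rw [contDiff_succ_iff_fderiv_apply] at hf hG hA ⊢
    refine ⟨fun x => (hder x).differentiableAt, fun h => by simp at h, fun v => ?_⟩
    have hf' : ContDiff ℝ k f := by assumption
    have hG' : ContDiff ℝ k G := by assumption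
    have hA' : ContDiff ℝ k A := by assumption
    have e1 := ih (fun x => fderiv ℝ A x v) hf' hG' (hA.2.2 v) r M (by nlinarith)
    have e2 := ih (fun x => M * A x * fderiv ℝ f x v) hf' hG' ((contDiff_const.mul hA').mul (hf.2.2 v)) r (M - 1) (by
      have : N * (r + k) + k + 2 + 1 ≤ M := by nlinarith
      omega)
    have e3 := ih (fun x => - (r * A x * fderiv ℝ G x v)) hf' hG' ((contDiff_const.mul hA').mul (hG.2.2 v)).neg (r + 1) M (by
      nlinarith)
    convert ((e1.add e2).add e3) using 2 with x
    rw [(hder x).fderiv]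
    simp
    ring

end quot


theorem eq_zero_of_rep {n : ℕ} (f : (Fin n → ℝ) → ℝ) (hf : Continuous f) (q : MvPolynomial (Fin n) ℝ)
    (hq : q ≠ 0) (h : ∀ x, eval x q ≠ 0 → f x = 0) : f = 0 := by
  have := (dense_ne_zero q hq)
  exact hf.ext_on this continuous_zero h

theorem pow_mem_of_zeros {n k : ℕ} (I : Ideal (RegulousRing n k)) (f g : RegulousRing n k) (hg : g ∈ I)
    (hz : ∀ x, (g : (Fin n → ℝ) → ℝ) x = 0 → (f : (Fin n → ℝ) → ℝ) x = 0) : ∃ N : ℕ, f ^ N ∈ I := by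
  by_cases hf0 : f = 0
  · exact ⟨1, by simp [hf0]⟩
  obtain ⟨f, hfR⟩ := f
  obtain ⟨g, hgR⟩ := g
  obtain ⟨⟨hfc, pf, qf, hqf, hf⟩, hfd⟩ := id hfR
  obtain ⟨⟨hgc, pg, qg, hqg, hgr⟩, hgd⟩ := id hgR
  simp only at hz
  have hf0' : f ≠ 0 := fun h => hf0 (Subtype.ext h)
  have hpf : pf ≠ 0 := by
    rintro rfl
    exact hf0' (eq_zero_of_rep f hfc qf hqf fun x hx => by simp [hf x hx])
  have hpg : pg ≠ 0 := by
    rintro rfl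
    apply hf0'
    have : g = 0 := (eq_zero_of_rep g hgc qg hqg fun x hx => by simp [hgr x hx])
    funext x
    exact hz x (by simp [this])
  obtain ⟨N, w, hwc, hw, hb⟩ := lojasiewicz (pf * qg) (qf * qg) (pg * qf) f g hfc hgc (mul_ne_zero hpf hqg)
    (mul_ne_zero hqf hqg) (by
      intro x hx
      rw [map_mul] at hx
      have h1 : eval x qf ≠ 0 := left_ne_zero_of_mul hx
      have h2 : eval x qg ≠ 0 := right_ne_zero_of_mul hx
      rw [hf x h1, map_mul, map_mul]; field_simp) (by
      intro x hx
      rw [map_mul] at hx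
      have h1 : eval x qf ≠ 0 := left_ne_zero_of_mul hx
      have h2 : eval x qg ≠ 0 := right_ne_zero_of_mul hx
      rw [hgr x h2, map_mul, map_mul]; field_simp) hz
  have hsm := quot_contDiff f (fun x => g x ^ 2) w N hwc hw (by
      intro x; rw [abs_of_nonneg (sq_nonneg (g x))]; exact hb x) (by
      intro x h; exact hz x (by simpa using h)) k (fun _ => 1) hfd (hgd.pow 2) contDiff_const 1
      (N * (1 + k) + k + 2) le_rfl
  set M := N * (1 + k) + k + 2 with hM
  let h : (Fin n → ℝ) → ℝ := fun x => 1 * f x ^ M / (g x ^ 2) ^ 1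
  have hR : h ∈ RegulousRing n k := by
    refine ⟨⟨hsm.continuous, pf ^ M * qg ^ 3, qf ^ M * pg ^ 2 * qg,
      mul_ne_zero (mul_ne_zero (pow_ne_zero _ hqf) (pow_ne_zero _ hpg)) hqg, ?_⟩, hsm⟩
    intro x hx
    simp only [map_mul, map_pow] at hx ⊢
    have h2 : eval x qg ≠ 0 := right_ne_zero_of_mul hx
    have h3 : eval x qf ≠ 0 := by
      intro h; apply hx; rw [h, zero_pow (by omega)]; simp
    have h4 : eval x pg ≠ 0 := by
      intro h; apply hx; rw [h]; simp
    change 1 * f x ^ M / (g x ^ 2) ^ 1 = _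
    rw [hf x h3, hgr x h2, div_pow, div_pow]; field_simp
  refine ⟨M, ?_⟩
  have : (⟨f, hfR⟩ : RegulousRing n k) ^ M = ⟨h, hR⟩ * ⟨g, hgR⟩ * ⟨g, hgR⟩ := by
    apply Subtype.ext
    funext x
    change f x ^ M = h x * g x * g x
    simp only [h]
    by_cases hx : g x = 0
    · rw [hz x hx, hx, zero_pow (by omega)]; simp
    · field_simp
  rw [this]
  exact I.mul_mem_left _ hg


theorem coeff_of_quotient (φ : ℝ → ℝ) (hφ : ContinuousAt φ 0) (m : ℕ) : ∀ (P Q : Polynomial ℝ)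
    (_ : ∀ s, s ≠ 0 → P.eval s = φ s * Q.eval s) (_ : Polynomial.X ^ m ∣ Q),
    P.coeff m = φ 0 * Q.coeff m := by
  have base : ∀ (P Q : Polynomial ℝ), (∀ s, s ≠ 0 → P.eval s = φ s * Q.eval s) → P.coeff 0 = φ 0 * Q.coeff 0 := by
    intro P Q h
    have h1 : Filter.Tendsto (fun s => P.eval s) (nhdsWithin 0 {0}ᶜ) (nhds (P.eval 0)) :=
      (P.continuous.tendsto 0).mono_left nhdsWithin_le_nhds
    have h2 : Filter.Tendsto (fun s => φ s * Q.eval s) (nhdsWithin 0 {0}ᶜ) (nhds (φ 0 * Q.eval 0)) :=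
      (Filter.Tendsto.mul hφ (Q.continuous.tendsto 0)).mono_left nhdsWithin_le_nhds
    rw [Polynomial.coeff_zero_eq_eval_zero, Polynomial.coeff_zero_eq_eval_zero]
    refine tendsto_nhds_unique h1 (h2.congr' ?_)
    filter_upwards [self_mem_nhdsWithin] with s hs using (h s hs).symm
  induction m with
  | zero => intro P Q h _; exact base P Q h
  | succ m ih =>
    intro P Q h hd
    obtain ⟨R, rfl⟩ := hd
    have h0 : P.coeff 0 = 0 := by rw [base P _ h]; simp [pow_succ]
    obtain ⟨P', rfl⟩ := Polynomial.X_dvd_iff.2 h0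
    have h1 : (Polynomial.X : Polynomial ℝ) ^ (m + 1) * R = Polynomial.X * (Polynomial.X ^ m * R) := by ring
    rw [h1] at h ⊢
    rw [Polynomial.coeff_X_mul, Polynomial.coeff_X_mul]
    refine ih P' _ (fun s hs => ?_) ⟨R, rfl⟩
    have := h s hs
    simp only [Polynomial.eval_mul, Polynomial.eval_X] at this ⊢
    apply mul_left_cancel₀ hs
    linarith

theorem restrict_rep {n : ℕ} (f : (Fin n → ℝ) → ℝ) (hf : Continuous f) (p q : MvPolynomial (Fin n) ℝ)
    (hq : q ≠ 0) (hfp : ∀ x, eval x q ≠ 0 → f x = eval x p / eval x q)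
    (J : Ideal (MvPolynomial (Fin n) ℝ)) (x0 : Fin n → ℝ) (hx0 : ∀ j ∈ J, eval x0 j = 0) :
    ∃ p' q' : MvPolynomial (Fin n) ℝ, q' ∉ J ∧ ∀ x, (∀ j ∈ J, eval x j = 0) → f x * eval x q' = eval x p' := by
  have hall : ∀ x, eval x p = f x * eval x q := by
    have : (fun x => eval x p) = fun x => f x * eval x q := by
      refine (continuous_eval p).ext_on (dense_ne_zero q hq) (hf.mul (continuous_eval q)) ?_
      intro x hx
      have hx' : eval x q ≠ 0 := hx
      simp only [hfp x hx']; field_simp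
    exact fun x => congrFun this x
  obtain ⟨y, hy⟩ := (dense_ne_zero q hq).nonempty
  have hy' : eval y q ≠ 0 := hy
  let v := y - x0
  let T : MvPolynomial (Fin n) ℝ →ₐ[ℝ] Polynomial (MvPolynomial (Fin n) ℝ) :=
    aeval (fun i => Polynomial.C (X i) + Polynomial.C (C (v i)) * Polynomial.X)
  have hT : ∀ a x s, ((T a).map (eval x)).eval s = eval (x + s • v) a := by
    intro a x s
    induction a using MvPolynomial.induction_on with
    | C c => simp [T, MvPolynomial.algebraMap_eq]
    | add a b ha hb => simp only [map_add, Polynomial.map_add, Polynomial.eval_add, ha, hb]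
    | mul_X a i ha =>
      simp only [map_mul, Polynomial.map_mul, Polynomial.eval_mul, ha]
      simp [T]
      left; ring
  have hex : ∃ m, (T q).coeff m ∉ J := by
    by_contra hcon
    push Not at hcon
    apply hy'
    have h1 := hT q x0 1
    have h2 : (T q).map (eval x0) = 0 := by
      ext i
      rw [Polynomial.coeff_map]
      simpa using hx0 _ (hcon i)
    rw [h2] at h1
    simp only [Polynomial.eval_zero, one_smul] at h1
    rw [h1]; congr 2; simp [v]
  classical
  refine ⟨(T p).coeff (Nat.find hex), (T q).coeff (Nat.find hex), Nat.find_spec hex, fun x hx => ?_⟩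
  have h1 := coeff_of_quotient (fun s => f (x + s • v)) (by fun_prop) (Nat.find hex) ((T p).map (eval x)) ((T q).map (eval x))
    (fun s _ => by rw [hT, hT]; exact hall _) (by
      rw [Polynomial.X_pow_dvd_iff]
      intro d hd
      rw [Polynomial.coeff_map]
      exact hx _ (not_not.1 (Nat.find_min hex hd)))
  rw [Polynomial.coeff_map, Polynomial.coeff_map] at h1
  simpa using h1.symm


theorem primitive_data {R D : Type} [CommRing R] [IsDomain R] [CharZero R] [CommRing D] [IsDomain D]
    [Algebra R D] [FaithfulSMul R D] [Algebra.IsAlgebraic R D] {n : ℕ} (ξ : Fin n → D) :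
    ∃ (θ : D) (s : R) (G : Fin n → Polynomial R), s ≠ 0 ∧
      ∀ i, algebraMap R D s * ξ i = Polynomial.aeval θ (G i) := by
  let F := FractionRing R
  let K := FractionRing D
  haveI : FaithfulSMul R K := FaithfulSMul.trans R D K
  letI : Algebra F K := FractionRing.liftAlgebra R K
  haveI : IsScalarTower R F K := inferInstance
  haveI : CharZero F := charZero_of_injective_algebraMap (IsFractionRing.injective R F)
  have hinjD : Function.Injective (algebraMap D K) := IsFractionRing.injective D K
  have hinjR : Function.Injective (algebraMap R K) := FaithfulSMul.algebraMap_injective R K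
  have hinjF : Function.Injective (algebraMap R F) := IsFractionRing.injective R F
  have hxi : ∀ d : D, IsAlgebraic F (algebraMap D K d) := by
    intro d
    rw [← IsFractionRing.isAlgebraic_iff R F K]
    exact (Algebra.IsAlgebraic.isAlgebraic (R := R) d).algebraMap
  let ξ' : Fin n → K := fun i => algebraMap D K (ξ i)
  let L := IntermediateField.adjoin F (Set.range ξ')
  haveI : FiniteDimensional F L := IntermediateField.finiteDimensional_adjoin (by
    rintro _ ⟨i, rfl⟩
    exact (hxi (ξ i)).isIntegral)
  obtain ⟨α, hα⟩ := Field.exists_primitive_element F L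
  obtain ⟨a, b, hb, hab⟩ := IsFractionRing.div_surjective (A := D) (α : K)
  obtain ⟨u, hu0, c, hc⟩ := (Algebra.IsAlgebraic.isAlgebraic (R := R) b).exists_nonzero_dvd hb
  have hb0 : algebraMap D K b ≠ 0 := by
    rw [Ne, map_eq_zero_iff _ hinjD]
    exact nonZeroDivisors.ne_zero hb
  let θ : D := a * c
  have hθ : algebraMap D K θ = algebraMap F K (algebraMap R F u) * (α : K) := by
    rw [← IsScalarTower.algebraMap_apply, IsScalarTower.algebraMap_apply R D K, hc, ← hab]
    simp only [θ, map_mul]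
    rw [mul_div_assoc', eq_div_iff hb0, mul_comm (algebraMap D K b), mul_comm (algebraMap D K a), mul_right_comm]
  have huF : algebraMap R F u ≠ 0 := by
    rwa [Ne, map_eq_zero_iff _ hinjF]
  have hex : ∀ i, ∃ (s : R) (G : Polynomial R), s ≠ 0 ∧ algebraMap R D s * ξ i = Polynomial.aeval θ G := by
    intro i
    have h1 : (⟨ξ' i, IntermediateField.subset_adjoin F _ ⟨i, rfl⟩⟩ : L) ∈ (IntermediateField.adjoin F {α}).toSubalgebra := by
      rw [hα]; trivial
    rw [IntermediateField.adjoin_simple_toSubalgebra_of_isAlgebraic (Algebra.IsAlgebraic.isAlgebraic α),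
      Algebra.adjoin_singleton_eq_range_aeval] at h1
    obtain ⟨g, hg⟩ := h1
    have hg2 : Polynomial.aeval α g = (⟨ξ' i, IntermediateField.subset_adjoin F _ ⟨i, rfl⟩⟩ : L) := hg
    have hg' : Polynomial.aeval (α : K) g = ξ' i := by
      have := congrArg (algebraMap L K) hg2
      rw [← Polynomial.aeval_algebraMap_apply] at this
      exact this
    let g' := g.comp (Polynomial.C (algebraMap R F u)⁻¹ * Polynomial.X)
    have hg'' : Polynomial.aeval (algebraMap D K θ) g' = ξ' i := by
      simp only [g', Polynomial.aeval_comp, map_mul, Polynomial.aeval_C, Polynomial.aeval_X]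
      rw [hθ, ← mul_assoc, ← map_mul, inv_mul_cancel₀ huF, map_one, one_mul, hg']
    obtain ⟨s, hs, hsG⟩ := IsLocalization.integerNormalization_spec (nonZeroDivisors R) g'
    refine ⟨s, IsLocalization.integerNormalization (nonZeroDivisors R) g', nonZeroDivisors.ne_zero hs, ?_⟩
    apply hinjD
    have := congrArg (Polynomial.aeval (algebraMap D K θ)) hsG
    rw [Polynomial.aeval_map_algebraMap, Polynomial.aeval_algebraMap_apply] at this
    have h3 : s • g' = (algebraMap R F s) • g' := (algebraMap_smul F s g').symm
    rw [h3, map_smul, hg'', Algebra.smul_def, ← IsScalarTower.algebraMap_apply R F K] at this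
    rw [this, map_mul, ← IsScalarTower.algebraMap_apply R D K]
  choose s G hs hG using hex
  have hd : ∀ i, ∃ u, ∏ j, s j = s i * u := fun i => Finset.dvd_prod_of_mem s (Finset.mem_univ i)
  choose v hv using hd
  refine ⟨θ, ∏ j, s j, fun i => Polynomial.C (v i) * G i, Finset.prod_ne_zero_iff.2 fun i _ => hs i, fun i => ?_⟩
  rw [hv i, map_mul, map_mul, ← hG i, Polynomial.aeval_C]
  ring

theorem minimal_data {R D : Type} [CommRing R] [IsDomain R] [CharZero R] [CommRing D] [IsDomain D]
    [Algebra R D] [FaithfulSMul R D] [Algebra.IsAlgebraic R D] (θ : D) :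
    ∃ F : Polynomial R, F ≠ 0 ∧ Polynomial.aeval θ F = 0 ∧ Polynomial.aeval θ (Polynomial.derivative F) ≠ 0 ∧
      ∀ (ev : R →+* ℝ) (T : ℝ), F.eval₂ ev T = 0 → ev F.leadingCoeff ≠ 0 →
        ∀ H : Polynomial R, Polynomial.aeval θ H = 0 → H.eval₂ ev T = 0 := by
  classical
  have hex : ∃ d, ∃ F : Polynomial R, F ≠ 0 ∧ Polynomial.aeval θ F = 0 ∧ F.natDegree = d := by
    obtain ⟨F, h1, h2⟩ := Algebra.IsAlgebraic.isAlgebraic (R := R) θ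
    exact ⟨_, F, h1, h2, rfl⟩
  obtain ⟨F, hF0, hF, hFd⟩ := Nat.find_spec hex
  have hmin : ∀ H : Polynomial R, Polynomial.aeval θ H = 0 → H.natDegree < F.natDegree → H = 0 := by
    intro H hH hlt
    by_contra hne
    rw [hFd] at hlt
    exact Nat.find_min hex hlt ⟨H, hne, hH, rfl⟩
  have hpos : 0 < F.natDegree := by
    by_contra hcon
    have h0 : F.natDegree = 0 := by omega
    rw [Polynomial.eq_C_of_natDegree_eq_zero h0] at hF hF0
    rw [Polynomial.aeval_C, map_eq_zero_iff _ (FaithfulSMul.algebraMap_injective R D)] at hF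
    exact hF0 (by rw [hF]; simp)
  refine ⟨F, hF0, hF, ?_, ?_⟩
  · intro h
    have := hmin _ h (Polynomial.natDegree_derivative_lt hpos.ne')
    have := Polynomial.derivative_eq_zero.1 this
    omega
  · intro ev T hT hlc
    have key : ∀ d, ∀ H : Polynomial R, H.natDegree < d → Polynomial.aeval θ H = 0 → H.eval₂ ev T = 0 := by
      intro d
      induction d with
      | zero => intro H h; omega
      | succ d ih =>
        intro H hd hH
        by_cases hlt : H.natDegree < F.natDegree
        · rw [hmin H hH hlt]; simp
        push Not at hlt
        have hH0 : H ≠ 0 := by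
          rintro rfl; simp at hlt; omega
        set A := Polynomial.C F.leadingCoeff * H with hA
        set B := F * (Polynomial.C H.leadingCoeff * Polynomial.X ^ (H.natDegree - F.natDegree)) with hB
        have hlF : F.leadingCoeff ≠ 0 := by simpa using hF0
        have hlH : H.leadingCoeff ≠ 0 := by simpa using hH0
        have hA0 : A ≠ 0 := mul_ne_zero (by simpa using hF0) hH0
        have hdA : A.natDegree = H.natDegree := by
          rw [hA, Polynomial.natDegree_C_mul hlF]
        have hB0 : B ≠ 0 := mul_ne_zero hF0 (mul_ne_zero (by simpa using hH0) (by simp))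
        have hdB : B.natDegree = H.natDegree := by
          rw [hB, Polynomial.natDegree_mul hF0 (mul_ne_zero (by simpa using hH0) (by simp)), Polynomial.natDegree_C_mul_X_pow _ _ hlH]
          omega
        have hdeg : (A - B).degree < A.degree := by
          apply Polynomial.degree_sub_lt_left _ hA0
          · rw [hA, hB]
            simp only [Polynomial.leadingCoeff_mul, Polynomial.leadingCoeff_C, Polynomial.leadingCoeff_X_pow, mul_one]
          · rw [Polynomial.degree_eq_natDegree hA0, Polynomial.degree_eq_natDegree hB0, hdA, hdB]
        have h1 : (A - B).eval₂ ev T = 0 := by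
          by_cases hAB : A - B = 0
          · simp [hAB]
          apply ih
          · have := Polynomial.natDegree_lt_natDegree hAB hdeg
            omega
          · simp [hA, hB, hH, hF]
        rw [hA, hB] at h1
        simp only [Polynomial.eval₂_sub, Polynomial.eval₂_mul, hT, zero_mul, sub_zero, Polynomial.eval₂_C] at h1
        exact (mul_eq_zero.1 h1).resolve_left hlc
    exact fun H hH => key _ H (Nat.lt_succ_self _) hH


theorem joint_continuous {ι : Type} [Finite ι] (P : Polynomial (MvPolynomial ι ℝ)) :
    Continuous (fun z : (ι → ℝ) × ℝ => P.eval₂ (eval z.1) z.2) := by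
  simp only [Polynomial.eval₂_eq_sum_range]
  refine continuous_finsetSum _ fun i _ => Continuous.mul ?_ (by fun_prop)
  exact (continuous_eval _).comp continuous_fst

/-- persistence of a simple root -/
theorem root_persist {ι : Type} [Finite ι] (P : Polynomial (MvPolynomial ι ℝ)) (y0 : ι → ℝ) (T0 : ℝ)
    (h0 : P.eval₂ (eval y0) T0 = 0) (h1 : (Polynomial.derivative P).eval₂ (eval y0) T0 ≠ 0) (ε : ℝ) (hε : 0 < ε) :
    ∀ᶠ y in nhds y0, ∃ T, |T - T0| < ε ∧ P.eval₂ (eval y) T = 0 := by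
  have hder : HasDerivAt (fun T => P.eval₂ (eval y0) T) ((Polynomial.derivative P).eval₂ (eval y0) T0) T0 := by
    have := (P.map (eval y0)).hasDerivAt T0
    simpa [Polynomial.eval_map, Polynomial.derivative_map] using this
  -- two points of opposite sign
  obtain ⟨a, b, ha, hb, hab⟩ : ∃ a b, |a - T0| < ε ∧ |b - T0| < ε ∧
      P.eval₂ (eval y0) a < 0 ∧ 0 < P.eval₂ (eval y0) b := by
    by_contra hcon
    push Not at hcon
    have hball : ∀ᶠ T in nhds T0, |T - T0| < ε := by
      have := Metric.ball_mem_nhds T0 hε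
      filter_upwards [this] with T hT
      simpa [Real.dist_eq] using hT
    by_cases hneg : ∃ a, |a - T0| < ε ∧ P.eval₂ (eval y0) a < 0
    · obtain ⟨a, ha, hna⟩ := hneg
      have hmax : IsLocalMax (fun T => P.eval₂ (eval y0) T) T0 := by
        filter_upwards [hball] with b hb
        rw [h0]; exact hcon a b ha hb hna
      exact h1 (hmax.hasDerivAt_eq_zero hder)
    · push Not at hneg
      have hmin : IsLocalMin (fun T => P.eval₂ (eval y0) T) T0 := by
        filter_upwards [hball] with b hb
        rw [h0]; exact hneg b hb
      exact h1 (hmin.hasDerivAt_eq_zero hder)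
  have hc : ∀ T, Continuous (fun y => P.eval₂ (eval y) T) := fun T =>
    (joint_continuous P).comp (by fun_prop : Continuous fun y : ι → ℝ => (y, T))
  have e1 := ((hc a).tendsto y0).eventually_lt_const hab.1
  have e2 := ((hc b).tendsto y0).eventually_const_lt hab.2
  filter_upwards [e1, e2] with y h1 h2
  have hcy : Continuous (fun T => P.eval₂ (eval y) T) :=
    (joint_continuous P).comp (by fun_prop : Continuous fun T : ℝ => (y, T))
  obtain ⟨T, hT, hT0⟩ := intermediate_value_uIcc (a := a) (b := b) (f := fun T => P.eval₂ (eval y) T) hcy.continuousOn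
    (Set.mem_uIcc.2 (Or.inl ⟨h1.le, h2.le⟩))
  refine ⟨T, ?_, hT0⟩
  rw [abs_lt] at *
  rcases Set.mem_uIcc.1 hT with h | h <;> constructor <;> linarith

theorem exists_central {n : ℕ} (J : Ideal (MvPolynomial (Fin n) ℝ)) (hJp : J.IsPrime)
    (hJ : ∀ h, (∀ x, (∀ j ∈ J, eval x j = 0) → eval x h = 0) → h ∈ J)
    (h : MvPolynomial (Fin n) ℝ) (hh : h ∉ J) :
    ∃ x0, (∀ j ∈ J, eval x0 j = 0) ∧ eval x0 h ≠ 0 ∧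
      ∀ q ∉ J, x0 ∈ closure {x | (∀ j ∈ J, eval x j = 0) ∧ eval x q ≠ 0} := by
  let A := MvPolynomial (Fin n) ℝ
  let D := A ⧸ J
  let π : A →ₐ[ℝ] D := Ideal.Quotient.mkₐ ℝ J
  have hπ : ∀ a, π a = 0 ↔ a ∈ J := fun a => Ideal.Quotient.eq_zero_iff_mem
  have hπs : Function.Surjective π := Ideal.Quotient.mk_surjective
  let ξ : Fin n → D := fun i => π (X i)
  have hadj : Algebra.adjoin ℝ (Set.range ξ) = ⊤ := by
    have h1 : Set.range ξ = π '' (Set.range X) := by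
      rw [← Set.range_comp]; rfl
    rw [h1, ← AlgHom.map_adjoin, MvPolynomial.adjoin_range_X, Algebra.map_top]
    exact (AlgHom.range_eq_top _).2 hπs
  haveI : FaithfulSMul ℝ D := (faithfulSMul_iff_algebraMap_injective ℝ D).2 (algebraMap ℝ D).injective
  haveI : Algebra.IsAlgebraic (Algebra.adjoin ℝ (Set.range ξ)) D := by
    constructor
    intro d
    have : d ∈ Algebra.adjoin ℝ (Set.range ξ) := by rw [hadj]; trivial
    exact isAlgebraic_algebraMap (A := D) (⟨d, this⟩ : Algebra.adjoin ℝ (Set.range ξ))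
  obtain ⟨t, htr, ht⟩ := exists_isTranscendenceBasis_subset (R := ℝ) (Set.range ξ)
  haveI : Finite t := (Set.finite_range ξ).subset htr
  choose c hc using fun e : t => htr e.2
  let R := MvPolynomial t ℝ
  let σ : R →ₐ[ℝ] D := aeval ((↑) : t → D)
  have hσi : Function.Injective σ := ht.1
  letI : Algebra R D := σ.toRingHom.toAlgebra
  have hσ : ∀ r : R, algebraMap R D r = σ r := fun _ => rfl
  haveI : FaithfulSMul R D := (faithfulSMul_iff_algebraMap_injective R D).2 hσi
  haveI : Algebra.IsAlgebraic R D := by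
    haveI := ht.isAlgebraic
    refine Algebra.IsAlgebraic.of_ringHom_of_comp_eq (S := Algebra.adjoin ℝ (Set.range ((↑) : t → D))) (B := D)
      ht.1.aevalEquiv (RingHom.id D) ht.1.aevalEquiv.surjective Function.injective_id ?_
    refine RingHom.ext fun r => ?_
    exact ht.1.algebraMap_aevalEquiv r
  obtain ⟨θ, s, G, hs0, hG⟩ := primitive_data (R := R) ξ
  obtain ⟨F, hF0, hF, hF', hconj⟩ := minimal_data (R := R) θ
  obtain ⟨a, ha⟩ := hπs θ
  let τ : R →ₐ[ℝ] A := rename c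
  have hτ : ∀ r, π (τ r) = σ r := by
    intro r
    have : π.comp τ = σ := by
      ext e
      have h1 : τ (X e) = X (c e) := rename_X ..
      have h2 : σ (X e) = (e : D) := aeval_X ..
      rw [AlgHom.comp_apply, h1, h2]
      exact hc e
    exact congrArg (fun f => f r) this
  have hτe : ∀ r x, eval x (τ r) = eval (x ∘ c) r := fun r x => eval_rename ..
  let lift : Polynomial R → A := fun P => P.eval₂ (τ : R →+* A) a
  have hlift : ∀ P, π (lift P) = Polynomial.aeval θ P := by
    intro P
    have : π (lift P) = (π : A →+* D) (P.eval₂ (τ : R →+* A) a) := rfl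
    rw [this, Polynomial.hom_eval₂, Polynomial.aeval_def]
    congr 1
    refine RingHom.ext fun r => ?_
    exact hτ r
  have hlifte : ∀ P x, eval x (lift P) = P.eval₂ (eval (x ∘ c)) (eval x a) := by
    intro P x
    simp only [lift]
    rw [Polynomial.hom_eval₂]
    congr 1
    refine RingHom.ext fun r => ?_
    exact hτe r x
  have hπ0 : ∀ r : R, r ≠ 0 → τ r ∉ J := by
    intro r hr hJ
    rw [← hπ, hτ] at hJ
    exact hr (hσi (by rw [hJ, map_zero]))
  -- choice of x0
  have hprod : h * τ s * τ F.leadingCoeff * lift (Polynomial.derivative F) ∉ J := by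
    intro hmem
    rcases hJp.mem_or_mem hmem with hmem | hmem
    · rcases hJp.mem_or_mem hmem with hmem | hmem
      · rcases hJp.mem_or_mem hmem with hmem | hmem
        · exact hh hmem
        · exact hπ0 _ hs0 hmem
      · exact hπ0 _ (by simpa using hF0) hmem
    · rw [← hπ, hlift] at hmem
      exact hF' hmem
  obtain ⟨x0, hx0, hne⟩ : ∃ x0, (∀ j ∈ J, eval x0 j = 0) ∧
      eval x0 (h * τ s * τ F.leadingCoeff * lift (Polynomial.derivative F)) ≠ 0 := by
    by_contra hcon
    push Not at hcon
    exact hprod (hJ _ hcon)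
  simp only [map_mul, hlifte, hτe] at hne
  set y0 := x0 ∘ c with hy0
  set T0 := eval x0 a with hT0
  have n4 := right_ne_zero_of_mul hne
  have hne := left_ne_zero_of_mul hne
  have n3 := right_ne_zero_of_mul hne
  have hne := left_ne_zero_of_mul hne
  have n2 := right_ne_zero_of_mul hne
  have n1 := left_ne_zero_of_mul hne
  refine ⟨x0, hx0, n1, fun q hq => ?_⟩
  -- relations at x0
  have hrel : ∀ P : Polynomial R, Polynomial.aeval θ P = 0 → P.eval₂ (eval y0) T0 = 0 := by
    intro P hP
    rw [hy0, hT0, ← hlifte]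
    apply hx0
    rw [← hπ, hlift, hP]
  have hFx0 := hrel F hF
  have hGx0 : ∀ i, eval y0 s * x0 i = (G i).eval₂ (eval y0) T0 := by
    intro i
    have : τ s * X i - lift (G i) ∈ J := by
      rw [← hπ, map_sub, map_mul, hτ, hlift, ← hG i, hσ]
      simp [ξ]
    have := hx0 _ this
    rw [map_sub, map_mul, hτe, hlifte, eval_X] at this
    linarith
  -- the denominators for q
  obtain ⟨c0, hc00, b, hb⟩ := (Algebra.IsAlgebraic.isAlgebraic (R := R) (π q)).exists_nonzero_dvd
    (mem_nonZeroDivisors_of_ne_zero (by rwa [Ne, hπ]))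
  obtain ⟨b, rfl⟩ := hπs b
  have hqb : q * b - τ c0 ∈ J := by
    rw [← hπ, map_sub, map_mul, hτ, ← hb, hσ, sub_self]
  -- the point attached to (y, T)
  let pt : (t → ℝ) × ℝ → Fin n → ℝ := fun z i => (G i).eval₂ (eval z.1) z.2 / eval z.1 s
  have hpt0 : pt (y0, T0) = x0 := by
    funext i
    simp only [pt]
    rw [← hGx0 i]; field_simp
  have hptc : ContinuousAt pt (y0, T0) := by
    rw [continuousAt_pi]
    intro i
    exact (joint_continuous (G i)).continuousAt.div ((continuous_eval s).comp continuous_fst).continuousAt n2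
  have hhom : ∀ E : A, ∃ (N : ℕ) (H : Polynomial R), algebraMap R D s ^ N * π E = Polynomial.aeval θ H ∧
      ∀ (y : t → ℝ) (T : ℝ), eval y s ≠ 0 → H.eval₂ (eval y) T = eval y s ^ N * eval (pt (y, T)) E := by
    intro E
    induction E using MvPolynomial.induction_on with
    | C r =>
      refine ⟨0, Polynomial.C (C r), ?_, ?_⟩
      · have h1 : τ (C r) = C r := rename_C ..
        rw [Polynomial.aeval_C, hσ (C r), ← hτ (C r), h1, pow_zero, one_mul]
      · intro y T _; simp
    | add E1 E2 h1 h2 =>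
      obtain ⟨N1, H1, h1, h1'⟩ := h1
      obtain ⟨N2, H2, h2, h2'⟩ := h2
      refine ⟨N1 + N2, Polynomial.C (s ^ N2) * H1 + Polynomial.C (s ^ N1) * H2, ?_, ?_⟩
      · simp only [map_add, map_mul, Polynomial.aeval_C, ← h1, ← h2, map_pow]; ring
      · intro y T hy
        simp only [map_add, Polynomial.eval₂_add, Polynomial.eval₂_mul, Polynomial.eval₂_C, Polynomial.eval₂_pow, h1' y T hy, h2' y T hy, map_pow]
        ring
    | mul_X E i h1 =>
      obtain ⟨N1, H1, h1, h1'⟩ := h1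
      refine ⟨N1 + 1, H1 * G i, ?_, ?_⟩
      · rw [map_mul, map_mul, ← h1, ← hG i]; ring
      · intro y T hy
        rw [Polynomial.eval₂_mul, h1' y T hy, map_mul, eval_X]
        have : (G i).eval₂ (eval y) T = eval y s * pt (y, T) i := by
          simp only [pt]; field_simp
        rw [this]; ring
  have hptV : ∀ (y : t → ℝ) (T : ℝ), eval y s ≠ 0 → eval y F.leadingCoeff ≠ 0 → F.eval₂ (eval y) T = 0 →
      ∀ j ∈ J, eval (pt (y, T)) j = 0 := by
    intro y T hys hyl hyF j hj
    obtain ⟨N, H, h1, h2⟩ := hhom j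
    rw [(hπ j).2 hj, mul_zero] at h1
    have := hconj (eval y) T hyF hyl H h1.symm
    rw [h2 y T hys, mul_eq_zero] at this
    exact this.resolve_left (pow_ne_zero _ hys)
  have hpty : ∀ (y : t → ℝ) (T : ℝ), eval y s ≠ 0 → eval y F.leadingCoeff ≠ 0 → F.eval₂ (eval y) T = 0 →
      pt (y, T) ∘ c = y := by
    intro y T hys hyl hyF
    funext e
    have h1 : Polynomial.aeval θ (Polynomial.C (s * X e) - G (c e)) = 0 := by
      rw [map_sub, Polynomial.aeval_C, ← hG, hc e, map_mul, hσ (X e)]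
      have h2 : σ (X e) = (e : D) := aeval_X ..
      rw [h2, sub_self]
    have h2 := hconj (eval y) T hyF hyl _ h1
    rw [Polynomial.eval₂_sub, Polynomial.eval₂_C, map_mul, eval_X] at h2
    simp only [Function.comp, pt]
    rw [div_eq_iff hys]; linarith
  rw [mem_closure_iff_nhds]
  intro W hW
  have hW' : ∀ᶠ z in nhds (y0, T0), pt z ∈ W := hptc (by rwa [hpt0])
  rw [nhds_prod_eq, Filter.eventually_prod_iff] at hW'
  obtain ⟨pa, hpa, pb, hpb, hW''⟩ := hW'
  obtain ⟨ε, hε, hball⟩ := Metric.eventually_nhds_iff.1 hpb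
  have e1 := root_persist F y0 T0 hFx0 n4 ε hε
  have e2 := (continuous_eval s).continuousAt.eventually_ne n2
  have e3 := (continuous_eval F.leadingCoeff).continuousAt.eventually_ne n3
  have hd := mem_closure_iff_nhds.1 ((dense_ne_zero c0 hc00) y0) _ (hpa.and (e1.and (e2.and e3)))
  obtain ⟨y, ⟨hya, ⟨T, hT, hTF⟩, hys, hyl⟩, hyc⟩ := hd
  refine ⟨pt (y, T), hW'' hya (hball (by rwa [Real.dist_eq])), hptV y T hys hyl hTF, ?_⟩
  intro hq0
  have := hptV y T hys hyl hTF _ hqb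
  rw [map_sub, map_mul, hq0, zero_mul, hτe, hpty y T hys hyl hTF] at this
  exact hyc (by linarith)


theorem exists_single_zero {n k : ℕ} (I : Ideal (RegulousRing n k)) (f : RegulousRing n k)
    (hf : ∀ x : Fin n → ℝ, (∀ g ∈ I, (g : (Fin n → ℝ) → ℝ) x = 0) → (f : (Fin n → ℝ) → ℝ) x = 0)
    (J : Ideal (MvPolynomial (Fin n) ℝ)) :
    ∃ g ∈ I, ∀ x, (∀ j ∈ J, eval x j = 0) → (g : (Fin n → ℝ) → ℝ) x = 0 → (f : (Fin n → ℝ) → ℝ) x = 0 := by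
  induction J using WellFoundedGT.induction with
  | ind J ih =>
  have hsup : ∀ a, a ∉ J → ∃ g ∈ I, ∀ x, (∀ j ∈ J, eval x j = 0) → eval x a = 0 →
      (g : (Fin n → ℝ) → ℝ) x = 0 → (f : (Fin n → ℝ) → ℝ) x = 0 := by
    intro a ha
    obtain ⟨g, hg, h⟩ := ih (J ⊔ Ideal.span {a}) (by
      refine lt_of_le_of_ne le_sup_left fun h => ha ?_
      rw [h]
      exact Ideal.mem_sup_right (Ideal.mem_span_singleton_self a))
    refine ⟨g, hg, fun x hx hxa => h x fun j hj => ?_⟩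
    have hle : J ⊔ Ideal.span {a} ≤ RingHom.ker (eval x) := by
      refine sup_le (fun j hj => hx j hj) ?_
      rw [Ideal.span_singleton_le_iff_mem]
      exact hxa
    exact hle hj
  have hcomb : ∀ g1 ∈ I, ∀ g2 ∈ I, ∃ g ∈ I, ∀ x, (g : (Fin n → ℝ) → ℝ) x = 0 →
      (g1 : (Fin n → ℝ) → ℝ) x = 0 ∧ (g2 : (Fin n → ℝ) → ℝ) x = 0 := by
    intro g1 h1 g2 h2
    refine ⟨g1 * g1 + g2 * g2, I.add_mem (I.mul_mem_left _ h1) (I.mul_mem_left _ h2), fun x hx => ?_⟩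
    have hx' : (g1 : (Fin n → ℝ) → ℝ) x * (g1 : (Fin n → ℝ) → ℝ) x + (g2 : (Fin n → ℝ) → ℝ) x * (g2 : (Fin n → ℝ) → ℝ) x = 0 := hx
    constructor <;> nlinarith
  by_cases hJ : ∀ h, (∀ x, (∀ j ∈ J, eval x j = 0) → eval x h = 0) → h ∈ J
  swap
  · push Not at hJ
    obtain ⟨h, h1, h2⟩ := hJ
    obtain ⟨g, hg, hgx⟩ := hsup h h2
    exact ⟨g, hg, fun x hx => hgx x hx (h1 x hx)⟩
  by_cases hp : J.IsPrime
  swap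
  · rw [Ideal.not_isPrime_iff] at hp
    rcases hp with rfl | ⟨a, ha, b, hb, hab⟩
    · refine ⟨0, I.zero_mem, fun x hx => ?_⟩
      have := hx 1 trivial
      simp at this
    · obtain ⟨g1, hg1, h1⟩ := hsup a ha
      obtain ⟨g2, hg2, h2⟩ := hsup b hb
      obtain ⟨g, hg, h⟩ := hcomb g1 hg1 g2 hg2
      refine ⟨g, hg, fun x hx hgx => ?_⟩
      have := hx _ hab
      rw [map_mul, mul_eq_zero] at this
      rcases this with h0 | h0
      · exact h1 x hx h0 (h x hgx).1
      · exact h2 x hx h0 (h x hgx).2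
  obtain ⟨x0, hx0⟩ : ∃ x0 : Fin n → ℝ, ∀ j ∈ J, eval x0 j = 0 := by
    by_contra hcon
    push Not at hcon
    apply hp.ne_top
    rw [Ideal.eq_top_iff_one]
    apply hJ
    intro x hx
    obtain ⟨j, hj, hne⟩ := hcon x
    exact absurd (hx j hj) hne
  have hrep : ∀ g : RegulousRing n k, ∃ p' q' : MvPolynomial (Fin n) ℝ, q' ∉ J ∧
      ∀ x, (∀ j ∈ J, eval x j = 0) → (g : (Fin n → ℝ) → ℝ) x * eval x q' = eval x p' := by
    rintro ⟨g, ⟨hgc, p, q, hq, hg⟩, hgd⟩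
    exact restrict_rep g hgc p q hq hg J x0 hx0
  choose P Q hQ hPQ using hrep
  by_cases hex : ∃ g ∈ I, P g ∉ J
  · obtain ⟨g1, hg1, hP⟩ := hex
    obtain ⟨g2, hg2, h2⟩ := hsup _ hP
    obtain ⟨g, hg, h⟩ := hcomb g1 hg1 g2 hg2
    refine ⟨g, hg, fun x hx hgx => h2 x hx ?_ (h x hgx).2⟩
    rw [← hPQ g1 x hx, (h x hgx).1, zero_mul]
  push Not at hex
  by_cases hPf : P f ∈ J
  · obtain ⟨g, hg, h⟩ := hsup _ (hQ f)
    refine ⟨g, hg, fun x hx hgx => ?_⟩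
    have h1 := hPQ f x hx
    rw [hx _ hPf, mul_eq_zero] at h1
    rcases h1 with h1 | h1
    · exact h1
    · exact h x hx h1 hgx
  exfalso
  obtain ⟨y, hy, hyP, hcl⟩ := exists_central J hp hJ (P f) hPf
  have : ∀ g ∈ I, (g : (Fin n → ℝ) → ℝ) y = 0 := by
    intro g hg
    have hclosed : IsClosed {x | (g : (Fin n → ℝ) → ℝ) x = 0} := isClosed_eq g.2.1.1 continuous_const
    refine closure_minimal ?_ hclosed (hcl (Q g) (hQ g))
    rintro x ⟨hx, hxq⟩
    have := hPQ g x hx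
    rw [hx _ (hex g hg), mul_eq_zero] at this
    exact this.resolve_right hxq
  apply hyP
  rw [← hPQ f y hy, hf y this, zero_mul]

/-- Nullstellensatz for `R^k(ℝ^n)`: for an ideal `I` of `R^k(ℝ^n)`, an
element `f` satisfies `f^N ∈ I` for some `N` if and only if `f` vanishes on the common
zero set of `I`. -/
theorem nullstellensatz_regulousRing
    (n k : ℕ) (hn : 1 ≤ n) (I : Ideal (RegulousRing n k)) (f : RegulousRing n k) :
    (∃ N : ℕ, f ^ N ∈ I) ↔
      ∀ x : Fin n → ℝ, (∀ g ∈ I, (g : (Fin n → ℝ) → ℝ) x = 0) →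
        (f : (Fin n → ℝ) → ℝ) x = 0 := by
  constructor
  · rintro ⟨N, hN⟩ x hx
    have h : (f : (Fin n → ℝ) → ℝ) x ^ N = 0 := hx _ hN
    exact eq_zero_of_pow_eq_zero h
  · intro hf
    obtain ⟨g, hg, h⟩ := exists_single_zero I f hf ⊥
    refine pow_mem_of_zeros I f g hg fun x hx => h x ?_ hx
    intro j hj
    rw [Ideal.mem_bot.1 hj, map_zero]
end

section
/- Let n ≥ 1 and let f : ℝ^n → ℝ be a regulous function with f(x) ≥ 0 for all x ∈ ℝ^n. Then there exist m ∈ ℕ and regulous functions f₁, …, f_m : ℝ^n → ℝ such that f = f₁² + ⋯ + f_m² pointwise on ℝ^n. -/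
open MvPolynomial

namespace H17

/-- A subfield in which `-1` is not a sum of squares. -/
def FR {Ω : Type} [Field Ω] (L : Subfield Ω) : Prop :=
  ∀ l : List Ω, (∀ x ∈ l, x ∈ L) → (l.map (fun x => x * x)).sum ≠ -1

/-- Polynomial intermediate value property. -/
def PIVT (R : Type) [Field R] [LinearOrder R] : Prop :=
  ∀ (p : Polynomial R) (a b : R), a < b → p.eval a < 0 → 0 < p.eval b →
    ∃ c, a < c ∧ c < b ∧ p.eval c = 0

lemma FR_sSup {Ω : Type} [Field Ω] (c : Set (Subfield Ω)) (hc : IsChain (· ≤ ·) c)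
    (hne : c.Nonempty) (h : ∀ L ∈ c, FR L) : FR (sSup c) := by
  intro l hl
  have hd : DirectedOn (· ≤ ·) c := hc.directedOn
  have key : ∀ l : List Ω, (∀ x ∈ l, x ∈ sSup c) → ∃ M ∈ c, ∀ x ∈ l, x ∈ M := by
    intro l
    induction l with
    | nil => intro _; obtain ⟨M, hM⟩ := hne; exact ⟨M, hM, by simp⟩
    | cons a l ih =>
      intro h
      obtain ⟨M, hM, hM2⟩ := ih (fun x hx => h x (by simp [hx]))
      obtain ⟨N, hN, hN2⟩ := (Subfield.mem_sSup_of_directedOn hne hd).1 (h a (by simp))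
      obtain ⟨P, hP, h1, h2⟩ := hd M hM N hN
      refine ⟨P, hP, ?_⟩
      intro x hx
      rcases List.mem_cons.1 hx with rfl | hx
      · exact h2 hN2
      · exact h1 (hM2 x hx)
  obtain ⟨M, hM, hM2⟩ := key l hl
  exact h M hM l hM2

lemma FR_adjoin {Ω : Type} [Field Ω] (L : Subfield Ω) (f : Polynomial L) (hf : Irreducible f)
    (θ : Ω) (hθ : Polynomial.aeval θ f = 0)
    (h : ∀ l : List (Polynomial L), ¬ f ∣ 1 + (l.map (fun x => x * x)).sum) :
    ∃ L' : Subfield Ω, L ≤ L' ∧ θ ∈ L' ∧ FR L' := by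
  have halg : IsAlgebraic L θ := ⟨f, hf.ne_zero, hθ⟩
  refine ⟨(IntermediateField.adjoin L {θ}).toSubfield, ?_, ?_, ?_⟩
  · intro x hx
    exact (IntermediateField.adjoin L {θ}).algebraMap_mem ⟨x, hx⟩
  · exact IntermediateField.mem_adjoin_simple_self L θ
  · intro l hl heq
    have hrep : ∀ x ∈ (IntermediateField.adjoin L {θ}).toSubfield,
        ∃ p : Polynomial L, Polynomial.aeval θ p = x := by
      intro x hx
      have : x ∈ (IntermediateField.adjoin L {θ}).toSubalgebra := hx
      rw [IntermediateField.adjoin_simple_toSubalgebra_of_isAlgebraic halg,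
        Algebra.adjoin_singleton_eq_range_aeval] at this
      exact this
    have key : ∀ l : List Ω, (∀ x ∈ l, x ∈ (IntermediateField.adjoin L {θ}).toSubfield) →
        ∃ m : List (Polynomial L), Polynomial.aeval θ ((m.map (fun x => x * x)).sum)
          = (l.map (fun x => x * x)).sum := by
      intro l
      induction l with
      | nil => intro _; exact ⟨[], by simp⟩
      | cons a l ih =>
        intro h
        obtain ⟨m, hm⟩ := ih (fun x hx => h x (by simp [hx]))
        obtain ⟨p, hp⟩ := hrep a (h a (by simp))
        exact ⟨p :: m, by simp [hm, hp]⟩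
    obtain ⟨m, hm⟩ := key l hl
    apply h m
    have h1 := minpoly.dvd L θ (p := 1 + (m.map (fun x => x * x)).sum) (by
      rw [map_add, hm, heq]; simp)
    have h2 := minpoly.dvd L θ hθ
    have h3 : Associated (minpoly L θ) f :=
      (minpoly.irreducible halg.isIntegral).associated_of_dvd hf h2
    exact h3.symm.dvd.trans h1

lemma list_reduce {F : Type} [Field F] (f : Polynomial F) (hf : 0 < f.natDegree)
    (l : List (Polynomial F)) :
    ∃ m : List (Polynomial F), (∀ h ∈ m, h.natDegree < f.natDegree) ∧
      f ∣ (l.map (fun x => x * x)).sum - (m.map (fun x => x * x)).sum := by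
  induction l with
  | nil => exact ⟨[], by simp⟩
  | cons a l ih =>
    obtain ⟨m, hm, hd⟩ := ih
    have hf0 : f ≠ 0 := by rintro rfl; simp at hf
    refine ⟨(a % f) :: m, ?_, ?_⟩
    · intro h hh
      rcases List.mem_cons.1 hh with rfl | hh
      · exact Polynomial.natDegree_mod_lt _ hf.ne'
      · exact hm h hh
    · have h1 : f ∣ a - a % f := ⟨a / f, by
        have := EuclideanDomain.div_add_mod a f
        linear_combination -this⟩
      have h2 : f ∣ a * a - (a % f) * (a % f) := by
        have : a * a - (a % f) * (a % f) = (a - a % f) * (a + a % f) := by ring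
        rw [this]; exact h1.mul_right _
      simp only [List.map_cons, List.sum_cons]
      have : a * a + (l.map (fun x => x * x)).sum
          - ((a % f) * (a % f) + (m.map (fun x => x * x)).sum)
        = (a * a - (a % f) * (a % f))
          + ((l.map (fun x => x * x)).sum - (m.map (fun x => x * x)).sum) := by ring
      rw [this]
      exact dvd_add h2 hd

lemma list_degree {F : Type} [Field F] (d : ℕ) (m : List (Polynomial F))
    (hm : ∀ h ∈ m, h.natDegree < d + 1) :
    (1 + (m.map (fun x => x * x)).sum).natDegree ≤ 2 * d := by
  refine (Polynomial.natDegree_add_le _ _).trans (max_le (by simp) ?_)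
  induction m with
  | nil => simp
  | cons a m ih =>
    simp only [List.map_cons, List.sum_cons]
    refine (Polynomial.natDegree_add_le _ _).trans (max_le ?_ (ih fun h hh => hm h (by simp [hh])))
    have := hm a (by simp)
    refine Polynomial.natDegree_mul_le.trans ?_
    omega

lemma sqrt_adjoin {Ω : Type} [Field Ω] (L : Subfield Ω) (hL : FR L) (a : L)
    (ha : ¬ IsSumSq a) (w : Ω) (hw : w * w = -a) :
    ∃ L' : Subfield Ω, L ≤ L' ∧ w ∈ L' ∧ FR L' := by
  by_cases hwL : w ∈ L
  · exact ⟨L, le_rfl, hwL, hL⟩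
  have hdeg : (Polynomial.X ^ 2 + Polynomial.C a : Polynomial L).natDegree = 2 :=
    Polynomial.natDegree_X_pow_add_C
  have hmon : (Polynomial.X ^ 2 + Polynomial.C a : Polynomial L).Monic :=
    Polynomial.monic_X_pow_add_C _ (by norm_num)
  have hirr : Irreducible (Polynomial.X ^ 2 + Polynomial.C a : Polynomial L) := by
    rw [hmon.irreducible_iff_roots_eq_zero_of_degree_le_three (by omega) (by omega)]
    rw [Multiset.eq_zero_iff_forall_notMem]
    intro r hr
    have h1 := (Polynomial.mem_roots'.1 hr).2
    simp only [Polynomial.IsRoot.def, Polynomial.eval_add, Polynomial.eval_pow, Polynomial.eval_X,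
      Polynomial.eval_C] at h1
    have h2 : (r : Ω) ^ 2 + a = 0 := by exact_mod_cast congrArg (Subtype.val) h1
    have h3 : (w - r) * (w + r) = 0 := by linear_combination hw - h2
    rcases mul_eq_zero.1 h3 with h | h
    · exact hwL (by rw [sub_eq_zero.1 h]; exact r.2)
    · exact hwL (by rw [eq_neg_of_add_eq_zero_left h]; exact L.neg_mem r.2)
  have hFR : ∀ s : L, IsSumSq s → 1 + s ≠ 0 := by
    intro s hs h
    have key : ∀ s : L, IsSumSq s → ∃ l : List Ω, (∀ x ∈ l, x ∈ L) ∧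
        (l.map (fun x => x * x)).sum = s := by
      intro s hs
      induction hs with
      | zero => exact ⟨[], by simp⟩
      | sq_add b hs ih =>
        obtain ⟨l, h1, h2⟩ := ih
        refine ⟨(b : Ω) :: l, ?_, by simp [h2]⟩
        intro x hx
        rcases List.mem_cons.1 hx with rfl | hx
        · exact b.2
        · exact h1 x hx
    obtain ⟨l, h1, h2⟩ := key s hs
    apply hL l h1
    rw [h2, eq_neg_of_add_eq_zero_right h]; simp
  refine FR_adjoin L _ hirr w ?_ ?_
  · simp only [map_add, map_pow, Polynomial.aeval_X, Polynomial.aeval_C]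
    have : (algebraMap L Ω) a = (a : Ω) := rfl
    rw [this, sq, hw]; ring
  · intro l hl
    obtain ⟨m, hm, hd⟩ := list_reduce _ (by rw [hdeg]; norm_num) l
    rw [hdeg] at hm
    have hd2 : (Polynomial.X ^ 2 + Polynomial.C a : Polynomial L) ∣
        1 + (m.map (fun x => x * x)).sum := by
      have := dvd_sub hl hd
      simpa [add_sub_assoc] using this
    obtain ⟨g, hg⟩ := hd2
    have hdm := list_degree 1 m hm
    have hc : ∃ c : L, g = Polynomial.C c := by
      by_cases hg0 : g = 0
      · exact ⟨0, by simp [hg0]⟩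
      · rw [hg, Polynomial.natDegree_mul hmon.ne_zero hg0, hdeg] at hdm
        exact ⟨_, Polynomial.eq_C_of_natDegree_eq_zero (by omega)⟩
    obtain ⟨c, rfl⟩ := hc
    have hco : ∀ m : List (Polynomial L), (∀ h ∈ m, h.natDegree < 2) →
        IsSumSq ((m.map (fun x => x * x)).sum.coeff 2) ∧
        IsSumSq ((m.map (fun x => x * x)).sum.coeff 0) := by
      intro m hm
      induction m with
      | nil => simp
      | cons b m ih =>
        obtain ⟨i1, i2⟩ := ih (fun h hh => hm h (by simp [hh]))
        have hb := hm b (by simp)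
        simp only [List.map_cons, List.sum_cons, Polynomial.coeff_add]
        refine ⟨?_, ?_⟩
        · have : (b * b).coeff 2 = b.coeff 1 * b.coeff 1 := by
            have h := Polynomial.coeff_mul_add_eq_of_natDegree_le (df := 1) (dg := 1)
              (f := b) (g := b) (by omega) (by omega)
            simpa using h
          rw [this]
          exact IsSumSq.sq_add _ i1
        · rw [Polynomial.mul_coeff_zero]
          exact IsSumSq.sq_add _ i2
    obtain ⟨s2, s0⟩ := hco m hm
    have e2 := congrArg (fun p => Polynomial.coeff p 2) hg
    have e0 := congrArg (fun p => Polynomial.coeff p 0) hg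
    simp [Polynomial.coeff_one] at e2 e0
    rw [e2] at s2
    have hne := hFR _ s0
    rw [e0] at hne
    have hc0 : c ≠ 0 := by rintro rfl; simp at hne
    apply ha
    have : a = (1 + (m.map (fun x => x * x)).sum.coeff 0) * (c * (c⁻¹ * c⁻¹)) := by
      rw [e0]; field_simp
    rw [this]
    exact (IsSumSq.one.add s0).mul (s2.mul (IsSumSq.mul_self _))

end H17
namespace H17

section ordered
variable {R : Type} [Field R] [LinearOrder R] [IsStrictOrderedRing R]

lemma list_sq_nonneg (l : List (Polynomial R)) (a : R) :
    0 ≤ ((l.map (fun x => x * x)).sum).eval a := by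
  induction l with
  | nil => simp
  | cons b l ih =>
    simp only [List.map_cons, List.sum_cons, Polynomial.eval_add, Polynomial.eval_mul]
    exact add_nonneg (mul_self_nonneg _) ih

lemma exists_irr_sign (g : Polynomial R) (a b : R) (h : g.eval a * g.eval b < 0) :
    ∃ g1, Irreducible g1 ∧ g1 ∣ g ∧ g1.eval a * g1.eval b < 0 := by
  induction g using UniqueFactorizationMonoid.induction_on_prime with
  | h₁ => simp at h
  | h₂ x hx =>
    obtain ⟨c, hc, rfl⟩ := Polynomial.isUnit_iff.1 hx
    simp only [Polynomial.eval_C] at h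
    exact absurd h (not_lt.2 (mul_self_nonneg c))
  | h₃ x p hx hp ih =>
    by_cases hpn : p.eval a * p.eval b < 0
    · exact ⟨p, hp.irreducible, dvd_mul_right _ _, hpn⟩
    · have : x.eval a * x.eval b < 0 := by
        simp only [Polynomial.eval_mul] at h
        have h2 : (p.eval a * p.eval b) * (x.eval a * x.eval b) < 0 := by
          calc _ = _ := by ring
            _ < 0 := h
        by_contra h3
        exact absurd h2 (not_lt.2 (mul_nonneg (not_lt.1 hpn) (not_lt.1 h3)))
      obtain ⟨g1, i1, i2, i3⟩ := ih this
      exact ⟨g1, i1, i2.mul_left _, i3⟩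

lemma sign_change_real (a b : R) : ∀ (d : ℕ) (f : Polynomial R), f.natDegree = d → Irreducible f →
    f.eval a * f.eval b < 0 →
    ∀ l : List (Polynomial R), ¬ f ∣ 1 + (l.map (fun x => x * x)).sum := by
  intro d
  induction d using Nat.strong_induction_on with
  | _ d ih =>
    intro f hd hf hs l hl
    have hpos : 0 < f.natDegree := hf.natDegree_pos
    obtain ⟨m, hm, hdv⟩ := list_reduce f hpos l
    have hd2 : f ∣ 1 + (m.map (fun x => x * x)).sum := by
      have := dvd_sub hl hdv
      simpa [add_sub_assoc] using this
    obtain ⟨g, hg⟩ := hd2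
    obtain ⟨e, he⟩ : ∃ e, f.natDegree = e + 1 := ⟨f.natDegree - 1, by omega⟩
    have hdm := list_degree e m (fun h hh => he ▸ hm h hh)
    have hev : ∀ x, 0 < f.eval x * g.eval x := by
      intro x
      rw [← Polynomial.eval_mul, ← hg, Polynomial.eval_add, Polynomial.eval_one]
      have := list_sq_nonneg m x
      linarith
    have hg0 : g ≠ 0 := by
      rintro rfl
      have := hev 0
      simp at this
    rw [hg, Polynomial.natDegree_mul hf.ne_zero hg0] at hdm
    have hgs : g.eval a * g.eval b < 0 := by
      have h1 := mul_pos (hev a) (hev b)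
      by_contra h3
      have h4 := mul_nonpos_of_nonpos_of_nonneg hs.le (not_lt.1 h3)
      nlinarith
    obtain ⟨g1, i1, i2, i3⟩ := exists_irr_sign g a b hgs
    have hg1 := Polynomial.natDegree_le_of_dvd i2 hg0
    refine ih g1.natDegree (by omega) g1 rfl i1 i3 m ?_
    rw [hg]
    exact i2.mul_left _

end ordered

/-- the cone of squares -/
def sqCone (L : Type) [Field L] (h1 : ∀ a b : L, IsSumSq a → IsSumSq b → a + b = 0 → a = 0)
    (h2 : ∀ a : L, IsSquare a ∨ IsSquare (-a)) : RingCone L where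
  carrier := {a | IsSquare a}
  mul_mem' := fun ha hb => ha.mul hb
  one_mem' := IsSquare.one
  zero_mem' := IsSquare.zero
  add_mem' := by
    rintro a b ha hb
    rcases h2 (a + b) with h | h
    · exact h
    · have h3 := h1 a (b + -(a + b)) ha.isSumSq (hb.isSumSq.add h.isSumSq) (by ring)
      have : a + b = b := by rw [h3, zero_add]
      change IsSquare (a + b)
      rw [this]; exact hb
  eq_zero_of_mem_of_neg_mem' := by
    rintro a ha hb
    exact h1 a (-a) (IsSquare.isSumSq ha) (IsSquare.isSumSq hb) (by ring)

lemma mem_list_of_sumSq {Ω : Type} [Field Ω] (L : Subfield Ω) (s : L) (hs : IsSumSq s) :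
    ∃ l : List Ω, (∀ x ∈ l, x ∈ L) ∧ (l.map (fun x => x * x)).sum = s := by
  induction hs with
  | zero => exact ⟨[], by simp⟩
  | sq_add b hs ih =>
    obtain ⟨l, h1, h2⟩ := ih
    refine ⟨(b : Ω) :: l, ?_, by simp [h2]⟩
    intro x hx
    rcases List.mem_cons.1 hx with rfl | hx
    · exact b.2
    · exact h1 x hx

theorem exists_real_closed (K : Type) [Field K] [CharZero K] (g : K) (hg : ¬ IsSumSq g) :
    ∃ (L : Type) (_ : Field L) (_ : LinearOrder L) (_ : IsStrictOrderedRing L) (φ : K →+* L),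
      PIVT L ∧ φ g < 0 := by
  classical
  let Ω := AlgebraicClosure K
  let L0 : Subfield Ω := (algebraMap K Ω).fieldRange
  have hinj : Function.Injective (algebraMap K Ω) := (algebraMap K Ω).injective
  have hlift : ∀ l : List Ω, (∀ x ∈ l, x ∈ L0) → ∃ s : K, IsSumSq s ∧
      algebraMap K Ω s = (l.map (fun x => x * x)).sum := by
    intro l
    induction l with
    | nil => intro _; exact ⟨0, by simp⟩
    | cons a l ih =>
      intro h
      obtain ⟨s, h1, h2⟩ := ih (fun x hx => h x (by simp [hx]))
      obtain ⟨b, hb⟩ := h a (by simp)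
      exact ⟨b * b + s, IsSumSq.sq_add _ h1, by simp [h2, hb]⟩
  have hL0 : FR L0 := by
    intro l hl heq
    obtain ⟨s, h1, h2⟩ := hlift l hl
    have hs : s = -1 := hinj (by rw [h2, heq]; simp)
    apply hg
    have : g = ((g + 1) / 2) * ((g + 1) / 2) + s * (((g - 1) / 2) * ((g - 1) / 2)) := by
      rw [hs]; ring
    rw [this]
    exact (IsSumSq.mul_self _).add (h1.mul (IsSumSq.mul_self _))
  let gL : L0 := ⟨algebraMap K Ω g, g, rfl⟩
  have hgL : ¬ IsSumSq gL := by
    intro h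
    obtain ⟨l, h1, h2⟩ := mem_list_of_sumSq L0 gL h
    obtain ⟨s, h3, h4⟩ := hlift l h1
    have : s = g := hinj (by rw [h4, h2])
    exact hg (this ▸ h3)
  obtain ⟨w, hw⟩ := IsAlgClosed.exists_pow_nat_eq (-(gL : Ω)) (n := 2) (by norm_num)
  obtain ⟨L1, hL01, hwL1, hL1⟩ := sqrt_adjoin L0 hL0 gL hgL w (by rw [← sq, hw])
  obtain ⟨L, hL1L, hmax⟩ := zorn_le_nonempty₀ {L : Subfield Ω | FR L} (by
    intro c hc hchain y hy
    exact ⟨sSup c, FR_sSup c hchain ⟨y, hy⟩ (fun L hL => hc hL), fun z hz => le_sSup hz⟩) L1 hL1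
  have hFR : FR L := hmax.prop
  have hmx : ∀ L' : Subfield Ω, L ≤ L' → FR L' → L' ≤ L := fun L' h h' => hmax.le_of_ge h' h
  have hneg : ∀ s : L, IsSumSq s → s ≠ -1 := by
    intro s hs h
    obtain ⟨l, h1, h2⟩ := mem_list_of_sumSq L s hs
    exact hFR l h1 (by rw [h2, h]; simp)
  have hadd : ∀ a b : L, IsSumSq a → IsSumSq b → a + b = 0 → a = 0 := by
    intro a b ha hb hab
    by_contra h
    refine hneg (b * (a * (a⁻¹ * a⁻¹))) (hb.mul (ha.mul (IsSumSq.mul_self _))) ?_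
    rw [eq_neg_of_add_eq_zero_right hab]; field_simp
  have hsq : ∀ a : L, ¬ IsSumSq a → IsSquare (-a) := by
    intro a ha
    obtain ⟨w, hw⟩ := IsAlgClosed.exists_pow_nat_eq (-(a : Ω)) (n := 2) (by norm_num)
    obtain ⟨L', h1, h2, h3⟩ := sqrt_adjoin L hFR a ha w (by rw [← sq, hw])
    have hwL : w ∈ L := hmx L' h1 h3 h2
    refine ⟨⟨w, hwL⟩, Subtype.ext ?_⟩
    simp [← hw, sq]
  have hsq2 : ∀ a : L, IsSquare a ∨ IsSquare (-a) := by
    intro a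
    by_cases ha : IsSumSq a
    · by_cases hb : IsSumSq (-a)
      · left
        have := hadd a (-a) ha hb (by ring)
        rw [this]; exact IsSquare.zero
      · left; simpa using hsq (-a) hb
    · exact Or.inr (hsq a ha)
  let cone := sqCone L hadd hsq2
  haveI : HasMemOrNegMem cone := ⟨hsq2⟩
  letI : LinearOrder L := LinearOrder.mkOfAddGroupCone cone
  haveI hor : IsOrderedRing L := IsOrderedRing.mkOfCone cone
  haveI : IsStrictOrderedRing L := IsOrderedRing.toIsStrictOrderedRing L
  have hL0L : L0 ≤ L := hL01.trans hL1L
  let φ : K →+* L := (algebraMap K Ω).codRestrict L (fun x => hL0L ⟨x, rfl⟩)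
  refine ⟨L, inferInstance, inferInstance, inferInstance, φ, ?_, ?_⟩
  · intro p a b hab ha hb
    have hprod : p.eval a * p.eval b < 0 := mul_neg_of_neg_of_pos ha hb
    obtain ⟨f, hf, hfp, hfs⟩ := exists_irr_sign p a b hprod
    have hno := sign_change_real a b _ f rfl hf hfs
    obtain ⟨θ, hθ⟩ := IsAlgClosed.exists_aeval_eq_zero Ω f hf.degree_pos.ne'
    obtain ⟨L', h1, h2, h3⟩ := FR_adjoin L f hf θ hθ hno
    have hθL : θ ∈ L := hmx L' h1 h3 h2
    let t : L := ⟨θ, hθL⟩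
    have ht : f.eval t = 0 := by
      have h4 : algebraMap L Ω (f.eval t) = 0 := by
        rw [← Polynomial.aeval_algebraMap_apply_eq_algebraMap_eval]
        exact hθ
      exact (algebraMap L Ω).injective (by rw [h4, map_zero])
    obtain ⟨c, hc⟩ : Polynomial.X - Polynomial.C t ∣ f := Polynomial.dvd_iff_isRoot.2 ht
    have hcu : IsUnit c := by
      rcases hf.isUnit_or_isUnit hc with h | h
      · exact absurd h (Polynomial.not_isUnit_X_sub_C t)
      · exact h
    obtain ⟨u, hu, rfl⟩ := Polynomial.isUnit_iff.1 hcu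
    have hsgn : (a - t) * (b - t) < 0 := by
      rw [hc] at hfs
      simp only [Polynomial.eval_mul, Polynomial.eval_sub, Polynomial.eval_X,
        Polynomial.eval_C] at hfs
      by_contra h5
      have := mul_nonneg (not_lt.1 h5) (mul_self_nonneg u)
      nlinarith
    refine ⟨t, ?_, ?_, ?_⟩
    · by_contra h6
      have h7 : 0 ≤ a - t := sub_nonneg.2 (not_lt.1 h6)
      have h8 : 0 ≤ b - t := by linarith
      exact absurd hsgn (not_lt.2 (mul_nonneg h7 h8))
    · by_contra h6
      have h7 : b - t ≤ 0 := sub_nonpos.2 (not_lt.1 h6)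
      have h8 : a - t ≤ 0 := by linarith
      exact absurd hsgn (not_lt.2 (mul_nonneg_of_nonpos_of_nonpos h8 h7))
    · obtain ⟨q, rfl⟩ := hfp
      rw [Polynomial.eval_mul, ht, zero_mul]
  · let wL : L := ⟨w, hL1L hwL1⟩
    have h1 : φ g = -(wL * wL) := by
      apply Subtype.ext
      have : (φ g : Ω) = algebraMap K Ω g := rfl
      rw [this]
      change _ = -(w * w)
      rw [← sq, hw, neg_neg]
    have h2 : φ g ≠ 0 := by
      rw [map_ne_zero]
      rintro rfl
      exact hg IsSumSq.zero
    refine lt_of_le_of_ne ?_ h2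
    rw [h1]
    exact neg_nonpos.2 (mul_self_nonneg wL)

end H17
namespace H17

section sturm
set_option linter.unusedSectionVars false
variable {R : Type} [Field R] [LinearOrder R] [IsStrictOrderedRing R]

/-- sign as an integer -/
noncomputable def sg (x : R) : ℤ := ((SignType.sign x : SignType) : ℤ)

lemma sg_mul (x y : R) : sg (x * y) = sg x * sg y := by
  simp [sg, sign_mul]

lemma sg_pos {x : R} (h : 0 < x) : sg x = 1 := by simp [sg, h]
lemma sg_neg {x : R} (h : x < 0) : sg x = -1 := by simp [sg, h]
@[simp] lemma sg_zero : sg (0 : R) = 0 := by simp [sg]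

lemma sg_eq_one {x : R} : sg x = 1 ↔ 0 < x := by
  rcases lt_trichotomy x 0 with h | h | h
  · simp [sg_neg h, h.le]
  · simp [h]
  · simp [sg_pos h, h]

/-- growth at infinity -/
lemma pos_at_top (p : Polynomial R) (h : 0 < p.leadingCoeff) :
    ∃ M : R, ∀ x, M ≤ x → 0 < p.eval x := by
  suffices H : ∀ d (p : Polynomial R), p.natDegree = d → 0 < p.leadingCoeff →
      ∃ ε : R, 0 < ε ∧ ∃ M : R, ∀ x, M ≤ x → ε ≤ p.eval x by
    obtain ⟨ε, h1, M, h2⟩ := H _ p rfl h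
    exact ⟨M, fun x hx => h1.trans_le (h2 x hx)⟩
  intro d
  induction d with
  | zero =>
    intro p hp hl
    rw [Polynomial.eq_C_of_natDegree_eq_zero hp] at hl ⊢
    simp only [Polynomial.leadingCoeff_C] at hl
    exact ⟨_, hl, 0, fun x _ => by simp⟩
  | succ d ih =>
    intro p hp hl
    have hdx : p.divX.natDegree = d := by
      rw [Polynomial.natDegree_divX_eq_natDegree_tsub_one]; omega
    have hlx : p.divX.leadingCoeff = p.leadingCoeff := by
      rw [Polynomial.leadingCoeff, hdx, Polynomial.coeff_divX, Polynomial.leadingCoeff, hp]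
    obtain ⟨ε, hε, M, hM⟩ := ih p.divX hdx (by rw [hlx]; exact hl)
    refine ⟨1, one_pos, max (max M 0) ((1 - p.coeff 0) / ε), ?_⟩
    intro x hx
    have hx1 : M ≤ x := (le_max_left _ _).trans ((le_max_left _ _).trans hx)
    have hx2 : 0 ≤ x := (le_max_right _ _).trans ((le_max_left _ _).trans hx)
    have hx3 : (1 - p.coeff 0) / ε ≤ x := (le_max_right _ _).trans hx
    have h4 := hM x hx1
    rw [div_le_iff₀ hε] at hx3
    have h5 : p.eval x = p.divX.eval x * x + p.coeff 0 := by
      conv_lhs => rw [← Polynomial.divX_mul_X_add p]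
      simp
    rw [h5]
    nlinarith [mul_le_mul_of_nonneg_right h4 hx2]

lemma sg_neg_eq (x : R) : sg (-x) = - sg x := by
  have : -x = (-1) * x := by ring
  rw [this, sg_mul, sg_neg (by norm_num : (-1 : R) < 0)]; ring

lemma sg_eq_neg_one {x : R} : sg x = -1 ↔ x < 0 := by
  rw [← neg_pos, ← sg_eq_one, sg_neg_eq]; constructor <;> intro h <;> linarith

lemma pivt' (hR : PIVT R) (p : Polynomial R) (a b : R) (hab : a < b)
    (h : p.eval a * p.eval b < 0) : ∃ c, a < c ∧ c < b ∧ p.eval c = 0 := by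
  rcases mul_neg_iff.1 h with ⟨h1, h2⟩ | ⟨h1, h2⟩
  · obtain ⟨c, h3, h4, h5⟩ := hR (-p) a b hab (by simpa using h1) (by simpa using h2)
    exact ⟨c, h3, h4, by simpa using h5⟩
  · exact hR p a b hab h1 h2

lemma sg_const (hR : PIVT R) (p : Polynomial R) (a b : R) (hab : a ≤ b)
    (h : ∀ c, a ≤ c → c ≤ b → p.eval c ≠ 0) : sg (p.eval a) = sg (p.eval b) := by
  have key : ¬ p.eval a * p.eval b < 0 := by
    intro hn
    rcases hab.lt_or_eq with hlt | rfl
    · obtain ⟨c, h1, h2, h3⟩ := pivt' hR p a b hlt hn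
      exact h c h1.le h2.le h3
    · exact absurd hn (not_lt.2 (mul_self_nonneg _))
  have ha := h a le_rfl hab
  have hb := h b hab le_rfl
  rcases lt_or_gt_of_ne ha with h1 | h1 <;> rcases lt_or_gt_of_ne hb with h2 | h2
  · rw [sg_neg h1, sg_neg h2]
  · exact absurd (mul_neg_of_neg_of_pos h1 h2) key
  · exact absurd (mul_neg_of_pos_of_neg h1 h2) key
  · rw [sg_pos h1, sg_pos h2]

lemma sg_eq_lc (hR : PIVT R) (p : Polynomial R) (a : R)
    (h : ∀ c, a ≤ c → p.eval c ≠ 0) : sg (p.eval a) = sg p.leadingCoeff := by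
  have hp : p ≠ 0 := by rintro rfl; exact h a le_rfl (by simp)
  have hl : p.leadingCoeff ≠ 0 := by simpa using hp
  rcases lt_or_gt_of_ne hl with hl | hl
  · obtain ⟨M, hM⟩ := pos_at_top (-p) (by simpa using hl)
    have := sg_const hR p a (max a M) (le_max_left _ _) (fun c hc _ => h c hc)
    have h2 := hM (max a M) (le_max_right _ _)
    rw [this, sg_neg hl, sg_neg (by simpa using h2)]
  · obtain ⟨M, hM⟩ := pos_at_top p hl
    have := sg_const hR p a (max a M) (le_max_left _ _) (fun c hc _ => h c hc)
    have h2 := hM (max a M) (le_max_right _ _)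
    rw [this, sg_pos hl, sg_pos h2]

lemma comp_neg_lc (p : Polynomial R) :
    (p.comp (-Polynomial.X)).leadingCoeff = (-1) ^ p.natDegree * p.leadingCoeff := by
  rw [Polynomial.leadingCoeff_comp (by simp)]
  simp [mul_comm]

lemma odd_root (hR : PIVT R) (p : Polynomial R) (hp : Odd p.natDegree) : ∃ c, p.eval c = 0 := by
  by_contra hno
  push Not at hno
  have h1 := sg_eq_lc hR p 0 (fun c _ => hno c)
  have h2 := sg_eq_lc hR (p.comp (-Polynomial.X)) 0 (fun c _ => by
    rw [Polynomial.eval_comp]; exact hno _)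
  rw [comp_neg_lc, hp.neg_one_pow, Polynomial.eval_comp] at h2
  simp only [Polynomial.eval_neg, Polynomial.eval_X, neg_zero, neg_mul, one_mul, sg_neg_eq] at h2
  have h3 : sg (p.eval 0) = 0 := by linarith
  have h0 := hno 0
  rcases lt_or_gt_of_ne h0 with h | h
  · rw [sg_neg h] at h3; norm_num at h3
  · rw [sg_pos h] at h3; norm_num at h3

open Classical in
/-- half jump of the sign of `P` at `ξ` -/
noncomputable def jmp (P : Polynomial R) (ξ : R) : ℤ :=
  if Odd (P.rootMultiplicity ξ) then
    sg ((P /ₘ (Polynomial.X - Polynomial.C ξ) ^ P.rootMultiplicity ξ).eval ξ) else 0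

lemma rm_eq (P Q : Polynomial R) (ξ : R) (m : ℕ)
    (h : P = (Polynomial.X - Polynomial.C ξ) ^ m * Q) (hQ : Q.eval ξ ≠ 0) :
    P.rootMultiplicity ξ = m := by
  have hQ0 : Q ≠ 0 := by rintro rfl; simp at hQ
  rw [h, mul_comm, Polynomial.rootMultiplicity_mul_X_sub_C_pow hQ0,
    Polynomial.rootMultiplicity_eq_zero hQ, zero_add]

open Classical in
lemma jmp_eq (P Q : Polynomial R) (ξ : R) (m : ℕ)
    (h : P = (Polynomial.X - Polynomial.C ξ) ^ m * Q) (hQ : Q.eval ξ ≠ 0) :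
    jmp P ξ = if Odd m then sg (Q.eval ξ) else 0 := by
  have hm := rm_eq P Q ξ m h hQ
  rw [jmp, hm]
  have : P /ₘ (Polynomial.X - Polynomial.C ξ) ^ m = Q := by
    rw [h]
    exact Polynomial.mul_divByMonic_cancel_left _ ((Polynomial.monic_X_sub_C ξ).pow m)
  rw [this]

lemma exists_fac (P : Polynomial R) (hP : P ≠ 0) (ξ : R) :
    ∃ Q : Polynomial R, P = (Polynomial.X - Polynomial.C ξ) ^ P.rootMultiplicity ξ * Q ∧
      Q.eval ξ ≠ 0 :=
  ⟨_, (Polynomial.pow_mul_divByMonic_rootMultiplicity_eq P ξ).symm,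
    Polynomial.eval_divByMonic_pow_rootMultiplicity_ne_zero ξ hP⟩

@[simp] lemma jmp_zero (ξ : R) : jmp (0 : Polynomial R) ξ = 0 := by
  simp [jmp]

open Classical in
theorem sum_jmp (hR : PIVT R) : ∀ (d : ℕ) (P : Polynomial R), P.natDegree = d → P ≠ 0 →
    ∑ ξ ∈ P.roots.toFinset, jmp P ξ = if Odd P.natDegree then sg P.leadingCoeff else 0 := by
  intro d
  induction d using Nat.strong_induction_on with
  | _ d ih =>
    intro P hd hP
    by_cases hne : P.roots.toFinset.Nonempty
    · obtain ⟨M, hM, hmax⟩ := P.roots.toFinset.exists_max_image id hne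
      obtain ⟨Q, hQ, hQM⟩ := exists_fac P hP M
      have hm : 0 < P.rootMultiplicity M := by
        rw [Polynomial.rootMultiplicity_pos hP]
        exact (Polynomial.mem_roots hP).1 (Multiset.mem_toFinset.1 hM)
      generalize P.rootMultiplicity M = m at hQ hm
      have hQ0 : Q ≠ 0 := by rintro rfl; simp at hQM
      have hX0 : (Polynomial.X - Polynomial.C M) ^ m ≠ 0 :=
        pow_ne_zero _ (Polynomial.X_sub_C_ne_zero M)
      have hdeg : P.natDegree = m + Q.natDegree := by
        rw [hQ, Polynomial.natDegree_mul hX0 hQ0]; simp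
      have hlc : P.leadingCoeff = Q.leadingCoeff := by
        rw [hQ, Polynomial.leadingCoeff_mul]; simp
      have hrP : P.roots.toFinset = insert M Q.roots.toFinset := by
        ext x
        simp only [Multiset.mem_toFinset, Polynomial.mem_roots hP, Finset.mem_insert,
          Polynomial.mem_roots hQ0, Polynomial.IsRoot.def]
        rw [hQ]
        simp [hm.ne', sub_eq_zero]
      have hMQ : M ∉ Q.roots.toFinset := by
        simp [hQM]
      have hlt : ∀ x ∈ Q.roots.toFinset, x < M := by
        intro x hx
        refine lt_of_le_of_ne (hmax x (by rw [hrP]; simp only [Finset.mem_insert, hx, or_true])) ?_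
        rintro rfl; exact hMQ hx
      have hjM : jmp P M = if Odd m then sg Q.leadingCoeff else 0 := by
        rw [jmp_eq P Q M m hQ hQM, sg_eq_lc hR Q M]
        intro c hc hc0
        have : c ∈ Q.roots.toFinset := by simp [hQ0, hc0]
        exact absurd (hlt c this) (not_lt.2 hc)
      have hj : ∀ x ∈ Q.roots.toFinset, jmp P x = (-1) ^ m * jmp Q x := by
        intro x hx
        obtain ⟨S, hS, hSx⟩ := exists_fac Q hQ0 x
        generalize Q.rootMultiplicity x = k at hS
        have hxM := hlt x hx
        have h1 : P = (Polynomial.X - Polynomial.C x) ^ k *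
            ((Polynomial.X - Polynomial.C M) ^ m * S) := by rw [hQ, hS]; ring
        have h2 : sg (x - M) = -1 := sg_neg (by linarith)
        have h4 : ∀ m : ℕ, sg ((x - M) ^ m) = (-1) ^ m := by
          intro m
          induction m with
          | zero => simp [sg]
          | succ m ih => rw [pow_succ, sg_mul, ih, h2, pow_succ]
        rw [jmp_eq P _ x k h1 ?_, jmp_eq Q S x k hS hSx]
        · split_ifs
          · simp [sg_mul, h4]
          · simp
        · simp [hSx, sub_eq_zero, hxM.ne]
      rw [hrP, Finset.sum_insert hMQ, hjM, Finset.sum_congr rfl hj, ← Finset.mul_sum,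
        ih Q.natDegree (by omega) Q rfl hQ0, hdeg, hlc]
      rcases Nat.even_or_odd m with h | h <;> rcases Nat.even_or_odd Q.natDegree with h' | h'
      · simp [h, h', Nat.odd_add]
      · have h2 := h.add_odd h'
        simp [h2, h', Nat.not_odd_iff_even.2 h, h.neg_one_pow]
      · simp [h, h', Nat.odd_add]
      · simp [h, h', Nat.odd_add, ← Nat.not_odd_iff_even]
    · rw [Finset.not_nonempty_iff_eq_empty] at hne
      rw [hne, Finset.sum_empty, if_neg]
      intro hodd
      obtain ⟨c, hc⟩ := odd_root hR P hodd
      have : c ∈ P.roots.toFinset := by simp [hP, hc]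
      rw [hne] at this
      simp at this

open Classical in
/-- Cauchy index of `g / f` -/
noncomputable def ind (f g : Polynomial R) : ℤ :=
  ∑ ξ ∈ f.roots.toFinset,
    if g.rootMultiplicity ξ < f.rootMultiplicity ξ then jmp (f * g) ξ else 0

open Classical in
lemma ind_swap (hR : PIVT R) (f g : Polynomial R) (hf : f ≠ 0) (hg : g ≠ 0) :
    ind f g = (if Odd (f.natDegree + g.natDegree) then sg (f.leadingCoeff * g.leadingCoeff) else 0)
      - ind g f := by
  have hfg : f * g ≠ 0 := mul_ne_zero hf hg
  have h0 := sum_jmp hR _ (f * g) rfl hfg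
  rw [Polynomial.natDegree_mul hf hg, Polynomial.leadingCoeff_mul] at h0
  have h1 : ∀ f g : Polynomial R, f ≠ 0 → g ≠ 0 → ind f g = ∑ ξ ∈ (f * g).roots.toFinset,
      if g.rootMultiplicity ξ < f.rootMultiplicity ξ then jmp (f * g) ξ else 0 := by
    intro f g hf hg
    unfold ind
    apply Finset.sum_subset
    · intro x hx
      simp only [Multiset.mem_toFinset, Polynomial.mem_roots hf,
        Polynomial.mem_roots (mul_ne_zero hf hg)] at hx ⊢
      simp only [Polynomial.IsRoot.def] at hx ⊢
      simp [hx]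
    · intro x _ hx
      have : f.rootMultiplicity x = 0 := by
        apply Polynomial.rootMultiplicity_eq_zero
        simpa [hf] using hx
      simp [this]
  rw [← h0, h1 f g hf hg, h1 g f hg hf, mul_comm g f, eq_sub_iff_add_eq, ← Finset.sum_add_distrib]
  refine Finset.sum_congr rfl fun x _ => ?_
  rcases lt_trichotomy (g.rootMultiplicity x) (f.rootMultiplicity x) with h | h | h
  · simp [h, h.le]
  · have : jmp (f * g) x = 0 := by
      rw [jmp, if_neg]
      rw [Polynomial.rootMultiplicity_mul hfg, h]
      simp
    simp [h, this]
  · simp [h, h.le]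

lemma rm_ge (g : Polynomial R) (hg : g ≠ 0) (ξ : R) (m : ℕ)
    (h : (Polynomial.X - Polynomial.C ξ) ^ m ∣ g) : m ≤ g.rootMultiplicity ξ :=
  (Polynomial.le_rootMultiplicity_iff hg).2 h

lemma ind_term_zero (f g : Polynomial R) (ξ : R)
    (h : (Polynomial.X - Polynomial.C ξ) ^ (f.rootMultiplicity ξ) ∣ g) :
    (if g.rootMultiplicity ξ < f.rootMultiplicity ξ then jmp (f * g) ξ else 0) = 0 := by
  by_cases hg : g = 0
  · simp [hg]
  · rw [if_neg]
    exact not_lt.2 (rm_ge g hg ξ _ h)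

lemma ind_mod (f g q : Polynomial R) (c : R) (hc : 0 < c) :
    ind f (Polynomial.C c * g + q * f) = ind f g := by
  by_cases hf : f = 0
  · simp [hf, ind]
  unfold ind
  refine Finset.sum_congr rfl fun x _ => ?_
  have hfd := Polynomial.pow_rootMultiplicity_dvd f x
  by_cases hd : (Polynomial.X - Polynomial.C x) ^ (f.rootMultiplicity x) ∣ g
  · rw [ind_term_zero f g x hd, ind_term_zero]
    exact dvd_add (hd.mul_left _) (hfd.mul_left _)
  · have hg : g ≠ 0 := by rintro rfl; simp at hd
    have hlt : g.rootMultiplicity x < f.rootMultiplicity x := by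
      by_contra h
      exact hd ((pow_dvd_pow _ (not_lt.1 h)).trans (Polynomial.pow_rootMultiplicity_dvd g x))
    obtain ⟨F, hF, hFx⟩ := exists_fac f hf x
    obtain ⟨G, hG, hGx⟩ := exists_fac g hg x
    rw [if_pos hlt]
    generalize f.rootMultiplicity x = m at *
    generalize g.rootMultiplicity x = k at *
    obtain ⟨e, rfl⟩ : ∃ e, m = k + (e + 1) := ⟨m - k - 1, by omega⟩
    have h1 : Polynomial.C c * g + q * f = (Polynomial.X - Polynomial.C x) ^ k *
        (Polynomial.C c * G + q * (Polynomial.X - Polynomial.C x) ^ (e + 1) * F) := by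
      rw [hG, hF]; ring
    have h1x : (Polynomial.C c * G + q * (Polynomial.X - Polynomial.C x) ^ (e + 1) * F).eval x
        = c * G.eval x := by simp
    have hne : c * G.eval x ≠ 0 := mul_ne_zero hc.ne' hGx
    rw [rm_eq _ _ x k h1 (by rw [h1x]; exact hne), if_pos hlt]
    rw [jmp_eq (f * (Polynomial.C c * g + q * f)) (F * (Polynomial.C c * G + q * (Polynomial.X - Polynomial.C x) ^ (e + 1) * F)) x
        (k + (e + 1) + k) (by rw [h1, hF]; ring) (by
          rw [Polynomial.eval_mul, h1x]; exact mul_ne_zero hFx hne),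
      jmp_eq (f * g) (F * G) x (k + (e + 1) + k) (by rw [hF, hG]; ring) (by
          rw [Polynomial.eval_mul]; exact mul_ne_zero hFx hGx)]
    rw [Polynomial.eval_mul, h1x, Polynomial.eval_mul, sg_mul, sg_mul, sg_mul, sg_pos hc, one_mul]

lemma ind_taq (f h : Polynomial R) (hf : f ≠ 0) :
    ind f (Polynomial.derivative f * h) = ∑ ξ ∈ f.roots.toFinset, sg (h.eval ξ) := by
  unfold ind
  refine Finset.sum_congr rfl fun x hx => ?_
  have hm : 0 < f.rootMultiplicity x := by
    rw [Polynomial.rootMultiplicity_pos hf]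
    simpa [hf] using hx
  have hfac := exists_fac f hf x
  by_cases hhx : h.eval x = 0
  · rw [hhx, sg_zero, ind_term_zero]
    obtain ⟨F, hF, hFx⟩ := hfac
    generalize f.rootMultiplicity x = m at *
    obtain ⟨e, rfl⟩ : ∃ e, m = e + 1 := ⟨m - 1, by omega⟩
    obtain ⟨H, hH⟩ := Polynomial.dvd_iff_isRoot.2 hhx
    have : Polynomial.derivative f = (Polynomial.X - Polynomial.C x) ^ e *
      (((e + 1 : ℕ) : Polynomial R) * F
        + (Polynomial.X - Polynomial.C x) * Polynomial.derivative F) := by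
      rw [hF, Polynomial.derivative_mul, Polynomial.derivative_X_sub_C_pow]
      simp only [Nat.add_sub_cancel, map_natCast]
      push_cast
      ring
    rw [this, hH]
    exact ⟨(((e + 1 : ℕ) : Polynomial R) * F
        + (Polynomial.X - Polynomial.C x) * Polynomial.derivative F) * H, by ring⟩
  · obtain ⟨F, hF, hFx⟩ := hfac
    generalize f.rootMultiplicity x = m at *
    obtain ⟨e, rfl⟩ : ∃ e, m = e + 1 := ⟨m - 1, by omega⟩
    have h0 : Polynomial.derivative f = (Polynomial.X - Polynomial.C x) ^ e *
      (((e + 1 : ℕ) : Polynomial R) * F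
        + (Polynomial.X - Polynomial.C x) * Polynomial.derivative F) := by
      rw [hF, Polynomial.derivative_mul, Polynomial.derivative_X_sub_C_pow]
      simp only [Nat.add_sub_cancel, map_natCast]
      push_cast
      ring
    set D := (((e + 1 : ℕ) : Polynomial R) * F
        + (Polynomial.X - Polynomial.C x) * Polynomial.derivative F) with hD
    have hDx : D.eval x = ((e : R) + 1) * F.eval x := by simp [hD]
    have hepos : (0 : R) < (e : R) + 1 := by positivity
    have hne : D.eval x ≠ 0 := by rw [hDx]; exact mul_ne_zero hepos.ne' hFx
    rw [rm_eq (Polynomial.derivative f * h) (D * h) x e (by rw [h0]; ring)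
      (by rw [Polynomial.eval_mul]; exact mul_ne_zero hne hhx), if_pos (Nat.lt_succ_self e)]
    rw [jmp_eq _ (F * (D * h)) x (2 * e + 1) (by rw [h0, hF]; ring)
      (by simp only [Polynomial.eval_mul]; exact mul_ne_zero hFx (mul_ne_zero hne hhx))]
    rw [if_pos (by simp)]
    simp only [Polynomial.eval_mul, hDx]
    have : F.eval x * ((e + 1) * F.eval x * h.eval x)
      = ((e + 1) * (F.eval x * F.eval x)) * h.eval x := by ring
    rw [this, sg_mul, sg_pos (mul_pos hepos (mul_self_pos.2 hFx)), one_mul]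

lemma rolle (hR : PIVT R) (P : Polynomial R) (hP : P ≠ 0) (a b : R) (hab : a < b)
    (ha : P.eval a = 0) (hb : P.eval b = 0) (hno : ∀ c, a < c → c < b → P.eval c ≠ 0) :
    ∃ c, a < c ∧ c < b ∧ (Polynomial.derivative P).eval c = 0 := by
  have hma : 0 < P.rootMultiplicity a := (Polynomial.rootMultiplicity_pos hP).2 ha
  obtain ⟨Q, hQ, hQa⟩ := exists_fac P hP a
  generalize P.rootMultiplicity a = m at *
  have hQ0 : Q ≠ 0 := by rintro rfl; simp at hQa
  have hQb : Q.eval b = 0 := by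
    rw [hQ] at hb
    simpa [sub_eq_zero, hab.ne', hma.ne'] using hb
  have hmb : 0 < Q.rootMultiplicity b := (Polynomial.rootMultiplicity_pos hQ0).2 hQb
  obtain ⟨S, hS, hSb⟩ := exists_fac Q hQ0 b
  generalize Q.rootMultiplicity b = k at *
  obtain ⟨m, rfl⟩ : ∃ e, m = e + 1 := ⟨m - 1, by omega⟩
  obtain ⟨k, rfl⟩ : ∃ e, k = e + 1 := ⟨k - 1, by omega⟩
  have hSa : S.eval a ≠ 0 := by
    intro h; apply hQa; rw [hS]; simp [h]
  have hPS : P = (Polynomial.X - Polynomial.C a) ^ (m + 1) *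
    ((Polynomial.X - Polynomial.C b) ^ (k + 1) * S) := by rw [hQ, hS]
  have hSno : ∀ c, a ≤ c → c ≤ b → S.eval c ≠ 0 := by
    intro c h1 h2
    rcases h1.lt_or_eq with h1 | rfl
    · rcases h2.lt_or_eq with h2 | rfl
      · intro h; apply hno c h1 h2; rw [hPS]; simp [h]
      · exact hSb
    · exact hSa
  have hsame := sg_const hR S a b hab.le hSno
  have hprod : 0 < S.eval a * S.eval b := by
    rw [← sg_eq_one, sg_mul, ← hsame, ← sg_mul, sg_eq_one]
    exact mul_self_pos.2 hSa
  set B : Polynomial R := ((m + 1 : ℕ) : Polynomial R) * (Polynomial.X - Polynomial.C b) * S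
    + ((k + 1 : ℕ) : Polynomial R) * (Polynomial.X - Polynomial.C a) * S
    + (Polynomial.X - Polynomial.C a) * (Polynomial.X - Polynomial.C b) * Polynomial.derivative S
    with hB
  have hder : Polynomial.derivative P = (Polynomial.X - Polynomial.C a) ^ m *
      (Polynomial.X - Polynomial.C b) ^ k * B := by
    rw [hPS, Polynomial.derivative_mul, Polynomial.derivative_mul,
      Polynomial.derivative_X_sub_C_pow, Polynomial.derivative_X_sub_C_pow, hB]
    simp only [Nat.add_sub_cancel, map_natCast]
    push_cast
    ring
  have hBa : B.eval a = ((m : R) + 1) * (a - b) * S.eval a := by simp [hB]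
  have hBb : B.eval b = ((k : R) + 1) * (b - a) * S.eval b := by simp [hB]
  have hm1 : (0 : R) < (m : R) + 1 := by positivity
  have hk1 : (0 : R) < (k : R) + 1 := by positivity
  obtain ⟨c, h1, h2, h3⟩ := pivt' hR B a b hab (by
    rw [hBa, hBb]
    have : ((m : R) + 1) * (a - b) * S.eval a * (((k : R) + 1) * (b - a) * S.eval b)
      = -((((m : R) + 1) * ((k : R) + 1)) * ((b - a) * (b - a)) * (S.eval a * S.eval b)) := by ring
    rw [this, neg_lt_zero]
    have : 0 < b - a := by linarith
    positivity)
  exact ⟨c, h1, h2, by rw [hder, Polynomial.eval_mul, h3, mul_zero]⟩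

end sturm
end H17
namespace H17

section transfer
set_option linter.unusedSectionVars false
variable {L : Type} [Field L] [LinearOrder L] [IsStrictOrderedRing L]
variable {D : Type} [CommRing D] [IsDomain D]

lemma sg_eq_zero {x : L} : sg x = 0 ↔ x = 0 := by
  rcases lt_trichotomy x 0 with h | h | h
  · simp [sg_neg h, h.ne]
  · simp [h]
  · simp [sg_pos h, h.ne']

lemma pivt_real : PIVT ℝ := by
  intro p a b hab ha hb
  have hc : ContinuousOn (fun x => p.eval x) (Set.Icc a b) := p.continuous.continuousOn
  obtain ⟨c, hc1, hc2⟩ := intermediate_value_Ioo hab.le hc ⟨ha, hb⟩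
  exact ⟨c, hc1.1, hc1.2, hc2⟩

lemma sg_one : sg (1 : L) = 1 := sg_pos one_pos

lemma sg_prod {ι : Type} (s : Finset ι) (u : ι → L) : sg (∏ i ∈ s, u i) = ∏ i ∈ s, sg (u i) := by
  classical
  induction s using Finset.induction_on with
  | empty => simp [sg_one]
  | insert a s ha ih => rw [Finset.prod_insert ha, Finset.prod_insert ha, sg_mul, ih]

lemma ind_zero_right (f : Polynomial L) : ind f 0 = 0 := by
  unfold ind
  apply Finset.sum_eq_zero
  intro x _
  simp

lemma ind_zero_left (g : Polynomial L) : ind 0 g = 0 := by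
  simp [ind]

lemma ind_const (c : L) (g : Polynomial L) : ind (Polynomial.C c) g = 0 := by
  simp [ind]

/-- pseudo remainder step -/
noncomputable def red (f g : Polynomial D) : Polynomial D :=
  Polynomial.C (f.leadingCoeff * f.leadingCoeff) * g +
    (Polynomial.C (-(f.leadingCoeff * g.leadingCoeff)) *
      Polynomial.X ^ (g.natDegree - f.natDegree)) * f

lemma red_deg (f g : Polynomial D) (hf : f ≠ 0) (hg : g ≠ 0) (h : f.natDegree ≤ g.natDegree)
    (h0 : 0 < g.natDegree) : (red f g).natDegree < g.natDegree := by
  have hc : f.leadingCoeff ≠ 0 := by simpa using hf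
  have hd : g.leadingCoeff ≠ 0 := by simpa using hg
  have e : red f g = Polynomial.C (f.leadingCoeff * f.leadingCoeff) * g -
      (Polynomial.C (f.leadingCoeff * g.leadingCoeff) *
      Polynomial.X ^ (g.natDegree - f.natDegree)) * f := by
    simp only [red, Polynomial.C_neg]; ring
  by_cases hr : red f g = 0
  · rw [hr]; simpa using h0
  have hcc : f.leadingCoeff * f.leadingCoeff ≠ 0 := mul_ne_zero hc hc
  have hcd : f.leadingCoeff * g.leadingCoeff ≠ 0 := mul_ne_zero hc hd
  have hdg : (Polynomial.C (f.leadingCoeff * f.leadingCoeff) * g).degree = g.degree :=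
    Polynomial.degree_C_mul hcc
  apply Polynomial.natDegree_lt_natDegree hr
  rw [← hdg, e]
  apply Polynomial.degree_sub_lt_left
  · rw [hdg, mul_assoc, Polynomial.degree_C_mul hcd, Polynomial.degree_mul,
      Polynomial.degree_X_pow, Polynomial.degree_eq_natDegree hf, Polynomial.degree_eq_natDegree hg]
    norm_cast
    omega
  · exact mul_ne_zero (by simpa using hc) hg
  · simp only [Polynomial.leadingCoeff_mul, Polynomial.leadingCoeff_C, Polynomial.leadingCoeff_X_pow]
    ring

lemma ind_red (χ : D →+* L) (f g : Polynomial D) (hf : χ f.leadingCoeff ≠ 0) :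
    ind (f.map χ) ((red f g).map χ) = ind (f.map χ) (g.map χ) := by
  have : (red f g).map χ = Polynomial.C (χ f.leadingCoeff * χ f.leadingCoeff) * g.map χ +
    ((Polynomial.C (-(f.leadingCoeff * g.leadingCoeff)) *
      Polynomial.X ^ (g.natDegree - f.natDegree)).map χ) * f.map χ := by
    simp only [red, Polynomial.map_add, Polynomial.map_mul, Polynomial.map_C, map_mul]
  rw [this]
  exact ind_mod _ _ _ _ (mul_self_pos.2 hf)

theorem ind_det (φ : D →+* L) (hφ : Function.Injective φ) (hL : PIVT L) :
    ∀ (N : ℕ) (f g : Polynomial D), f.natDegree + g.natDegree = N →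
    ∃ S : Finset D, (∀ s ∈ S, s ≠ 0) ∧ ∀ ψ : D →+* ℝ, (∀ s ∈ S, sg (ψ s) = sg (φ s)) →
      ind (f.map φ) (g.map φ) = ind (f.map ψ) (g.map ψ) := by
  classical
  intro N
  induction N using Nat.strong_induction_on with
  | _ N ih =>
    intro f g hN
    by_cases hf : f = 0
    · exact ⟨∅, by simp, fun ψ _ => by simp [hf, ind_zero_left]⟩
    by_cases hg : g = 0
    · exact ⟨∅, by simp, fun ψ _ => by simp [hg, ind_zero_right]⟩
    by_cases hf0 : f.natDegree = 0
    · rw [Polynomial.eq_C_of_natDegree_eq_zero hf0]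
      exact ⟨∅, by simp, fun ψ _ => by simp only [Polynomial.map_C, ind_const]⟩
    have hc : f.leadingCoeff ≠ 0 := by simpa using hf
    have hd : g.leadingCoeff ≠ 0 := by simpa using hg
    have hφne : ∀ x, x ≠ 0 → φ x ≠ 0 := fun x hx => (map_ne_zero_iff φ hφ).2 hx
    have hψne : ∀ (ψ : D →+* ℝ) x, x ≠ 0 → sg (ψ x) = sg (φ x) → ψ x ≠ 0 := by
      intro ψ x hx h h0
      rw [h0, sg_zero] at h
      exact hφne x hx (sg_eq_zero.1 h.symm)
    rcases le_or_gt f.natDegree g.natDegree with h | h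
    · have hlt := red_deg f g hf hg h (by omega)
      obtain ⟨S, hS0, hS⟩ := ih _ (by omega) f (red f g) rfl
      refine ⟨insert f.leadingCoeff S, ?_, ?_⟩
      · intro s hs
        rcases Finset.mem_insert.1 hs with rfl | hs
        · exact hc
        · exact hS0 s hs
      · intro ψ hψ
        have h1 := hS ψ (fun s hs => hψ s (Finset.mem_insert_of_mem hs))
        rw [ind_red φ f g (hφne _ hc), ind_red ψ f g
          (hψne ψ _ hc (hψ _ (Finset.mem_insert_self _ _)))] at h1
        exact h1
    · have hlt := red_deg g f hg hf h.le (by omega)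
      obtain ⟨S, hS0, hS⟩ := ih _ (by omega) g (red g f) rfl
      refine ⟨insert f.leadingCoeff (insert g.leadingCoeff S), ?_, ?_⟩
      · intro s hs
        rcases Finset.mem_insert.1 hs with rfl | hs
        · exact hc
        rcases Finset.mem_insert.1 hs with rfl | hs
        · exact hd
        · exact hS0 s hs
      · intro ψ hψ
        have h1 := hS ψ (fun s hs => hψ s (Finset.mem_insert_of_mem (Finset.mem_insert_of_mem hs)))
        have sc := hψ f.leadingCoeff (Finset.mem_insert_self _ _)
        have sd := hψ g.leadingCoeff (Finset.mem_insert_of_mem (Finset.mem_insert_self _ _))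
        have nc := hψne ψ _ hc sc
        have nd := hψne ψ _ hd sd
        have mc := hφne _ hc
        have md := hφne _ hd
        rw [ind_red φ g f md, ind_red ψ g f nd] at h1
        have hne : ∀ {M : Type} [Field M] (χ : D →+* M) (p : Polynomial D),
            χ p.leadingCoeff ≠ 0 → p.map χ ≠ 0 := by
          intro M _ χ p hp h0
          apply hp
          have := congrArg (fun q => q.coeff p.natDegree) h0
          simpa [Polynomial.coeff_map] using this
        rw [ind_swap hL _ _ (hne φ f mc) (hne φ g md),
          ind_swap pivt_real _ _ (hne ψ f nc) (hne ψ g nd), h1,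
          Polynomial.natDegree_map_of_leadingCoeff_ne_zero φ mc,
          Polynomial.natDegree_map_of_leadingCoeff_ne_zero φ md,
          Polynomial.natDegree_map_of_leadingCoeff_ne_zero ψ nc,
          Polynomial.natDegree_map_of_leadingCoeff_ne_zero ψ nd,
          Polynomial.leadingCoeff_map_of_leadingCoeff_ne_zero φ mc,
          Polynomial.leadingCoeff_map_of_leadingCoeff_ne_zero φ md,
          Polynomial.leadingCoeff_map_of_leadingCoeff_ne_zero ψ nc,
          Polynomial.leadingCoeff_map_of_leadingCoeff_ne_zero ψ nd,
          sg_mul, sg_mul, sc, sd]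

end transfer
end H17
namespace H17

section onevar
set_option linter.unusedSectionVars false
variable {L : Type} [Field L] [LinearOrder L] [IsStrictOrderedRing L]
variable {D : Type} [CommRing D] [IsDomain D]

/-- product of powers attached to a subset -/
noncomputable def hprod [DecidableEq (Polynomial D)] (S T : Finset (Polynomial D)) : Polynomial D :=
  (∏ s ∈ T, s ^ 2) * ∏ s ∈ S \ T, s

lemma count_eq [DecidableEq (Polynomial D)] (χ : D →+* L) (F : Polynomial D) (hF : F.map χ ≠ 0)
    (S : Finset (Polynomial D)) :
    ∑ T ∈ S.powerset, ind (F.map χ) ((Polynomial.derivative F * hprod S T).map χ) =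
      ∑ ξ ∈ (F.map χ).roots.toFinset,
        ∏ s ∈ S, (sg ((s.map χ).eval ξ) ^ 2 + sg ((s.map χ).eval ξ)) := by
  have h1 : ∀ T ∈ S.powerset, ind (F.map χ) ((Polynomial.derivative F * hprod S T).map χ) =
      ∑ ξ ∈ (F.map χ).roots.toFinset, sg (((hprod S T).map χ).eval ξ) := by
    intro T _
    rw [Polynomial.map_mul, ← Polynomial.derivative_map, ind_taq _ _ hF]
  rw [Finset.sum_congr rfl h1, Finset.sum_comm]
  refine Finset.sum_congr rfl fun ξ _ => ?_
  rw [Finset.prod_add]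
  refine Finset.sum_congr rfl fun T _ => ?_
  rw [hprod, Polynomial.map_mul, Polynomial.eval_mul, sg_mul, Polynomial.map_prod,
    Polynomial.map_prod, Polynomial.eval_prod, Polynomial.eval_prod, sg_prod, sg_prod]
  congr 1
  refine Finset.prod_congr rfl fun s _ => ?_
  rw [Polynomial.map_pow, Polynomial.eval_pow, pow_two, sg_mul, pow_two]

lemma term_nonneg (S : Finset (Polynomial D)) (u : Polynomial D → L) :
    0 ≤ ∏ s ∈ S, (sg (u s) ^ 2 + sg (u s)) := by
  refine Finset.prod_nonneg fun s _ => ?_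
  rcases lt_trichotomy (u s) 0 with h | h | h
  · simp [sg_neg h]
  · simp [h]
  · simp [sg_pos h]

lemma term_pos (S : Finset (Polynomial D)) (u : Polynomial D → L) (h : ∀ s ∈ S, 0 < u s) :
    0 < ∏ s ∈ S, (sg (u s) ^ 2 + sg (u s)) := by
  refine Finset.prod_pos fun s hs => ?_
  simp [sg_pos (h s hs)]

lemma of_term_ne (S : Finset (Polynomial D)) (u : Polynomial D → L)
    (h : ∏ s ∈ S, (sg (u s) ^ 2 + sg (u s)) ≠ 0) : ∀ s ∈ S, 0 < u s := by
  intro s hs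
  rw [Finset.prod_ne_zero_iff] at h
  have := h s hs
  rcases lt_trichotomy (u s) 0 with h | h | h
  · simp [sg_neg h] at this
  · simp [h] at this
  · exact h

lemma onevar_top (φ : D →+* L) (hφ : Function.Injective φ) (hL : PIVT L)
    (S : Finset (Polynomial D)) (c : L) (hpos : ∀ s ∈ S, 0 < (s.map φ).eval c)
    (hno : ∀ s ∈ S, ∀ x, c < x → (s.map φ).eval x ≠ 0) :
    ∃ S' : Finset D, (∀ s ∈ S', s ≠ 0) ∧ ∀ ψ : D →+* ℝ, (∀ s ∈ S', sg (ψ s) = sg (φ s)) →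
      ∃ c' : ℝ, ∀ s ∈ S, 0 < (s.map ψ).eval c' := by
  classical
  have hlc : ∀ s ∈ S, 0 < φ s.leadingCoeff := by
    intro s hs
    have h1 := sg_eq_lc hL (s.map φ) c (by
      intro x hx
      rcases hx.lt_or_eq with hx | rfl
      · exact hno s hs x hx
      · exact (hpos s hs).ne')
    rw [sg_pos (hpos s hs), Polynomial.leadingCoeff_map_of_injective hφ] at h1
    exact sg_eq_one.1 h1.symm
  refine ⟨S.image Polynomial.leadingCoeff, ?_, ?_⟩
  · intro s hs
    obtain ⟨t, ht, rfl⟩ := Finset.mem_image.1 hs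
    intro h0
    have := hlc t ht
    rw [h0, map_zero] at this
    exact lt_irrefl _ this
  · intro ψ hψ
    have : ∀ᶠ x : ℝ in Filter.atTop, ∀ s ∈ S, 0 < (s.map ψ).eval x := by
      rw [Filter.eventually_all_finset]
      intro s hs
      have h1 := hψ _ (Finset.mem_image_of_mem _ hs)
      rw [sg_pos (hlc s hs), sg_eq_one] at h1
      obtain ⟨M, hM⟩ := pos_at_top (s.map ψ) (by
        rw [Polynomial.leadingCoeff_map_of_leadingCoeff_ne_zero ψ h1.ne']; exact h1)
      exact Filter.eventually_atTop.2 ⟨M, hM⟩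
    exact this.exists

lemma map_comp_neg {M : Type} [Field M] (χ : D →+* M) (s : Polynomial D) (x : M) :
    ((s.comp (-Polynomial.X)).map χ).eval x = (s.map χ).eval (-x) := by
  rw [Polynomial.map_comp, Polynomial.eval_comp]; simp

theorem onevar (φ : D →+* L) (hφ : Function.Injective φ) (hL : PIVT L)
    (S : Finset (Polynomial D)) (c : L) (hpos : ∀ s ∈ S, 0 < (s.map φ).eval c) :
    ∃ S' : Finset D, (∀ s ∈ S', s ≠ 0) ∧ ∀ ψ : D →+* ℝ, (∀ s ∈ S', sg (ψ s) = sg (φ s)) →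
      ∃ c' : ℝ, ∀ s ∈ S, 0 < (s.map ψ).eval c' := by
  classical
  by_cases hb : ∀ s ∈ S, ∀ x, c < x → (s.map φ).eval x ≠ 0
  · exact onevar_top φ hφ hL S c hpos hb
  by_cases ha : ∀ s ∈ S, ∀ x, x < c → (s.map φ).eval x ≠ 0
  · obtain ⟨S', h1, h2⟩ := onevar_top φ hφ hL (S.image (fun s => s.comp (-Polynomial.X))) (-c)
      (by
        intro s hs
        obtain ⟨t, ht, rfl⟩ := Finset.mem_image.1 hs
        rw [map_comp_neg, neg_neg]; exact hpos t ht)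
      (by
        intro s hs x hx
        obtain ⟨t, ht, rfl⟩ := Finset.mem_image.1 hs
        rw [map_comp_neg]; exact ha t ht _ (by linarith))
    refine ⟨S', h1, fun ψ hψ => ?_⟩
    obtain ⟨c', hc'⟩ := h2 ψ hψ
    refine ⟨-c', fun s hs => ?_⟩
    rw [← map_comp_neg]
    exact hc' _ (Finset.mem_image_of_mem _ hs)
  push Not at ha hb
  obtain ⟨sa, hsa, xa, hxa, hxa0⟩ := ha
  obtain ⟨sb, hsb, xb, hxb, hxb0⟩ := hb
  set G : Polynomial D := ∏ s ∈ S, s with hG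
  have hGe : ∀ x, (G.map φ).eval x = ∏ s ∈ S, (s.map φ).eval x := by
    intro x; rw [hG, Polynomial.map_prod, Polynomial.eval_prod]
  have hGc : 0 < (G.map φ).eval c := by rw [hGe]; exact Finset.prod_pos hpos
  have hG0 : G.map φ ≠ 0 := by intro h; rw [h] at hGc; simp at hGc
  have hmem : ∀ x, x ∈ (G.map φ).roots.toFinset ↔ (G.map φ).eval x = 0 := by
    intro x
    rw [Multiset.mem_toFinset, Polynomial.mem_roots hG0, Polynomial.IsRoot.def]
  have hra : (G.map φ).eval xa = 0 := by rw [hGe]; exact Finset.prod_eq_zero hsa hxa0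
  have hrb : (G.map φ).eval xb = 0 := by rw [hGe]; exact Finset.prod_eq_zero hsb hxb0
  obtain ⟨a, haM, hamax⟩ := ((G.map φ).roots.toFinset.filter (· < c)).exists_max_image id
    ⟨xa, Finset.mem_filter.2 ⟨(hmem _).2 hra, hxa⟩⟩
  obtain ⟨b, hbM, hbmin⟩ := ((G.map φ).roots.toFinset.filter (c < ·)).exists_min_image id
    ⟨xb, Finset.mem_filter.2 ⟨(hmem _).2 hrb, hxb⟩⟩
  rw [Finset.mem_filter, hmem] at haM hbM
  have hnoroot : ∀ x, a < x → x < b → (G.map φ).eval x ≠ 0 := by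
    intro x h1 h2 h0
    rcases lt_trichotomy x c with h | h | h
    · exact absurd (hamax x (Finset.mem_filter.2 ⟨(hmem _).2 h0, h⟩)) (not_le.2 h1)
    · rw [h] at h0; exact hGc.ne' h0
    · exact absurd (hbmin x (Finset.mem_filter.2 ⟨(hmem _).2 h0, h⟩)) (not_le.2 h2)
  obtain ⟨ξ, hξa, hξb, hξ⟩ := rolle hL (G.map φ) hG0 a b (haM.2.trans hbM.2) haM.1 hbM.1 hnoroot
  have hsno : ∀ s ∈ S, ∀ x, a < x → x < b → (s.map φ).eval x ≠ 0 := by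
    intro s hs x h1 h2 h0
    apply hnoroot x h1 h2
    rw [hGe]; exact Finset.prod_eq_zero hs h0
  have hξpos : ∀ s ∈ S, 0 < (s.map φ).eval ξ := by
    intro s hs
    rw [← sg_eq_one, ← sg_pos (hpos s hs)]
    rcases le_total ξ c with h | h
    · exact sg_const hL _ _ _ h
        (fun x h1 h2 => hsno s hs x (hξa.trans_le h1) (h2.trans_lt hbM.2))
    · exact (sg_const hL _ _ _ h
        (fun x h1 h2 => hsno s hs x (haM.2.trans_le h1) (h2.trans_lt hξb))).symm
  set F := Polynomial.derivative G with hF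
  have hFm : F.map φ = Polynomial.derivative (G.map φ) := by rw [hF, Polynomial.derivative_map]
  have hF0 : F.map φ ≠ 0 := by
    intro h
    rw [hFm] at h
    have h2 := Polynomial.derivative_eq_zero.1 h
    have h3 := haM.1
    rw [Polynomial.eq_C_of_natDegree_eq_zero h2] at h3 hG0
    simp only [Polynomial.eval_C] at h3
    rw [h3] at hG0
    simp at hG0
  have hFD : F ≠ 0 := by intro h; rw [h] at hF0; simp at hF0
  have hFl : F.leadingCoeff ≠ 0 := by simpa using hFD
  choose ST hST0 hST using fun T : Finset (Polynomial D) =>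
    ind_det φ hφ hL _ F (Polynomial.derivative F * hprod S T) rfl
  refine ⟨insert F.leadingCoeff (S.powerset.biUnion ST), ?_, ?_⟩
  · intro s hs
    rcases Finset.mem_insert.1 hs with rfl | hs
    · exact hFl
    · obtain ⟨T, _, hT⟩ := Finset.mem_biUnion.1 hs
      exact hST0 T s hT
  · intro ψ hψ
    have hl := hψ _ (Finset.mem_insert_self _ _)
    have hFψ : F.map ψ ≠ 0 := by
      intro h0
      have h1 : ψ F.leadingCoeff = 0 := by
        have := congrArg (fun q => q.coeff F.natDegree) h0
        simpa [Polynomial.coeff_map] using this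
      rw [h1, sg_zero] at hl
      exact hFl ((map_eq_zero_iff φ hφ).1 (sg_eq_zero.1 hl.symm))
    have e1 := count_eq φ F hF0 S
    have e2 := count_eq ψ F hFψ S
    rw [Finset.sum_congr rfl (fun T hT => hST T ψ (fun s hs => hψ s
      (Finset.mem_insert_of_mem (Finset.mem_biUnion.2 ⟨T, hT, hs⟩)))), e2] at e1
    have hpos1 : 0 < ∑ ξ ∈ (F.map φ).roots.toFinset,
        ∏ s ∈ S, (sg ((s.map φ).eval ξ) ^ 2 + sg ((s.map φ).eval ξ)) := by
      apply Finset.sum_pos'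
      · intro x _; exact term_nonneg S (fun s => (s.map φ).eval x)
      · refine ⟨ξ, ?_, term_pos S (fun s => (s.map φ).eval ξ) hξpos⟩
        rw [Multiset.mem_toFinset, Polynomial.mem_roots hF0, Polynomial.IsRoot.def, hFm]
        exact hξ
    rw [← e1] at hpos1
    obtain ⟨x, _, hx⟩ := Finset.exists_ne_zero_of_sum_ne_zero hpos1.ne'
    exact ⟨x, of_term_ne S (fun s => (s.map ψ).eval x) hx⟩

lemma real_sign (φ : ℝ →+* L) (r : ℝ) : sg (φ r) = sg r := by
  rcases lt_trichotomy r 0 with h | h | h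
  · have : φ r = -(φ (Real.sqrt (-r)) * φ (Real.sqrt (-r))) := by
      rw [← map_mul, Real.mul_self_sqrt (by linarith), map_neg, neg_neg]
    rw [sg_neg h, sg_neg]
    rw [this, neg_lt_zero]
    apply mul_self_pos.2
    rw [map_ne_zero]
    exact (Real.sqrt_pos.2 (by linarith)).ne'
  · simp [h]
  · have : φ r = (φ (Real.sqrt r) * φ (Real.sqrt r)) := by
      rw [← map_mul, Real.mul_self_sqrt h.le]
    rw [sg_pos h, sg_pos]
    rw [this]
    apply mul_self_pos.2
    rw [map_ne_zero]
    exact (Real.sqrt_pos.2 h).ne'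

theorem transfer (hL : PIVT L) : ∀ (n : ℕ) (φ : MvPolynomial (Fin n) ℝ →+* L),
    Function.Injective φ → ∀ S : Finset (MvPolynomial (Fin n) ℝ), (∀ s ∈ S, s ≠ 0) →
    ∃ a : Fin n → ℝ, ∀ s ∈ S, sg (MvPolynomial.eval a s) = sg (φ s) := by
  classical
  intro n
  induction n with
  | zero =>
    intro φ hφ S hS
    refine ⟨Fin.elim0, fun s _ => ?_⟩
    rw [MvPolynomial.eq_C_of_isEmpty s, MvPolynomial.eval_C]
    exact (real_sign (φ.comp MvPolynomial.C) _).symm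
  | succ n ih =>
    intro φ hφ S hS
    let θ : Polynomial (MvPolynomial (Fin n) ℝ) →+* L :=
      φ.comp (MvPolynomial.finSuccEquiv ℝ n).symm.toAlgHom.toRingHom
    have hθ : Function.Injective θ := hφ.comp (MvPolynomial.finSuccEquiv ℝ n).symm.injective
    let φ0 : MvPolynomial (Fin n) ℝ →+* L := θ.comp Polynomial.C
    have hφ0 : Function.Injective φ0 := hθ.comp Polynomial.C_injective
    have hθe : ∀ p, θ p = (p.map φ0).eval (θ Polynomial.X) := by
      intro p
      rw [Polynomial.eval_map]
      have : θ = Polynomial.eval₂RingHom φ0 (θ Polynomial.X) := by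
        apply Polynomial.ringHom_ext
        · intro a; simp [φ0]
        · simp
      conv_lhs => rw [this]
      simp
    have hθφ : ∀ s, θ (MvPolynomial.finSuccEquiv ℝ n s) = φ s := by
      intro s
      change φ ((MvPolynomial.finSuccEquiv ℝ n).symm (MvPolynomial.finSuccEquiv ℝ n s)) = φ s
      rw [AlgEquiv.symm_apply_apply]
    obtain ⟨S', h1, h2⟩ := onevar φ0 hφ0 hL
      (S.image (fun s => if 0 < φ s then MvPolynomial.finSuccEquiv ℝ n s
        else -MvPolynomial.finSuccEquiv ℝ n s)) (θ Polynomial.X) (by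
      intro s hs
      obtain ⟨t, ht, rfl⟩ := Finset.mem_image.1 hs
      rw [← hθe]
      split_ifs with h
      · rw [hθφ]; exact h
      · rw [map_neg, hθφ, neg_pos]
        refine lt_of_le_of_ne (not_lt.1 h) ?_
        exact (map_ne_zero_iff φ hφ).2 (hS t ht))
    obtain ⟨a, ha⟩ := ih φ0 hφ0 S' h1
    obtain ⟨c, hc⟩ := h2 (MvPolynomial.eval a) ha
    refine ⟨Fin.cons c a, fun s hs => ?_⟩
    have h3 := hc _ (Finset.mem_image_of_mem _ hs)
    rw [MvPolynomial.eval_eq_eval_mv_eval']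
    split_ifs at h3 with h
    · rw [sg_pos h, sg_pos h3]
    · rw [Polynomial.map_neg, Polynomial.eval_neg, neg_pos] at h3
      rw [sg_neg h3, sg_neg]
      refine lt_of_le_of_ne (not_lt.1 h) ?_
      exact (map_ne_zero_iff φ hφ).2 (hS s hs)

end onevar

theorem hilbert17 (n : ℕ) (g : MvPolynomial (Fin n) ℝ) (hg : ∀ x, 0 ≤ MvPolynomial.eval x g) :
    ∃ A b : MvPolynomial (Fin n) ℝ, A ≠ 0 ∧ IsSumSq b ∧ g * A ^ 2 = b := by
  let K := FractionRing (MvPolynomial (Fin n) ℝ)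
  have key : ∀ k : K, IsSumSq k → ∃ A b : MvPolynomial (Fin n) ℝ, A ≠ 0 ∧ IsSumSq b ∧
      k * algebraMap _ K A ^ 2 = algebraMap _ K b := by
    intro k hk
    induction hk with
    | zero => exact ⟨1, 0, one_ne_zero, IsSumSq.zero, by simp⟩
    | sq_add a hs ih =>
      obtain ⟨A, b, hA, hb, h⟩ := ih
      obtain ⟨u, v, hv, rfl⟩ := IsFractionRing.div_surjective (A := MvPolynomial (Fin n) ℝ) a
      have hv0 : v ≠ 0 := nonZeroDivisors.ne_zero hv
      have hvK : algebraMap _ K v ≠ 0 := by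
        simpa using hv0
      refine ⟨A * v, (u * A) * (u * A) + (v * v) * b, mul_ne_zero hA hv0,
        (IsSumSq.mul_self _).add ((IsSumSq.mul_self _).mul hb), ?_⟩
      simp only [map_mul, map_add, ← h]
      generalize algebraMap _ K u = U at *
      generalize algebraMap _ K v = V at *
      generalize algebraMap _ K A = W at *
      have e : U / V * V = U := div_mul_cancel₀ U hvK
      linear_combination (U / V * V * W ^ 2 + W ^ 2 * U) * e
  by_contra hcon
  have hns : ¬ IsSumSq (algebraMap _ K g) := by
    intro hs
    obtain ⟨A, b, hA, hb, h⟩ := key _ hs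
    refine hcon ⟨A, b, hA, hb, ?_⟩
    apply IsFractionRing.injective (MvPolynomial (Fin n) ℝ) K
    simpa using h
  have : CharZero K := charZero_of_injective_algebraMap
    (IsFractionRing.injective (MvPolynomial (Fin n) ℝ) K)
  obtain ⟨L, _, _, _, φ, hL, hneg⟩ := exists_real_closed K (algebraMap _ K g) hns
  have hinj : Function.Injective (φ.comp (algebraMap (MvPolynomial (Fin n) ℝ) K)) :=
    φ.injective.comp (IsFractionRing.injective (MvPolynomial (Fin n) ℝ) K)
  have hg0 : g ≠ 0 := by rintro rfl; simp at hneg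
  obtain ⟨a, ha⟩ := transfer hL n (φ.comp (algebraMap _ K)) hinj {g} (by simpa using hg0)
  have := ha g (by simp)
  rw [RingHom.comp_apply, sg_neg hneg, sg_eq_neg_one] at this
  exact absurd (hg a) (not_le.2 this)

end H17
namespace H17

section reg
variable {n : ℕ}

/-- restriction of polynomials to lines with direction `b` -/
noncomputable def line (b : Fin n → ℝ) :
    MvPolynomial (Fin n) ℝ →ₐ[ℝ] Polynomial (MvPolynomial (Fin n) ℝ) :=
  MvPolynomial.aeval (fun k => Polynomial.C (MvPolynomial.X k) +
    Polynomial.C (MvPolynomial.C (b k)) * Polynomial.X)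

lemma line_eval (b x : Fin n → ℝ) (t : ℝ) (p : MvPolynomial (Fin n) ℝ) :
    ((line b p).map (MvPolynomial.eval x)).eval t = MvPolynomial.eval (fun k => x k + b k * t) p := by
  induction p using MvPolynomial.induction_on with
  | C r =>
    have : line b (MvPolynomial.C r) = Polynomial.C (MvPolynomial.C r) := by
      rw [← MvPolynomial.algebraMap_eq, AlgHom.commutes]
      rfl
    rw [this]
    simp
  | add p q hp hq => simp [hp, hq]
  | mul_X p k hp =>
    have : line b (MvPolynomial.X k) = Polynomial.C (MvPolynomial.X k) +
      Polynomial.C (MvPolynomial.C (b k)) * Polynomial.X := by simp [line]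
    rw [map_mul, this]
    simp [hp]

lemma exists_eval_ne (q : MvPolynomial (Fin n) ℝ) (hq : q ≠ 0) : ∃ y, MvPolynomial.eval y q ≠ 0 := by
  by_contra h
  push Not at h
  apply hq
  apply MvPolynomial.funext
  intro x
  rw [h x, map_zero]

lemma line_ne (q : MvPolynomial (Fin n) ℝ) (x y : Fin n → ℝ) (hy : MvPolynomial.eval y q ≠ 0) :
    (line (fun k => y k - x k) q).map (MvPolynomial.eval x) ≠ 0 := by
  intro h
  have h1 := line_eval (fun k => y k - x k) x 1 q
  rw [h] at h1
  simp only [Polynomial.eval_zero, mul_one, add_sub_cancel] at h1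
  exact hy h1.symm

lemma dense_ne (q : MvPolynomial (Fin n) ℝ) (hq : q ≠ 0) : Dense {x | MvPolynomial.eval x q ≠ 0} := by
  intro x
  obtain ⟨y, hy⟩ := exists_eval_ne q hq
  have hne := line_ne q x y hy
  set b := fun k => y k - x k
  set P := (line b q).map (MvPolynomial.eval x) with hP
  have hd : Dense ((P.roots.toFinset : Set ℝ)ᶜ) :=
    P.roots.toFinset.finite_toSet.countable.dense_compl ℝ
  have hc : Continuous (fun t : ℝ => (fun k => x k + b k * t : Fin n → ℝ)) := by fun_prop
  have h0 : (0 : ℝ) ∈ closure ((P.roots.toFinset : Set ℝ)ᶜ) := hd 0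
  have h1 := image_closure_subset_closure_image hc ⟨0, h0, rfl⟩
  simp only [mul_zero, add_zero] at h1
  refine closure_mono ?_ h1
  rintro _ ⟨t, ht, rfl⟩
  simp only [Set.mem_ofPred_eq, ← line_eval]
  intro h
  apply ht
  rw [Finset.mem_coe, Multiset.mem_toFinset, Polynomial.mem_roots hne]
  exact h

lemma eq_of_eq_ne (q : MvPolynomial (Fin n) ℝ) (hq : q ≠ 0) (u v : (Fin n → ℝ) → ℝ)
    (hu : Continuous u) (hv : Continuous v) (h : ∀ x, MvPolynomial.eval x q ≠ 0 → u x = v x) :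
    ∀ x, u x = v x := by
  have := Continuous.ext_on (dense_ne q hq) hu hv h
  exact fun x => congrFun this x

lemma reg_poly (p : MvPolynomial (Fin n) ℝ) : Regulous n (fun x => MvPolynomial.eval x p) :=
  ⟨MvPolynomial.continuous_eval p, p, 1, one_ne_zero, fun x _ => by simp⟩

lemma reg_const (r : ℝ) : Regulous n (fun _ => r) := by
  simpa using reg_poly (n := n) (MvPolynomial.C r)

lemma reg_add {f g : (Fin n → ℝ) → ℝ} (hf : Regulous n f) (hg : Regulous n g) :
    Regulous n (fun x => f x + g x) := by
  obtain ⟨cf, p, q, hq, h⟩ := hf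
  obtain ⟨cg, r, s, hs, h'⟩ := hg
  refine ⟨cf.add cg, p * s + r * q, q * s, mul_ne_zero hq hs, fun x hx => ?_⟩
  rw [map_mul] at hx
  have h1 := left_ne_zero_of_mul hx
  have h2 := right_ne_zero_of_mul hx
  simp only [h x h1, h' x h2, map_add, map_mul]
  field_simp

lemma reg_mul {f g : (Fin n → ℝ) → ℝ} (hf : Regulous n f) (hg : Regulous n g) :
    Regulous n (fun x => f x * g x) := by
  obtain ⟨cf, p, q, hq, h⟩ := hf
  obtain ⟨cg, r, s, hs, h'⟩ := hg
  refine ⟨cf.mul cg, p * r, q * s, mul_ne_zero hq hs, fun x hx => ?_⟩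
  rw [map_mul] at hx
  have h1 := left_ne_zero_of_mul hx
  have h2 := right_ne_zero_of_mul hx
  simp only [h x h1, h' x h2, map_mul]
  field_simp

lemma reg_sub {f g : (Fin n → ℝ) → ℝ} (hf : Regulous n f) (hg : Regulous n g) :
    Regulous n (fun x => f x - g x) := by
  have := reg_add hf (reg_mul (reg_const (-1)) hg)
  refine cast ?_ this
  congr 1
  funext x
  ring

lemma reg_sq {f : (Fin n → ℝ) → ℝ} (hf : Regulous n f) : Regulous n (fun x => f x ^ 2) := by
  have := reg_mul hf hf
  refine cast ?_ this
  congr 1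
  funext x
  ring

lemma reg_sum {ι : Type} (s : Finset ι) (F : ι → (Fin n → ℝ) → ℝ) (hF : ∀ i, Regulous n (F i)) :
    Regulous n (fun x => ∑ i ∈ s, F i x) := by
  classical
  induction s using Finset.induction_on with
  | empty => simpa using reg_const (n := n) 0
  | insert a s ha ih =>
    simp only [Finset.sum_insert ha]
    exact reg_add (hF a) ih

lemma reg_quot {k F G : (Fin n → ℝ) → ℝ} (hk : Continuous k) (hF : Regulous n F)
    (hG : Regulous n G) (hne : ∃ x, G x ≠ 0) (h : ∀ x, k x * G x = F x) : Regulous n k := by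
  obtain ⟨cF, p, q, hq, h1⟩ := hF
  obtain ⟨cG, r, s, hs, h2⟩ := hG
  have hr : r ≠ 0 := by
    rintro rfl
    obtain ⟨x, hx⟩ := hne
    apply hx
    refine eq_of_eq_ne s hs G (fun _ => 0) cG continuous_const (fun x hx => ?_) x
    rw [h2 x hx]; simp
  refine ⟨hk, p * s * s, q * r * s, mul_ne_zero (mul_ne_zero hq hr) hs, fun x hx => ?_⟩
  simp only [map_mul] at hx ⊢
  have hs' := right_ne_zero_of_mul hx
  have hq' := left_ne_zero_of_mul (left_ne_zero_of_mul hx)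
  have hr' := right_ne_zero_of_mul (left_ne_zero_of_mul hx)
  have := h x
  rw [h1 x hq', h2 x hs'] at this
  field_simp at this ⊢
  linear_combination this

lemma reg_div {N Δ E : (Fin n → ℝ) → ℝ} (hN : Regulous n N) (hD : Regulous n Δ)
    (hE : Continuous E) (hle : ∀ x, N x ^ 2 ≤ E x * Δ x ^ 2) (hE0 : ∀ x, 0 ≤ E x)
    (hED : ∀ x, E x ≠ 0 → Δ x ≠ 0) : Regulous n (fun x => N x / Δ x) := by
  by_cases hz : ∃ x, Δ x ≠ 0
  swap
  · push Not at hz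
    simpa [hz] using reg_const (n := n) 0
  have hN0 : ∀ x, Δ x = 0 → N x = 0 := by
    intro x hx
    have := hle x
    rw [hx] at this
    nlinarith [sq_nonneg (N x)]
  have hb : ∀ x, |N x / Δ x| ≤ Real.sqrt (E x) := by
    intro x
    apply Real.abs_le_sqrt
    by_cases hx : Δ x = 0
    · simp [hx, hE0 x]
    · rw [div_pow, div_le_iff₀ (by positivity)]
      exact hle x
  refine reg_quot ?_ hN hD hz ?_
  · rw [continuous_iff_continuousAt]
    intro x
    by_cases hx : E x = 0
    · have h0 : N x / Δ x = 0 := by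
        have := hb x
        rw [hx, Real.sqrt_zero] at this
        exact abs_nonpos_iff.1 this
      rw [ContinuousAt, h0]
      refine squeeze_zero_norm (a := fun x => Real.sqrt (E x)) hb ?_
      have : Filter.Tendsto (fun x => Real.sqrt (E x)) (nhds x) (nhds (Real.sqrt (E x))) :=
        (Real.continuous_sqrt.comp hE).tendsto x
      rwa [hx, Real.sqrt_zero] at this
    · exact hN.1.continuousAt.div hD.1.continuousAt (hED x hx)
  · intro x
    by_cases hx : Δ x = 0
    · simp [hx, hN0 x hx]
    · field_simp

/-- finite sums of squares of regulous functions -/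
def SR (n : ℕ) (g : (Fin n → ℝ) → ℝ) : Prop :=
  ∃ (ι : Type) (_ : Fintype ι) (F : ι → (Fin n → ℝ) → ℝ), (∀ i, Regulous n (F i)) ∧
    ∀ x, g x = ∑ i, F i x ^ 2

lemma SR.nonneg {g : (Fin n → ℝ) → ℝ} (h : SR n g) (x : Fin n → ℝ) : 0 ≤ g x := by
  obtain ⟨ι, _, F, _, h⟩ := h
  rw [h]; positivity

lemma SR.reg {g : (Fin n → ℝ) → ℝ} (h : SR n g) : Regulous n g := by
  obtain ⟨ι, _, F, hF, h⟩ := h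
  have : g = fun x => ∑ i, F i x ^ 2 := funext h
  rw [this]
  exact reg_sum _ (fun i x => F i x ^ 2) (fun i => reg_sq (hF i))

lemma SR.add {g h : (Fin n → ℝ) → ℝ} (hg : SR n g) (hh : SR n h) : SR n (fun x => g x + h x) := by
  obtain ⟨ι, _, F, hF, h1⟩ := hg
  obtain ⟨κ, _, G, hG, h2⟩ := hh
  refine ⟨ι ⊕ κ, inferInstance, Sum.elim F G, ?_, fun x => ?_⟩
  · rintro (i | i)
    · exact hF i
    · exact hG i
  · simp [h1, h2]

lemma SR.mul {g h : (Fin n → ℝ) → ℝ} (hg : SR n g) (hh : SR n h) : SR n (fun x => g x * h x) := by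
  obtain ⟨ι, _, F, hF, h1⟩ := hg
  obtain ⟨κ, _, G, hG, h2⟩ := hh
  refine ⟨ι × κ, inferInstance, fun i x => F i.1 x * G i.2 x, fun i => reg_mul (hF _) (hG _),
    fun x => ?_⟩
  simp only [h1, h2]
  rw [Finset.sum_mul_sum, Fintype.sum_prod_type]
  simp only [mul_pow]

lemma SR.sq {g : (Fin n → ℝ) → ℝ} (hg : Regulous n g) : SR n (fun x => g x ^ 2) :=
  ⟨Unit, inferInstance, fun _ => g, fun _ => hg, fun x => by simp⟩

lemma SR.zero : SR n (fun _ => 0) :=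
  ⟨Empty, inferInstance, fun i => i.elim, fun i => i.elim, fun x => by simp⟩

lemma SR.sum_sq {ι : Type} [Fintype ι] (B : ι → MvPolynomial (Fin n) ℝ) :
    SR n (fun x => ∑ i, MvPolynomial.eval x (B i) ^ 2) :=
  ⟨ι, inferInstance, fun i x => MvPolynomial.eval x (B i), fun i => reg_poly _, fun _ => rfl⟩

theorem trick {f w α β : (Fin n → ℝ) → ℝ} (hf : Regulous n f) (hf0 : ∀ x, 0 ≤ f x)
    (hw : Regulous n w) (hα : SR n α) (hβ : SR n β)
    (hne : ∀ x, f x ≠ 0 → w x ≠ 0 → ¬ (α x = 0 ∧ β x = 0)) :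
    ∃ h, SR n h ∧ ∀ x, β x = f x * α x → (α x ≠ 0 ∨ f x = 0 ∨ w x = 0) →
      h x = f x * w x ^ 2 := by
  have hα0 := hα.nonneg
  have hβ0 := hβ.nonneg
  have rα := hα.reg
  have rβ := hβ.reg
  obtain ⟨ι, _, a, ha, hα⟩ := hα
  obtain ⟨κ, _, b, hb, hβ⟩ := hβ
  set u : (Fin n → ℝ) → ℝ := fun x => f x * α x with hu
  have ru : Regulous n u := reg_mul hf rα
  set d : (Fin n → ℝ) → ℝ := fun x => β x - u x with hd
  have rd : Regulous n d := reg_sub rβ ru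
  set Δ : (Fin n → ℝ) → ℝ := fun x => u x ^ 2 + d x ^ 2 with hΔ
  have rΔ : Regulous n Δ := reg_add (reg_sq ru) (reg_sq rd)
  have hΔ0 : ∀ x, 0 ≤ Δ x := fun x => by positivity
  have hu0 : ∀ x, 0 ≤ u x := fun x => mul_nonneg (hf0 x) (hα0 x)
  have hub : ∀ x, u x * β x ≤ 2 * Δ x := by
    intro x
    simp only [hΔ, hd]
    nlinarith [sq_nonneg (4 * β x - 5 * u x), sq_nonneg (u x), hu0 x, hβ0 x]
  have hale : ∀ i x, a i x ^ 2 ≤ α x := by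
    intro i x
    rw [hα]
    exact Finset.single_le_sum (f := fun i => a i x ^ 2) (fun i _ => sq_nonneg _) (Finset.mem_univ i)
  have hble : ∀ i x, b i x ^ 2 ≤ β x := by
    intro i x
    rw [hβ]
    exact Finset.single_le_sum (f := fun i => b i x ^ 2) (fun i _ => sq_nonneg _) (Finset.mem_univ i)
  have key : ∀ (e : (Fin n → ℝ) → ℝ), Regulous n e → (∀ x, e x ^ 2 ≤ Δ x) → ∀ i j,
      Regulous n (fun x => (a i x * b j x * f x * e x * w x) / Δ x) := by
    intro e re he i j
    apply reg_div (E := fun x => 2 * f x * w x ^ 2)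
      (reg_mul (reg_mul (reg_mul (reg_mul (ha i) (hb j)) hf) re) hw) rΔ
      (reg_mul (reg_mul (reg_const 2) hf) (reg_sq hw)).1
    · intro x
      have h1 : a i x ^ 2 * b j x ^ 2 ≤ α x * β x :=
        mul_le_mul (hale i x) (hble j x) (sq_nonneg _) (hα0 x)
      have h2 : a i x ^ 2 * b j x ^ 2 * e x ^ 2 ≤ α x * β x * Δ x :=
        mul_le_mul h1 (he x) (sq_nonneg _) (mul_nonneg (hα0 x) (hβ0 x))
      calc (a i x * b j x * f x * e x * w x) ^ 2
          = (a i x ^ 2 * b j x ^ 2 * e x ^ 2) * (f x * w x) ^ 2 := by ring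
        _ ≤ (α x * β x * Δ x) * (f x * w x) ^ 2 := mul_le_mul_of_nonneg_right h2 (sq_nonneg _)
        _ = (u x * β x) * (Δ x * f x * w x ^ 2) := by simp only [hu]; ring
        _ ≤ (2 * Δ x) * (Δ x * f x * w x ^ 2) := by
            apply mul_le_mul_of_nonneg_right (hub x)
            have := hΔ0 x
            have := hf0 x
            positivity
        _ = 2 * f x * w x ^ 2 * Δ x ^ 2 := by ring
    · intro x
      have := hf0 x
      positivity
    · intro x hx hD
      have hfx : f x ≠ 0 := by intro h; simp [h] at hx
      have hwx : w x ≠ 0 := by intro h; simp [h] at hx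
      simp only [hΔ] at hD
      have h1 : u x = 0 := by nlinarith [sq_nonneg (u x), sq_nonneg (d x)]
      have h2 : d x = 0 := by nlinarith [sq_nonneg (u x), sq_nonneg (d x)]
      refine hne x hfx hwx ⟨?_, ?_⟩
      · simpa [hu, hfx] using h1
      · simp only [hd, h1, sub_zero] at h2; exact h2
  refine ⟨fun x => ∑ i : ((ι × κ) ⊕ (ι × κ)), (Sum.elim
      (fun p : ι × κ => (a p.1 x * b p.2 x * f x * u x * w x) / Δ x)
      (fun p : ι × κ => (a p.1 x * b p.2 x * f x * d x * w x) / Δ x) i) ^ 2,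
    ⟨(ι × κ) ⊕ (ι × κ), inferInstance, fun i x => (Sum.elim
      (fun p : ι × κ => (a p.1 x * b p.2 x * f x * u x * w x) / Δ x)
      (fun p : ι × κ => (a p.1 x * b p.2 x * f x * d x * w x) / Δ x) i), ?_, fun x => rfl⟩, ?_⟩
  · rintro (p | p)
    · exact key u ru (fun x => by simp only [hΔ]; nlinarith [sq_nonneg (d x)]) p.1 p.2
    · exact key d rd (fun x => by simp only [hΔ]; nlinarith [sq_nonneg (u x)]) p.1 p.2
  · intro x hx hor
    have hd0 : d x = 0 := by simp only [hd, hu, hx]; ring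
    simp only [Fintype.sum_sum_type, Sum.elim_inl, Sum.elim_inr]
    by_cases hfw : f x = 0 ∨ w x = 0
    · rcases hfw with h | h <;> simp [h]
    push Not at hfw
    have hαx : α x ≠ 0 := by
      rcases hor with h | h | h
      · exact h
      · exact absurd h hfw.1
      · exact absurd h hfw.2
    have hux : u x ≠ 0 := mul_ne_zero hfw.1 hαx
    have hΔx : Δ x = u x ^ 2 := by simp only [hΔ, hd0]; ring
    have e1 : ∑ p : ι × κ, (a p.1 x * b p.2 x * f x * u x * w x / Δ x) ^ 2 =
        (α x * β x) * (f x * u x * w x / Δ x) ^ 2 := by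
      rw [hα, hβ, Finset.sum_mul_sum, Fintype.sum_prod_type, Finset.sum_mul]
      refine Finset.sum_congr rfl fun i _ => ?_
      rw [Finset.sum_mul]
      refine Finset.sum_congr rfl fun j _ => ?_
      ring
    rw [e1, hd0, hΔx, hx]
    simp only [mul_zero, zero_mul, zero_div, ne_eq, OfNat.ofNat_ne_zero, not_false_eq_true, zero_pow,
      Finset.sum_const_zero, add_zero]
    simp only [hu] at hux ⊢
    have := hfw.1
    field_simp

lemma univ {ι : Type} [Fintype ι] (F : ℝ → ℝ) (hF : Continuous F) : ∀ (m : ℕ) (A : Polynomial ℝ)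
    (B : ι → Polynomial ℝ), (∀ t, F t * A.eval t ^ 2 = ∑ j, (B j).eval t ^ 2) →
    (∀ k < m, A.coeff k = 0) → F 0 * A.coeff m ^ 2 = ∑ j, (B j).coeff m ^ 2 := by
  intro m
  induction m with
  | zero =>
    intro A B h _
    have := h 0
    simpa [Polynomial.coeff_zero_eq_eval_zero] using this
  | succ m ih =>
    intro A B h hA
    have hA0 : A.coeff 0 = 0 := hA 0 (by omega)
    have hAX : ∀ t, A.eval t = A.divX.eval t * t := by
      intro t
      conv_lhs => rw [← Polynomial.divX_mul_X_add A]
      simp [hA0]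
    have hB0 : ∀ j, (B j).coeff 0 = 0 := by
      have h0 := h 0
      rw [hAX 0, mul_zero] at h0
      simp only [ne_eq, OfNat.ofNat_ne_zero, not_false_eq_true, zero_pow, mul_zero] at h0
      have := (Finset.sum_eq_zero_iff_of_nonneg (fun j _ => sq_nonneg _)).1 h0.symm
      intro j
      rw [Polynomial.coeff_zero_eq_eval_zero]
      simpa using this j (Finset.mem_univ j)
    have hBX : ∀ j t, (B j).eval t = (B j).divX.eval t * t := by
      intro j t
      conv_lhs => rw [← Polynomial.divX_mul_X_add (B j)]
      simp [hB0]
    have key := ih A.divX (fun j => (B j).divX) (by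
      have : (fun t => F t * A.divX.eval t ^ 2) = fun t => ∑ j, ((B j).divX).eval t ^ 2 := by
        apply Continuous.ext_on (s := ({0} : Set ℝ)ᶜ) (dense_compl_singleton 0)
        · exact hF.mul (A.divX.continuous.pow 2)
        · exact continuous_finsetSum _ (fun j _ => ((B j).divX.continuous.pow 2))
        · intro t ht
          have ht0 : t ≠ 0 := ht
          have h1 := h t
          simp only [hAX, hBX, mul_pow, ← Finset.sum_mul] at h1
          rw [← mul_assoc] at h1
          exact mul_right_cancel₀ (pow_ne_zero 2 ht0) h1
      exact fun t => congrFun this t) (by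
      intro k hk
      rw [Polynomial.coeff_divX]
      exact hA _ (by omega))
    simpa [Polynomial.coeff_divX] using key

theorem line_trick {ι : Type} [Fintype ι] (f : (Fin n → ℝ) → ℝ) (hf : Continuous f)
    (a : MvPolynomial (Fin n) ℝ) (ha : a ≠ 0) (B : ι → MvPolynomial (Fin n) ℝ)
    (hB : ∀ x, f x * MvPolynomial.eval x a ^ 2 = ∑ j, MvPolynomial.eval x (B j) ^ 2)
    (V : Set (Fin n → ℝ)) (hV : V.Nonempty) :
    ∃ (a' : MvPolynomial (Fin n) ℝ) (B' : ι → MvPolynomial (Fin n) ℝ),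
      (∀ x ∈ V, f x * MvPolynomial.eval x a' ^ 2 = ∑ j, MvPolynomial.eval x (B' j) ^ 2) ∧
      ∃ x ∈ V, MvPolynomial.eval x a' ≠ 0 := by
  classical
  obtain ⟨x0, hx0⟩ := hV
  obtain ⟨y, hy⟩ := exists_eval_ne a ha
  have hne := line_ne a x0 y hy
  set b := fun k => y k - x0 k
  have hex : ∃ m, ∃ x ∈ V, MvPolynomial.eval x ((line b a).coeff m) ≠ 0 := by
    by_contra hcon
    push Not at hcon
    apply hne
    ext m
    rw [Polynomial.coeff_map, hcon m x0 hx0, Polynomial.coeff_zero]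
  have hm := Nat.find_spec hex
  have hmin : ∀ k < Nat.find hex, ∀ x ∈ V, MvPolynomial.eval x ((line b a).coeff k) = 0 := by
    intro k hk x hx
    by_contra h
    exact Nat.find_min hex hk ⟨x, hx, h⟩
  generalize Nat.find hex = m at hm hmin
  refine ⟨(line b a).coeff m, fun j => (line b (B j)).coeff m, ?_, hm⟩
  intro x hx
  have := univ (fun t => f (fun k => x k + b k * t)) (by fun_prop) m
    ((line b a).map (MvPolynomial.eval x)) (fun j => (line b (B j)).map (MvPolynomial.eval x))
    (by
      intro t
      simp only [line_eval]
      exact hB _)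
    (by
      intro k hk
      rw [Polynomial.coeff_map]
      exact hmin k hk x hx)
  simpa [Polynomial.coeff_map] using this

theorem main_ind {ι : Type} [Fintype ι] (f : (Fin n → ℝ) → ℝ) (hf : Regulous n f)
    (hf0 : ∀ x, 0 ≤ f x)
    (a : MvPolynomial (Fin n) ℝ) (ha : a ≠ 0) (B : ι → MvPolynomial (Fin n) ℝ)
    (hB : ∀ x, f x * MvPolynomial.eval x a ^ 2 = ∑ j, MvPolynomial.eval x (B j) ^ 2)
    (I : Ideal (MvPolynomial (Fin n) ℝ)) :
    ∃ s, SR n s ∧ ∀ x, (∀ p ∈ I, MvPolynomial.eval x p = 0) → s x = f x := by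
  classical
  induction I using WellFoundedGT.induction with
  | _ I ih =>
    by_cases hV : {x : Fin n → ℝ | ∀ p ∈ I, MvPolynomial.eval x p = 0}.Nonempty
    swap
    · exact ⟨_, SR.zero, fun x hx => absurd ⟨x, hx⟩ hV⟩
    obtain ⟨a', B', hB', x1, hx1, hx1'⟩ := line_trick f hf.1 a ha B hB _ hV
    have hlt : I < I ⊔ Ideal.span {a'} := by
      refine lt_of_le_of_ne le_sup_left ?_
      intro h
      apply hx1'
      apply hx1
      rw [h]
      exact (le_sup_right : _ ≤ I ⊔ Ideal.span {a'}) (Ideal.mem_span_singleton_self a')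
    obtain ⟨s', hs', hs'f⟩ := ih _ hlt
    have hs'V : ∀ x, (∀ p ∈ I, MvPolynomial.eval x p = 0) → MvPolynomial.eval x a' = 0 →
        s' x = f x := by
      intro x hx hxa
      apply hs'f
      have hle : I ⊔ Ideal.span {a'} ≤ RingHom.ker (MvPolynomial.eval x) := by
        rw [sup_le_iff]
        constructor
        · intro p hp; exact hx p hp
        · rw [Ideal.span_singleton_le_iff_mem]; exact hxa
      intro p hp
      exact hle hp
    obtain ⟨T, hT⟩ := (inferInstance : IsNoetherianRing (MvPolynomial (Fin n) ℝ)).noetherian I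
    have hTV : ∀ x, ∑ p : T, MvPolynomial.eval x p.1 ^ 2 = 0 →
        ∀ p ∈ I, MvPolynomial.eval x p = 0 := by
      intro x hx
      have h1 := (Finset.sum_eq_zero_iff_of_nonneg (fun j _ => sq_nonneg _)).1 hx
      have hle : I ≤ RingHom.ker (MvPolynomial.eval x) := by
        rw [← hT]
        apply Ideal.span_le.2
        intro p hp
        have := h1 ⟨p, hp⟩ (Finset.mem_univ _)
        simpa using this
      exact fun p hp => hle hp
    have hVT : ∀ x, (∀ p ∈ I, MvPolynomial.eval x p = 0) →
        ∑ p : T, MvPolynomial.eval x p.1 ^ 2 = 0 := by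
      intro x hx
      apply Finset.sum_eq_zero
      rintro ⟨p, hp⟩ _
      have : p ∈ I := by rw [← hT]; exact Ideal.subset_span hp
      simp [hx p this]
    have hw := reg_sub hf hs'.reg
    obtain ⟨h, hSR, hh⟩ := trick (w := fun x => f x - s' x) hf hf0 hw
      (SR.sq (reg_poly a')) ((SR.sum_sq B').add (SR.sum_sq (fun p : T => p.1))) (by
        intro x hfx hwx hab
        obtain ⟨h1, h2⟩ := hab
        have h3 : 0 ≤ ∑ j, MvPolynomial.eval x (B' j) ^ 2 := by positivity
        have h4 : 0 ≤ ∑ p : T, MvPolynomial.eval x p.1 ^ 2 := by positivity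
        have h5 : ∑ p : T, MvPolynomial.eval x p.1 ^ 2 = 0 := by linarith
        apply hwx
        have := hs'V x (hTV x h5) (by simpa using h1)
        simp only [this, sub_self])
    have hhV : ∀ x, (∀ p ∈ I, MvPolynomial.eval x p = 0) → h x = f x * (f x - s' x) ^ 2 := by
      intro x hx
      apply hh x
      · simp only [hVT x hx, add_zero]
        exact (hB' x hx).symm
      · by_cases hxa : MvPolynomial.eval x a' = 0
        · right; right
          simp only [hs'V x hx hxa, sub_self]
        · left
          exact pow_ne_zero 2 hxa
    obtain ⟨s, hs, hsf⟩ := trick (w := fun _ => 1) (α := fun x => f x ^ 2 + s' x ^ 2)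
      (β := fun x => h x + s' x * ((f x ^ 2) + (f x ^ 2))) hf hf0 (reg_const 1)
      ((SR.sq hf).add (SR.sq hs'.reg)) (hSR.add (hs'.mul ((SR.sq hf).add (SR.sq hf)))) (by
        intro x hfx _ hab
        have h1 := hab.1
        have h2 : 0 < f x ^ 2 := by positivity
        nlinarith [sq_nonneg (s' x)])
    refine ⟨s, hs, fun x hx => ?_⟩
    have := hsf x (by rw [hhV x hx]; ring) (by
      by_cases hfx : f x = 0
      · right; left; exact hfx
      · left
        have h2 : 0 < f x ^ 2 := by positivity
        have h3 : 0 < f x ^ 2 + s' x ^ 2 := by nlinarith [sq_nonneg (s' x)]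
        exact h3.ne')
    rw [this]; ring

lemma sumsq_family {b : MvPolynomial (Fin n) ℝ} (hb : IsSumSq b) :
    ∃ (ι : Type) (_ : Fintype ι) (B : ι → MvPolynomial (Fin n) ℝ), b = ∑ j, B j ^ 2 := by
  induction hb with
  | zero => exact ⟨Empty, inferInstance, fun i => i.elim, by simp⟩
  | sq_add c hs ih =>
    obtain ⟨ι, _, B, h⟩ := ih
    refine ⟨Option ι, inferInstance, fun o => o.elim c B, ?_⟩
    rw [Fintype.sum_option, h]
    simp [pow_two]

end reg
end H17

/-- STATEMENT 8: every non-negative regulous function on `ℝ^n` is a sum of squares of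
regulous functions. -/
theorem nonneg_regulous_is_sum_of_squares_of_regulous
    (n : ℕ) (hn : 1 ≤ n) (f : (Fin n → ℝ) → ℝ) (hf : Regulous n f)
    (hpos : ∀ x, 0 ≤ f x) :
    ∃ (m : ℕ) (F : Fin m → (Fin n → ℝ) → ℝ), (∀ i, Regulous n (F i)) ∧
      ∀ x, f x = ∑ i, F i x ^ 2 := by
  obtain ⟨p, q, hq, hpq⟩ := hf.2
  have h1 : ∀ x, f x * eval x q ^ 2 = eval x (p * q) := by
    intro x
    by_cases hx : eval x q = 0
    · simp [hx]
    · rw [hpq x hx, map_mul]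
      field_simp
  obtain ⟨A, b, hA, hb, hAb⟩ := H17.hilbert17 n (p * q) (fun x => by
    rw [← h1]; exact mul_nonneg (hpos x) (sq_nonneg _))
  obtain ⟨ι, _, B, hB⟩ := H17.sumsq_family hb
  obtain ⟨s, ⟨κ, _, F, hF, hs⟩, hsf⟩ := H17.main_ind f hf hpos (q * A) (mul_ne_zero hq hA) B (by
    intro x
    have h2 := congrArg (eval x) (hAb.trans hB)
    rw [map_mul, ← h1 x] at h2
    simp only [map_sum, map_pow] at h2
    rw [← h2, map_mul]
    ring) ⊥
  refine ⟨Fintype.card κ, fun i => F ((Fintype.equivFin κ).symm i), fun i => hF _, fun x => ?_⟩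
  rw [← hsf x (fun p hp => by rw [Ideal.mem_bot.1 hp, map_zero]), hs x]
  exact (Equiv.sum_comp (Fintype.equivFin κ).symm (fun i => F i x ^ 2)).symm
end
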